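/- arXiv:2404.12574 — 3 statements merged into one kernel-verified Lean document; each statement's English description precedes it below -/
import Mathlib

section
/- Let z* be a minimiser of Problem (P) for the data (z0, v0, zf, vf, t_f), and let 0 ≤ t1 < t2 ≤ t_f. Then the restriction of z* to [t1, t2] is a minimiser for the inherited data: every continuously differentiable curve w : [t1, t2] → ℝ² with Lipschitz derivative, ‖ẇ(t)‖ = 1 for all t, w(t1) = z*(t1), w(t2) = z*(t2), ẇ(t1) = ż*(t1) and ẇ(t2) = ż*(t2), has maximum curvature at least that of the restriction of z* to [t1, t2]. -/
open Set MeasureTheory Real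

noncomputable section

/-- Points of the Euclidean plane. -/
abbrev Pt : Type := EuclideanSpace ℝ (Fin 2)

/-- The point of the plane with coordinates `(x, y)`. -/
def pt (x y : ℝ) : Pt := (WithLp.equiv 2 (Fin 2 → ℝ)).symm ![x, y]

/-- Rotation of the plane by `π/2`. -/
def J (v : Pt) : Pt := pt (-(v 1)) (v 0)

/-- `z`, with derivative `z'`, is an admissible curve on `[t1, t2]` for the oriented
endpoint data `(p0, u0)`, `(p1, u1)`: it is differentiable with Lipschitz (hence
continuous) derivative `z'`, has unit speed, and matches the endpoint data. -/
def AdmissibleOn (t1 t2 : ℝ) (p0 u0 p1 u1 : Pt) (z z' : ℝ → Pt) : Prop :=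
  (∀ t ∈ Icc t1 t2, HasDerivWithinAt z (z' t) (Icc t1 t2) t) ∧
  (∃ K : NNReal, LipschitzOnWith K z' (Icc t1 t2)) ∧
  (∀ t ∈ Icc t1 t2, ‖z' t‖ = 1) ∧
  z t1 = p0 ∧ z t2 = p1 ∧ z' t1 = u0 ∧ z' t2 = u1

/-- The maximum curvature of a unit-speed curve with derivative `z'` on the set `s`:
the least Lipschitz constant of `z'` on `s` (equivalently, the essential supremum
of the norm of the second derivative). -/
def maxCurvOn (s : Set ℝ) (z' : ℝ → Pt) : ℝ :=
  sInf {a : ℝ | 0 ≤ a ∧ LipschitzOnWith (Real.toNNReal a) z' s}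

/-- The piece `[s1, s2]` of the unit-speed curve with derivative `z'` is a circular
arc of signed curvature `ω`: `z'' = ω • J z'` a.e. there. -/
def IsArcOn (z' : ℝ → Pt) (ω s1 s2 : ℝ) : Prop :=
  ∀ᵐ t ∂volume, t ∈ Ioo s1 s2 → HasDerivAt z' (ω • J (z' t)) t

/-- The piece `[s1, s2]` of the unit-speed curve with derivative `z'` is a straight
line segment: `z'` is constant there. -/
def IsLineOn (z' : ℝ → Pt) (s1 s2 : ℝ) : Prop :=
  ∀ s ∈ Icc s1 s2, ∀ t ∈ Icc s1 s2, z' s = z' t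

/-- The piece `[s1, s2]` is a full circular loop of curvature `a`: a circular arc of
signed curvature `±a` whose turning angle is a positive integer multiple of `2π`. -/
def IsFullLoopOn (z' : ℝ → Pt) (a s1 s2 : ℝ) : Prop :=
  ∃ ω : ℝ, |ω| = a ∧ IsArcOn z' ω s1 s2 ∧ ∃ k : ℕ, 0 < k ∧ a * (s2 - s1) = 2 * π * k


lemma exp_est (r x y : ℝ) (hx : |x| ≤ r) (hy : |y| ≤ r) :
    ‖Complex.exp (Complex.I * x) - Complex.exp (Complex.I * y) - Complex.I * (x - y)‖ ≤ r * |x - y| := by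
  have key := Convex.norm_image_sub_le_of_norm_hasDerivWithin_le (𝕜 := ℝ)
    (f := fun x : ℝ => Complex.exp (Complex.I * x) - Complex.I * x)
    (f' := fun x : ℝ => Complex.exp (Complex.I * x) * Complex.I - Complex.I)
    (s := Icc (-r) r) (C := r) (x := y) (y := x) ?_ ?_ (convex_Icc _ _) (abs_le.1 hy) (abs_le.1 hx)
  · rw [Real.norm_eq_abs] at key
    refine le_trans (le_of_eq ?_) key
    congr 1; ring
  · intro t _
    have h0 : HasDerivAt (fun x : ℝ => Complex.I * (x:ℂ)) Complex.I t := by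
      simpa using (Complex.ofRealCLM.hasDerivAt (x := t)).const_mul Complex.I
    exact (h0.cexp.sub h0).hasDerivWithinAt
  · intro t ht
    have : Complex.exp (Complex.I * t) * Complex.I - Complex.I = (Complex.exp (Complex.I * t) - 1) * Complex.I := by ring
    rw [this, norm_mul, Complex.norm_I, mul_one]
    exact (Real.norm_exp_I_mul_ofReal_sub_one_le).trans (abs_le.2 ht)

/-- the angular perturbation -/
def Psi (f : ℝ → ℂ) (t1 t2 : ℝ) (c : ℂ) (s : ℝ) : ℝ :=
  (s - t1) * (t2 - s) * ((starRingEnd ℂ) c * f s).re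

lemma Psi_cont (f : ℝ → ℂ) (hf : Continuous f) (t1 t2 : ℝ) (c : ℂ) : Continuous (Psi f t1 t2 c) := by
  unfold Psi; fun_prop

lemma Psi_sub (f : ℝ → ℂ) (t1 t2 : ℝ) (c d : ℂ) (s : ℝ) :
    Psi f t1 t2 (c - d) s = Psi f t1 t2 c s - Psi f t1 t2 d s := by
  unfold Psi; simp; ring

lemma re_le (f : ℝ → ℂ) (hn : ∀ t, ‖f t‖ = 1) (c : ℂ) (s : ℝ) : |((starRingEnd ℂ) c * f s).re| ≤ ‖c‖ := by
  refine (Complex.abs_re_le_norm _).trans ?_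
  simp [hn]

lemma chi_le {t1 t2 s : ℝ} (hs : s ∈ Icc t1 t2) : |(s - t1) * (t2 - s)| ≤ (t2 - t1) ^ 2 := by
  obtain ⟨h1, h2⟩ := hs
  rw [abs_of_nonneg (mul_nonneg (by linarith) (by linarith))]
  nlinarith

lemma Psi_le (f : ℝ → ℂ) (hn : ∀ t, ‖f t‖ = 1) {t1 t2 : ℝ} (c : ℂ) {s : ℝ} (hs : s ∈ Icc t1 t2) :
    |Psi f t1 t2 c s| ≤ (t2 - t1) ^ 2 * ‖c‖ := by
  unfold Psi
  rw [abs_mul]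
  exact mul_le_mul (chi_le hs) (re_le f hn c s) (abs_nonneg _) (sq_nonneg _)

lemma Psi_lip (f : ℝ → ℂ) (hn : ∀ t, ‖f t‖ = 1) {t1 t2 b : ℝ}
    (hb : ∀ s ∈ Icc t1 t2, ∀ t ∈ Icc t1 t2, ‖f s - f t‖ ≤ b * |s - t|) (c : ℂ) {s t : ℝ}
    (hs : s ∈ Icc t1 t2) (ht : t ∈ Icc t1 t2) :
    |Psi f t1 t2 c s - Psi f t1 t2 c t| ≤ ((t2 - t1) + (t2 - t1) ^ 2 * b) * ‖c‖ * |s - t| := by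
  unfold Psi
  have e : (s - t1) * (t2 - s) * ((starRingEnd ℂ) c * f s).re - (t - t1) * (t2 - t) * ((starRingEnd ℂ) c * f t).re
    = (s - t) * (t1 + t2 - s - t) * ((starRingEnd ℂ) c * f s).re
      + (t - t1) * (t2 - t) * ((starRingEnd ℂ) c * (f s - f t)).re := by
    simp; ring
  rw [e]
  refine (abs_add_le _ _).trans ?_
  rw [abs_mul, abs_mul (a := (t - t1) * (t2 - t)), abs_mul]
  have i1 : |t1 + t2 - s - t| ≤ t2 - t1 := by
    rw [abs_le]; constructor <;> linarith [hs.1, hs.2, ht.1, ht.2]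
  have i2 := re_le f hn c s
  have i3 : |((starRingEnd ℂ) c * (f s - f t)).re| ≤ ‖c‖ * (b * |s - t|) := by
    refine (Complex.abs_re_le_norm _).trans ?_
    rw [norm_mul, RCLike.norm_conj]
    exact mul_le_mul_of_nonneg_left (hb s hs t ht) (norm_nonneg _)
  have j1 : |s - t| * |t1 + t2 - s - t| * |((starRingEnd ℂ) c * f s).re| ≤ |s - t| * (t2 - t1) * ‖c‖ := by
    have : 0 ≤ t2 - t1 := by linarith [hs.1, hs.2]
    gcongr
  have j2 := mul_le_mul (chi_le ht) i3 (abs_nonneg _) (sq_nonneg _)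
  linarith

def HH (f : ℝ → ℂ) (t1 t2 : ℝ) (c : ℂ) : ℂ :=
  ∫ s in t1..t2, f s * Complex.exp (Complex.I * (Psi f t1 t2 c s : ℝ))

def LL (f : ℝ → ℂ) (hf : Continuous f) (t1 t2 : ℝ) : ℂ →ₗ[ℝ] ℂ where
  toFun c := ∫ s in t1..t2, f s * (Complex.I * (Psi f t1 t2 c s : ℝ))
  map_add' c d := by
    rw [← intervalIntegral.integral_add]
    · congr 1; ext s; unfold Psi; push_cast; simp; ring
    all_goals
      have := Psi_cont f hf t1 t2
      exact Continuous.intervalIntegrable (by fun_prop) _ _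
  map_smul' r c := by
    rw [RingHom.id_apply, ← intervalIntegral.integral_smul]
    congr 1; ext s; unfold Psi; push_cast; simp; ring

lemma const_of_perp (f : ℝ → ℂ) (hf : Continuous f) (hn : ∀ t, ‖f t‖ = 1) (t1 t2 : ℝ) (c : ℂ) (hc : c ≠ 0)
    (h : ∀ s ∈ Icc t1 t2, ((starRingEnd ℂ) c * f s).re = 0) (s : ℝ) (hs : s ∈ Icc t1 t2) : f s = f t1 := by
  have hcn : 0 < ‖c‖ := norm_pos_iff.2 hc
  have ht1 : t1 ∈ Icc t1 t2 := ⟨le_rfl, hs.1.trans hs.2⟩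
  let k : ℝ → ℝ := fun s => ((starRingEnd ℂ) c * f s).im
  have hk : Continuous k := by simp only [k]; fun_prop
  have hk2 : ∀ s ∈ Icc t1 t2, k s ^ 2 = ‖c‖ ^ 2 := by
    intro s hs
    have := Complex.sq_norm ((starRingEnd ℂ) c * f s)
    rw [Complex.normSq_apply, h s hs, norm_mul, RCLike.norm_conj, hn] at this
    simp only [k]; linarith
  have : k s = k t1 := by
    by_contra hne
    have e : k s ^ 2 = k t1 ^ 2 := by rw [hk2 s hs, hk2 t1 ht1]
    have e2 : k s = - k t1 := by
      rcases sq_eq_sq_iff_eq_or_eq_neg.1 e with e | e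
      · exact absurd e hne
      · exact e
    have h0 : (0:ℝ) ∈ uIcc (k t1) (k s) := by
      rw [e2, mem_uIcc]
      rcases le_total 0 (k t1) with h | h
      · right; constructor <;> linarith
      · left; constructor <;> linarith
    obtain ⟨u, hu, hu0⟩ := intermediate_value_uIcc (hk.continuousOn (s := uIcc t1 s)) h0
    rw [uIcc_of_le hs.1] at hu
    have := hk2 u ⟨hu.1, hu.2.trans hs.2⟩
    rw [hu0] at this
    have : 0 < ‖c‖ ^ 2 := by positivity
    simp at *; linarith
  have hc' : (starRingEnd ℂ) c ≠ 0 := by simpa using hc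
  apply mul_left_cancel₀ hc'
  apply Complex.ext
  · rw [h s hs, h t1 ht1]
  · exact this

lemma HH_open (f : ℝ → ℂ) (hf : Continuous f) (hn : ∀ t, ‖f t‖ = 1) (t1 t2 : ℝ) (h12 : t1 < t2)
    (hnc : ¬ ∀ s ∈ Icc t1 t2, f s = f t1) (U : Set ℂ) (hU : U ∈ nhds (0:ℂ)) :
    HH f t1 t2 '' U ∈ nhds (HH f t1 t2 0) := by
  have hPc := Psi_cont f hf t1 t2
  have hinj : Function.Injective (LL f hf t1 t2) := by
    rw [injective_iff_map_eq_zero]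
    intro c hc
    by_contra hc0
    apply hnc
    apply const_of_perp f hf hn t1 t2 c hc0
    have e : ∫ s in t1..t2, (s - t1) * (t2 - s) * ((starRingEnd ℂ) c * f s).re ^ 2 = 0 := by
      let M : ℂ →L[ℝ] ℝ := Complex.imCLM.comp (ContinuousLinearMap.mul ℝ ℂ ((starRingEnd ℂ) c))
      have := M.intervalIntegral_comp_comm (a := t1) (b := t2) (μ := volume) (f := fun s => f s * (Complex.I * (Psi f t1 t2 c s : ℝ)))
        (Continuous.intervalIntegrable (by fun_prop) _ _)
      have h0 : ∫ s in t1..t2, f s * (Complex.I * (Psi f t1 t2 c s : ℝ)) = 0 := hc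
      rw [h0, map_zero] at this
      rw [← this]
      congr 1; ext s
      simp [M, Psi]; ring
    by_contra hne
    push Not at hne
    obtain ⟨s0, hs0, hne⟩ := hne
    -- find an interior point
    have hcl : s0 ∈ closure (Ioo t1 t2) := by rw [closure_Ioo h12.ne]; exact hs0
    have hop : IsOpen {s | ((starRingEnd ℂ) c * f s).re ≠ 0} :=
      isOpen_ne_fun (by fun_prop) continuous_const
    obtain ⟨s, hs, hs'⟩ := mem_closure_iff.1 hcl _ hop hne
    have : 0 < ∫ s in t1..t2, (s - t1) * (t2 - s) * ((starRingEnd ℂ) c * f s).re ^ 2 := by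
      apply intervalIntegral.integral_pos h12
      · exact Continuous.continuousOn (by fun_prop)
      · intro x hx
        have : 0 ≤ x - t1 := by linarith [hx.1]
        have : 0 ≤ t2 - x := by linarith [hx.2]
        positivity
      · refine ⟨s, ⟨hs'.1.le, hs'.2.le⟩, ?_⟩
        have : 0 < s - t1 := by linarith [hs'.1]
        have : 0 < t2 - s := by linarith [hs'.2]
        have : 0 < ((starRingEnd ℂ) c * f s).re ^ 2 := by
          have h : ((starRingEnd ℂ) c * f s).re ≠ 0 := hs
          positivity
        positivity
    linarith
  have hsurj : Function.Surjective (LL f hf t1 t2) := LinearMap.injective_iff_surjective.1 hinj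
  have hd : HasStrictFDerivAt (HH f t1 t2) (LinearMap.toContinuousLinearMap (LL f hf t1 t2)) 0 := by
    apply HasStrictFDerivAt.of_isLittleO
    rw [Asymptotics.isLittleO_iff]
    intro η hη
    set l := t2 - t1 with hl
    have hl0 : 0 < l := by linarith
    have hrho : 0 < η / l ^ 5 := by positivity
    have : Metric.ball (0:ℂ) (η / l ^ 5) ×ˢ Metric.ball (0:ℂ) (η / l ^ 5) ∈ nhds ((0:ℂ), (0:ℂ)) :=
      prod_mem_nhds (Metric.ball_mem_nhds _ hrho) (Metric.ball_mem_nhds _ hrho)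
    filter_upwards [this] with p hp
    obtain ⟨c, d⟩ := p
    obtain ⟨hc, hd⟩ := hp
    simp only [Metric.mem_ball, dist_zero_right] at hc hd
    have e : HH f t1 t2 c - HH f t1 t2 d - (LL f hf t1 t2) (c - d) =
      ∫ s in t1..t2, f s * (Complex.exp (Complex.I * (Psi f t1 t2 c s : ℝ)) - Complex.exp (Complex.I * (Psi f t1 t2 d s : ℝ))
        - Complex.I * ((Psi f t1 t2 c s : ℝ) - (Psi f t1 t2 d s : ℝ))) := by
      show HH f t1 t2 c - HH f t1 t2 d - ∫ s in t1..t2, f s * (Complex.I * (Psi f t1 t2 (c - d) s : ℝ)) = _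
      unfold HH
      rw [← intervalIntegral.integral_sub, ← intervalIntegral.integral_sub]
      · congr 1; ext s; rw [Psi_sub]; push_cast; ring
      all_goals exact Continuous.intervalIntegrable (by fun_prop) _ _
    rw [LinearMap.coe_toContinuousLinearMap', e]
    refine (intervalIntegral.norm_integral_le_of_norm_le_const (C := (l ^ 2 * (η / l ^ 5)) * (l ^ 2 * ‖c - d‖)) ?_).trans ?_
    · intro s hs
      rw [uIoc_of_le h12.le] at hs
      have hs' : s ∈ Icc t1 t2 := ⟨hs.1.le, hs.2⟩
      rw [norm_mul, hn, one_mul]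
      refine (exp_est (l ^ 2 * (η / l ^ 5)) _ _ ?_ ?_).trans ?_
      · refine (Psi_le f hn c hs').trans ?_
        gcongr
      · refine (Psi_le f hn d hs').trans ?_
        gcongr
      · rw [← Psi_sub]
        have := Psi_le f hn (c - d) hs'
        gcongr
    · rw [← hl, abs_of_pos hl0]
      apply le_of_eq
      field_simp
  rw [← hd.map_nhds_eq_of_surj (by rw [LinearMap.range_eq_top]; exact hsurj)]
  exact Filter.image_mem_map hU

/-- `f` has Lipschitz constant `K` on `[p, q]`. -/
def LB {E : Type*} [NormedAddCommGroup E] (K p q : ℝ) (f : ℝ → E) : Prop :=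
  ∀ s ∈ Icc p q, ∀ t ∈ Icc p q, ‖f s - f t‖ ≤ K * |s - t|

lemma LB.cont {E : Type*} [NormedAddCommGroup E] {K p q : ℝ} {f : ℝ → E} (h : LB K p q f) :
    ContinuousOn f (Icc p q) := by
  have : LipschitzOnWith (Real.toNNReal K) f (Icc p q) := by
    apply LipschitzOnWith.of_dist_le_mul
    intro s hs t ht
    rw [dist_eq_norm, Real.dist_eq]
    refine (h s hs t ht).trans ?_
    gcongr
    exact Real.le_coe_toNNReal K
  exact this.continuousOn

lemma LB.mono {E : Type*} [NormedAddCommGroup E] {K K' p q : ℝ} {f : ℝ → E} (h : LB K p q f)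
    (hK : K ≤ K') : LB K' p q f := by
  intro s hs t ht
  refine (h s hs t ht).trans ?_
  gcongr

lemma LB.sub {E : Type*} [NormedAddCommGroup E] {K p q p' q' : ℝ} {f : ℝ → E} (h : LB K p q f)
    (hp : p ≤ p') (hq : q' ≤ q) : LB K p' q' f := by
  intro s hs t ht
  exact h s ⟨hp.trans hs.1, hs.2.trans hq⟩ t ⟨hp.trans ht.1, ht.2.trans hq⟩

lemma LB.congr {E : Type*} [NormedAddCommGroup E] {K p q : ℝ} {f g : ℝ → E} (h : LB K p q f)
    (he : ∀ s ∈ Icc p q, g s = f s) : LB K p q g := by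
  intro s hs t ht
  rw [he s hs, he t ht]
  exact h s hs t ht

lemma LB.glue {E : Type*} [NormedAddCommGroup E] {K p q r : ℝ} {f : ℝ → E}
    (h : LB K p q f) (h' : LB K q r f) : LB K p r f := by
  have main : ∀ s ∈ Icc p r, ∀ t ∈ Icc p r, s ≤ t → ‖f s - f t‖ ≤ K * |s - t| := by
    intro s hs t ht hst
    rcases le_total t q with h1 | h1
    · exact h s ⟨hs.1, hst.trans h1⟩ t ⟨ht.1, h1⟩
    rcases le_total q s with h2 | h2
    · exact h' s ⟨h2, hs.2⟩ t ⟨h1, ht.2⟩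
    have a1 := h s ⟨hs.1, h2⟩ q ⟨hs.1.trans h2, le_rfl⟩
    have a2 := h' q ⟨le_rfl, h1.trans ht.2⟩ t ⟨h1, ht.2⟩
    have e : f s - f t = (f s - f q) + (f q - f t) := by abel
    rw [e]
    refine (norm_add_le _ _).trans ((add_le_add a1 a2).trans (le_of_eq ?_))
    rw [abs_of_nonpos (by linarith), abs_of_nonpos (by linarith), abs_of_nonpos (by linarith)]
    ring
  intro s hs t ht
  rcases le_total s t with h1 | h1
  · exact main s hs t ht h1
  · rw [norm_sub_rev, abs_sub_comm]; exact main t ht s hs h1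

lemma LB.comp_aff {E : Type*} [NormedAddCommGroup E] {K p q p' q' d c : ℝ} {f : ℝ → E} (h : LB K p q f)
    (hc : 0 < c) (hp : d + p' / c = p) (hq : d + q' / c = q) :
    LB (K / c) p' q' (fun t => f (d + t / c)) := by
  have hm : ∀ s ∈ Icc p' q', d + s / c ∈ Icc p q := by
    intro s hs
    have h1 : p' / c ≤ s / c := div_le_div_of_nonneg_right hs.1 hc.le
    have h2 : s / c ≤ q' / c := div_le_div_of_nonneg_right hs.2 hc.le
    constructor <;> linarith
  intro s hs t ht
  refine (h _ (hm s hs) _ (hm t ht)).trans (le_of_eq ?_)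
  have : d + s / c - (d + t / c) = (s - t) / c := by ring
  rw [this, abs_div, abs_of_pos hc]
  ring

theorem key (f : ℝ → ℂ) (hf : Continuous f) (hn : ∀ t, ‖f t‖ = 1) (T t1 t2 a b : ℝ)
    (h1 : 0 ≤ t1) (h12 : t1 < t2) (h2 : t2 ≤ T) (hb : 0 ≤ b) (hab : b < a)
    (haL : LB a 0 T f) (hbL : LB b t1 t2 f) (hnc : ¬ ∀ s ∈ Icc t1 t2, f s = f t1) :
    ∃ (g : ℝ → ℂ) (a' : ℝ), 0 ≤ a' ∧ a' < a ∧ LB a' 0 T g ∧ (∀ t, ‖g t‖ = 1) ∧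
      g 0 = f 0 ∧ g T = f T ∧ ∫ t in (0:ℝ)..T, g t = ∫ t in (0:ℝ)..T, f t := by
  set l := t2 - t1 with hl
  have hl0 : 0 < l := by linarith
  set m := (T - l) / l with hm
  set A0 := ∫ t in (0:ℝ)..t1, f t with hA0
  set A2 := ∫ t in t2..T, f t with hA2
  set M := l + l ^ 2 * b with hM
  have hM0 : 0 < M := by positivity
  set ρ := (a - b) / 2 / M with hρ
  have hρ0 : 0 < ρ := by
    have : 0 < a - b := by linarith
    positivity
  have hopen := HH_open f hf hn t1 t2 h12 hnc (Metric.ball 0 ρ) (Metric.ball_mem_nhds _ hρ0)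
  set H0 := HH f t1 t2 0 with hH0
  have hH0' : H0 = ∫ t in t1..t2, f t := by
    simp [hH0, HH, Psi]
  have tend1 : Filter.Tendsto (fun ε : ℝ => (1 - ε * m)) (nhdsWithin 0 (Ioi 0)) (nhds 1) := by
    have : Continuous (fun ε : ℝ => (1 - ε * m)) := by fun_prop
    have := this.tendsto 0
    simp only [zero_mul, sub_zero] at this
    exact this.mono_left nhdsWithin_le_nhds
  have tend2 : Filter.Tendsto (fun ε : ℝ => (a + b) / 2 / (1 - ε * m)) (nhdsWithin 0 (Ioi 0)) (nhds ((a + b) / 2)) := by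
    have := (tendsto_const_nhds (x := (a + b) / 2)).div tend1 one_ne_zero
    rw [div_one] at this
    exact this
  have tend3 : Filter.Tendsto (fun ε : ℝ => (1 - ε * m)⁻¹ • (H0 - ε • (A0 + A2))) (nhdsWithin 0 (Ioi 0)) (nhds H0) := by
    have c1 : Continuous (fun ε : ℝ => (H0 - ε • (A0 + A2))) := by fun_prop
    have c2 := (c1.tendsto 0).mono_left (nhdsWithin_le_nhds (s := Ioi 0))
    have := (tend1.inv₀ one_ne_zero).smul c2
    simpa using this
  have ev1 := tend1.eventually (lt_mem_nhds (show (0:ℝ) < 1 by norm_num))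
  have ev2 := tend2.eventually (gt_mem_nhds (show (a + b) / 2 < a by linarith))
  have ev3 := tend3.eventually hopen
  obtain ⟨ε, ⟨⟨hμ, hlt⟩, c, hc, hHc⟩, hε⟩ := (((ev1.and ev2).and ev3).and self_mem_nhdsWithin).exists
  rw [Metric.mem_ball, dist_zero_right] at hc
  set μ := 1 - ε * m with hμdef
  set ν := 1 + ε with hν
  have hν0 : 0 < ν := by linarith
  set s1 := ν * t1 with hs1
  set s2 := T - ν * (T - t2) with hs2
  have hs12 : s2 - s1 = l * μ := by
    rw [hs2, hs1, hμdef, hm, hν, hl]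
    have : t2 - t1 ≠ 0 := hl0.ne'
    field_simp
    ring
  have hs1lt : s1 < s2 := by
    have : 0 < l * μ := by positivity
    linarith
  have hs10 : 0 ≤ s1 := by positivity
  have hs2T : s2 ≤ T := by
    have : 0 ≤ ν * (T - t2) := mul_nonneg hν0.le (by linarith)
    linarith
  set h : ℝ → ℂ := fun s => f s * Complex.exp (Complex.I * (Psi f t1 t2 c s : ℝ)) with hh
  have hht1 : h t1 = f t1 := by simp [hh, Psi]
  have hht2 : h t2 = f t2 := by simp [hh, Psi]
  have hhn : ∀ t, ‖h t‖ = 1 := by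
    intro t
    simp only [hh]
    rw [norm_mul, hn, mul_comm Complex.I, Complex.norm_exp_ofReal_mul_I, one_mul]
  have hhL : LB ((a + b) / 2) t1 t2 h := by
    intro s hs t ht
    have e : h s - h t = (f s - f t) * Complex.exp (Complex.I * (Psi f t1 t2 c s : ℝ))
      + f t * Complex.exp (Complex.I * (Psi f t1 t2 c t : ℝ)) *
        (Complex.exp (Complex.I * ((Psi f t1 t2 c s - Psi f t1 t2 c t : ℝ) : ℂ)) - 1) := by
      have : Complex.exp (Complex.I * (Psi f t1 t2 c t : ℝ)) *
        Complex.exp (Complex.I * ((Psi f t1 t2 c s - Psi f t1 t2 c t : ℝ) : ℂ)) =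
          Complex.exp (Complex.I * (Psi f t1 t2 c s : ℝ)) := by
        rw [← Complex.exp_add]; congr 1; push_cast; ring
      simp only [hh]
      linear_combination (-f t) * this
    rw [e]
    refine (norm_add_le _ _).trans ?_
    have ht1' : ‖f t * Complex.exp (Complex.I * (Psi f t1 t2 c t : ℝ))‖ = 1 := hhn t
    rw [norm_mul, norm_mul _ (_ - _), ht1', mul_comm Complex.I, Complex.norm_exp_ofReal_mul_I, one_mul, mul_one]
    have i1 := hbL s hs t ht
    have i2 := (Real.norm_exp_I_mul_ofReal_sub_one_le (x := Psi f t1 t2 c s - Psi f t1 t2 c t)).trans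
      (Psi_lip f hn hbL c hs ht)
    have i3 : M * ‖c‖ ≤ (a - b) / 2 := by
      have : M * ρ = (a - b) / 2 := by rw [hρ]; field_simp
      rw [← this]; gcongr
    have i4 : M * ‖c‖ * |s - t| ≤ (a - b) / 2 * |s - t| := by gcongr
    linarith
  let g : ℝ → ℂ := fun t => if t ≤ s1 then f (0 + t / ν) else if t ≤ s2 then h ((t1 - s1 / μ) + t / μ)
    else f ((T - T / ν) + t / ν)
  have e1l : 0 + 0 / ν = 0 := by simp
  have e1r : 0 + s1 / ν = t1 := by rw [hs1]; field_simp; ring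
  have e2l : (t1 - s1 / μ) + s1 / μ = t1 := by ring
  have e2r : (t1 - s1 / μ) + s2 / μ = t2 := by
    have : s2 = s1 + l * μ := by linarith
    rw [this, hl]; field_simp; ring
  have e3l : (T - T / ν) + s2 / ν = t2 := by rw [hs2]; field_simp; ring
  have e3r : (T - T / ν) + T / ν = T := by ring
  have g1 : ∀ t ∈ Icc 0 s1, g t = f (0 + t / ν) := by
    intro t ht
    simp only [g]; rw [if_pos ht.2]
  have g2 : ∀ t ∈ Icc s1 s2, g t = h ((t1 - s1 / μ) + t / μ) := by
    intro t ht
    rcases eq_or_lt_of_le ht.1 with he | he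
    · rw [← he, g1 s1 ⟨hs10, le_rfl⟩, e1r, e2l, hht1]
    · simp only [g]; rw [if_neg (not_le.2 he), if_pos ht.2]
  have g3 : ∀ t ∈ Icc s2 T, g t = f ((T - T / ν) + t / ν) := by
    intro t ht
    rcases eq_or_lt_of_le ht.1 with he | he
    · rw [← he, g2 s2 ⟨hs1lt.le, le_rfl⟩, e2r, e3l, hht2]
    · simp only [g]; rw [if_neg (not_le.2 (hs1lt.trans he)), if_neg (not_le.2 he)]
  have L1 : LB (a / ν) 0 s1 g :=
    ((haL.sub le_rfl (h12.le.trans h2)).comp_aff hν0 e1l e1r).congr g1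
  have L2 : LB ((a + b) / 2 / μ) s1 s2 g := (hhL.comp_aff hμ e2l e2r).congr g2
  have L3 : LB (a / ν) s2 T g :=
    ((haL.sub (h1.trans h12.le) le_rfl).comp_aff hν0 e3l e3r).congr g3
  have ha0 : 0 < a := by linarith
  have I1 : ∫ t in (0:ℝ)..s1, g t = ν • A0 := by
    rw [intervalIntegral.integral_congr (g := fun t => f (0 + t / ν))
      (by rw [uIcc_of_le hs10]; exact g1), intervalIntegral.integral_comp_add_div _ hν0.ne', e1l, e1r]
  have I2 : ∫ t in s1..s2, g t = μ • HH f t1 t2 c := by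
    rw [intervalIntegral.integral_congr (g := fun t => h ((t1 - s1 / μ) + t / μ))
      (by rw [uIcc_of_le hs1lt.le]; exact g2), intervalIntegral.integral_comp_add_div _ hμ.ne', e2l, e2r]
    rfl
  have I3 : ∫ t in s2..T, g t = ν • A2 := by
    rw [intervalIntegral.integral_congr (g := fun t => f ((T - T / ν) + t / ν))
      (by rw [uIcc_of_le hs2T]; exact g3), intervalIntegral.integral_comp_add_div _ hν0.ne', e3l, e3r]
  refine ⟨g, max (a / ν) ((a + b) / 2 / μ), ?_, ?_, ?_, ?_, ?_, ?_, ?_⟩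
  · exact le_max_of_le_left (by positivity)
  · apply max_lt _ hlt
    rw [div_lt_iff₀ hν0, hν]
    nlinarith
  · exact (L1.mono (le_max_left _ _)).glue ((L2.mono (le_max_right _ _)).glue (L3.mono (le_max_left _ _)))
  · intro t
    simp only [g]
    split_ifs
    · exact hn _
    · exact hhn _
    · exact hn _
  · rw [g1 0 ⟨le_rfl, hs10⟩, e1l]
  · rw [g3 T ⟨hs2T, le_rfl⟩, e3r]
  · have j1 : IntervalIntegrable g volume 0 s1 := L1.cont.intervalIntegrable_of_Icc hs10
    have j2 : IntervalIntegrable g volume s1 s2 := L2.cont.intervalIntegrable_of_Icc hs1lt.le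
    have j3 : IntervalIntegrable g volume s2 T := L3.cont.intervalIntegrable_of_Icc hs2T
    have k : ∀ p q, IntervalIntegrable f volume p q := fun p q => hf.intervalIntegrable p q
    rw [← intervalIntegral.integral_add_adjacent_intervals (j1.trans j2) j3,
      ← intervalIntegral.integral_add_adjacent_intervals j1 j2,
      ← intervalIntegral.integral_add_adjacent_intervals (k 0 t2) (k t2 T),
      ← intervalIntegral.integral_add_adjacent_intervals (k 0 t1) (k t1 t2), I1, I2, I3, ← hH0', hHc,
      smul_inv_smul₀ hμ.ne', ← hA0, ← hA2, hν]
    simp only [Complex.real_smul]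
    push_cast
    ring

lemma lip_of_LB {E : Type*} [NormedAddCommGroup E] {K p q : ℝ} {f : ℝ → E} (hL : LB K p q f) :
    LipschitzOnWith (Real.toNNReal K) f (Icc p q) := by
  apply LipschitzOnWith.of_dist_le_mul
  intro s hs t ht
  rw [dist_eq_norm, Real.dist_eq]
  refine (hL s hs t ht).trans ?_
  gcongr
  exact Real.le_coe_toNNReal K

lemma LB_of_lip {E : Type*} [NormedAddCommGroup E] {K : NNReal} {p q : ℝ} {f : ℝ → E}
    (hL : LipschitzOnWith K f (Icc p q)) : LB K p q f := by
  intro s hs t ht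
  have := hL.dist_le_mul s hs t ht
  rwa [dist_eq_norm, Real.dist_eq] at this

lemma maxCurv_bdd (s : Set ℝ) (f : ℝ → Pt) :
    BddBelow {a : ℝ | 0 ≤ a ∧ LipschitzOnWith (Real.toNNReal a) f s} := ⟨0, fun _ h => h.1⟩

lemma maxCurv_nonneg (s : Set ℝ) (f : ℝ → Pt) : 0 ≤ maxCurvOn s f :=
  Real.sInf_nonneg fun _ h => h.1

lemma maxCurv_le {K p q : ℝ} {f : ℝ → Pt} (hK : 0 ≤ K) (hL : LB K p q f) :
    maxCurvOn (Icc p q) f ≤ K := csInf_le (maxCurv_bdd _ _) ⟨hK, lip_of_LB hL⟩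

lemma LB_maxCurv {p q : ℝ} {f : ℝ → Pt} (h : ∃ K : NNReal, LipschitzOnWith K f (Icc p q)) :
    LB (maxCurvOn (Icc p q) f) p q f := by
  obtain ⟨K, hK⟩ := h
  have hne : {a : ℝ | 0 ≤ a ∧ LipschitzOnWith (Real.toNNReal a) f (Icc p q)}.Nonempty :=
    ⟨K, K.2, by simpa using hK⟩
  intro s hs t ht
  apply le_of_forall_pos_le_add
  intro η hη
  have hpos : 0 < η / (|s - t| + 1) := by positivity
  obtain ⟨a, ⟨ha0, ha⟩, hlt⟩ := Real.lt_sInf_add_pos hne hpos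
  have h1 := LB_of_lip ha s hs t ht
  rw [Real.coe_toNNReal a ha0] at h1
  have h2 : a ≤ maxCurvOn (Icc p q) f + η / (|s - t| + 1) := hlt.le
  have h3 : a * |s - t| ≤ (maxCurvOn (Icc p q) f + η / (|s - t| + 1)) * |s - t| := by gcongr
  have h4 : η / (|s - t| + 1) * |s - t| ≤ η := by
    rw [div_mul_eq_mul_div, div_le_iff₀ (by positivity)]
    nlinarith [abs_nonneg (s - t)]
  linarith

lemma ftc {p q : ℝ} {z z' : ℝ → Pt} (hpq : p ≤ q)
    (hd : ∀ t ∈ Icc p q, HasDerivWithinAt z (z' t) (Icc p q) t) (hc : ContinuousOn z' (Icc p q)) :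
    ∫ t in p..q, z' t = z q - z p := by
  apply intervalIntegral.integral_eq_sub_of_hasDerivAt_of_le hpq
  · exact fun t ht => (hd t ht).continuousWithinAt
  · exact fun t ht => (hd t ⟨ht.1.le, ht.2.le⟩).hasDerivAt (Icc_mem_nhds ht.1 ht.2)
  · exact hc.intervalIntegrable_of_Icc hpq

lemma straight {p q : ℝ} (hpq : p < q) {v : ℝ → Pt} {u : Pt} (hc : ContinuousOn v (Icc p q))
    (hn : ∀ t ∈ Icc p q, ‖v t‖ = 1) (hu : ‖u‖ = 1) (hI : ∫ t in p..q, v t = (q - p) • u) :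
    ∀ t ∈ Icc p q, v t = u := by
  by_contra hne
  push Not at hne
  obtain ⟨t0, ht0, hne⟩ := hne
  have hvi : IntervalIntegrable v volume p q := hc.intervalIntegrable_of_Icc hpq.le
  have e : ∫ t in p..q, (1 - innerSL ℝ u (v t)) = 0 := by
    have hi : IntervalIntegrable (fun t => innerSL ℝ u (v t)) volume p q :=
      ((innerSL ℝ u).continuous.comp_continuousOn hc).intervalIntegrable_of_Icc hpq.le
    rw [intervalIntegral.integral_sub intervalIntegrable_const hi,
      (innerSL ℝ u).intervalIntegral_comp_comm hvi, hI, map_smul]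
    simp [hu]
  have : 0 < ∫ t in p..q, (1 - innerSL ℝ u (v t)) := by
    apply intervalIntegral.integral_pos hpq
    · exact continuousOn_const.sub ((innerSL ℝ u).continuous.comp_continuousOn hc)
    · intro t ht
      have := real_inner_le_norm u (v t)
      rw [hu, hn t ⟨ht.1.le, ht.2⟩] at this
      simp only [innerSL_apply_apply]
      linarith
    · refine ⟨t0, ht0, ?_⟩
      have := (inner_lt_one_iff_real_of_norm_eq_one hu (hn t0 ht0)).2 hne.symm
      simp only [innerSL_apply_apply]
      linarith
  linarith

theorem stmt3 (z0 v0 zf vf : Pt) (tf : ℝ) (z z' : ℝ → Pt)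
    (hadm : AdmissibleOn 0 tf z0 v0 zf vf z z')
    (hmin : ∀ w w' : ℝ → Pt, AdmissibleOn 0 tf z0 v0 zf vf w w' →
      maxCurvOn (Icc 0 tf) z' ≤ maxCurvOn (Icc 0 tf) w')
    (t1 t2 : ℝ) (h1 : 0 ≤ t1) (h12 : t1 < t2) (h2 : t2 ≤ tf) :
    ∀ w w' : ℝ → Pt,
      AdmissibleOn t1 t2 (z t1) (z' t1) (z t2) (z' t2) w w' →
        maxCurvOn (Icc t1 t2) z' ≤ maxCurvOn (Icc t1 t2) w' := by
  intro w w' hw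
  by_contra hlt
  push Not at hlt
  obtain ⟨hzd, hzL, hzn, hz0, hzf, hz'0, hz'f⟩ := hadm
  obtain ⟨hwd, hwL, hwn, hw1, hw2, hw'1, hw'2⟩ := hw
  set a := maxCurvOn (Icc 0 tf) z' with ha
  set b := maxCurvOn (Icc t1 t2) w' with hb
  have htf : 0 ≤ tf := by linarith
  have hza : LB a 0 tf z' := LB_maxCurv hzL
  have hwb : LB b t1 t2 w' := LB_maxCurv hwL
  have ha0 : 0 ≤ a := maxCurv_nonneg _ _
  have hb0 : 0 ≤ b := maxCurv_nonneg _ _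
  have hzsub : LB a t1 t2 z' := hza.sub h1 h2
  have hba : b < a := hlt.trans_le (maxCurv_le ha0 hzsub)
  have subI : Icc t1 t2 ⊆ Icc 0 tf := Icc_subset_Icc h1 h2
  have FT : ∀ p q, 0 ≤ p → p ≤ q → q ≤ tf → ∫ t in p..q, z' t = z q - z p := by
    intro p q hp hpq hq
    have hs : Icc p q ⊆ Icc 0 tf := Icc_subset_Icc hp hq
    exact ftc hpq (fun t ht => (hzd t (hs ht)).mono hs) (hza.cont.mono hs)
  have FTw : ∫ t in t1..t2, w' t = w t2 - w t1 := ftc h12.le hwd hwb.cont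
  -- the spliced curve
  let y : ℝ → Pt := fun t => if t1 ≤ t ∧ t ≤ t2 then w' t else z' t
  have y1 : ∀ t ∈ Icc 0 t1, y t = z' t := by
    intro t ht
    simp only [y]
    split_ifs with hc
    · have : t = t1 := le_antisymm ht.2 hc.1
      rw [this, hw'1]
    · rfl
  have y2 : ∀ t ∈ Icc t1 t2, y t = w' t := by
    intro t ht
    simp only [y]; rw [if_pos ⟨ht.1, ht.2⟩]
  have y3 : ∀ t ∈ Icc t2 tf, y t = z' t := by
    intro t ht
    simp only [y]
    split_ifs with hc
    · have : t = t2 := le_antisymm hc.2 ht.1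
      rw [this, hw'2]
    · rfl
  have Y1 : LB a 0 t1 y := (hza.sub le_rfl (by linarith)).congr y1
  have Y2 : LB b t1 t2 y := hwb.congr y2
  have Y3 : LB a t2 tf y := (hza.sub (by linarith) le_rfl).congr y3
  have Y : LB a 0 tf y := Y1.glue ((Y2.mono hba.le).glue Y3)
  have yn : ∀ t ∈ Icc 0 tf, ‖y t‖ = 1 := by
    intro t ht
    simp only [y]
    split_ifs with hc
    · exact hwn t ⟨hc.1, hc.2⟩
    · exact hzn t ht
  have y0 : y 0 = v0 := by rw [y1 0 ⟨le_rfl, h1⟩, hz'0]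
  have yf : y tf = vf := by rw [y3 tf ⟨h2, le_rfl⟩, hz'f]
  have yI : ∫ t in (0:ℝ)..tf, y t = zf - z0 := by
    have j1 : IntervalIntegrable y volume 0 t1 := Y1.cont.intervalIntegrable_of_Icc h1
    have j2 : IntervalIntegrable y volume t1 t2 := Y2.cont.intervalIntegrable_of_Icc h12.le
    have j3 : IntervalIntegrable y volume t2 tf := Y3.cont.intervalIntegrable_of_Icc h2
    rw [← intervalIntegral.integral_add_adjacent_intervals (j1.trans j2) j3,
      ← intervalIntegral.integral_add_adjacent_intervals j1 j2,
      intervalIntegral.integral_congr (a := 0) (b := t1) (g := z') (by rw [uIcc_of_le h1]; exact y1),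
      intervalIntegral.integral_congr (a := t1) (b := t2) (g := w') (by rw [uIcc_of_le h12.le]; exact y2),
      intervalIntegral.integral_congr (a := t2) (b := tf) (g := z') (by rw [uIcc_of_le h2]; exact y3),
      FT 0 t1 le_rfl h1 (by linarith), FT t2 tf (by linarith) h2 le_rfl, FTw, hw1, hw2, hz0, hzf]
    abel
  -- transport to the complex plane
  let e : ℂ ≃ₗᵢ[ℝ] Pt := Complex.orthonormalBasisOneI.repr
  let cl : ℝ → ℝ := fun t => max 0 (min t tf)
  have clmem : ∀ t, cl t ∈ Icc 0 tf := fun t => ⟨le_max_left _ _, max_le htf (min_le_right _ _)⟩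
  have clid : ∀ t ∈ Icc 0 tf, cl t = t := by
    intro t ht
    simp only [cl]; rw [min_eq_left ht.2, max_eq_right ht.1]
  have clc : Continuous cl := by simp only [cl]; fun_prop
  let f : ℝ → ℂ := fun t => e.symm (y (cl t))
  have fy : ∀ t ∈ Icc 0 tf, f t = e.symm (y t) := by
    intro t ht
    simp only [f]; rw [clid t ht]
  have fc : Continuous f := e.symm.continuous.comp (Y.cont.comp_continuous clc clmem)
  have fn : ∀ t, ‖f t‖ = 1 := by
    intro t
    simp only [f]; rw [LinearIsometryEquiv.norm_map]; exact yn _ (clmem t)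
  have fL : ∀ K p q, 0 ≤ p → q ≤ tf → LB K p q y → LB K p q f := by
    intro K p q hp hq hL s hs t ht
    rw [fy s ⟨hp.trans hs.1, hs.2.trans hq⟩, fy t ⟨hp.trans ht.1, ht.2.trans hq⟩, ← map_sub,
      LinearIsometryEquiv.norm_map]
    exact hL s hs t ht
  have fnc : ¬ ∀ s ∈ Icc t1 t2, f s = f t1 := by
    intro hcon
    have ht1 : t1 ∈ Icc t1 t2 := ⟨le_rfl, h12.le⟩
    have hwc : ∀ s ∈ Icc t1 t2, w' s = w' t1 := by
      intro s hs
      have := hcon s hs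
      rw [fy s (subI hs), fy t1 (subI ht1)] at this
      have := e.symm.injective this
      rwa [y2 s hs, y2 t1 ht1] at this
    have hI : ∫ t in t1..t2, z' t = (t2 - t1) • w' t1 := by
      rw [FT t1 t2 h1 h12.le h2, ← hw1, ← hw2, ← FTw,
        intervalIntegral.integral_congr (g := fun _ => w' t1) (by rw [uIcc_of_le h12.le]; exact hwc)]
      simp
    have hst := straight h12 hzsub.cont (fun t ht => hzn t (subI ht)) (hwn t1 ht1) hI
    have hz0 : LB 0 t1 t2 z' := by
      intro s hs t ht
      rw [hst s hs, hst t ht]; simp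
    have := maxCurv_le le_rfl hz0
    linarith
  obtain ⟨g, a', ha'0, ha', gL, gn, g0, gT, gI⟩ := key f fc fn tf t1 t2 a b h1 h12 h2 hb0 hba
    (fL _ _ _ le_rfl le_rfl Y) (fL _ _ _ h1 h2 Y2) fnc
  let x' : ℝ → Pt := fun t => e (g t)
  have xL : LB a' 0 tf x' := by
    intro s hs t ht
    simp only [x']; rw [← map_sub, LinearIsometryEquiv.norm_map]
    exact gL s hs t ht
  let X : ℝ → Pt := fun t => e (g (cl t))
  have Xc : Continuous X := e.continuous.comp (gL.cont.comp_continuous clc clmem)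
  have Xx : ∀ t ∈ Icc 0 tf, X t = x' t := by
    intro t ht
    simp only [X, x']; rw [clid t ht]
  have m0 : (0:ℝ) ∈ Icc 0 tf := ⟨le_rfl, htf⟩
  have mf : tf ∈ Icc 0 tf := ⟨htf, le_rfl⟩
  have hfinal := hmin (fun t => z0 + ∫ s in (0:ℝ)..t, X s) x' ?_
  · have := maxCurv_le ha'0 xL
    linarith
  · refine ⟨?_, ⟨_, lip_of_LB xL⟩, ?_, ?_, ?_, ?_, ?_⟩
    · intro t ht
      rw [← Xx t ht]
      exact ((Xc.integral_hasStrictDerivAt 0 t).hasDerivAt.const_add z0).hasDerivWithinAt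
    · intro t _
      simp only [x']; rw [LinearIsometryEquiv.norm_map, gn]
    · simp
    · have e1 : ∫ s in (0:ℝ)..tf, X s = ∫ s in (0:ℝ)..tf, e.toContinuousLinearEquiv.toContinuousLinearMap (g s) :=
        intervalIntegral.integral_congr (by rw [uIcc_of_le htf]; exact Xx)
      have e2 : ∫ s in (0:ℝ)..tf, e.toContinuousLinearEquiv.toContinuousLinearMap (f s) = ∫ s in (0:ℝ)..tf, y s :=
        intervalIntegral.integral_congr (by
          rw [uIcc_of_le htf]; intro t ht
          show e (f t) = y t
          rw [fy t ht, LinearIsometryEquiv.apply_symm_apply])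
      rw [ContinuousLinearMap.intervalIntegral_comp_comm _ (fc.intervalIntegrable _ _)] at e2
      rw [ContinuousLinearMap.intervalIntegral_comp_comm _ (gL.cont.intervalIntegrable_of_Icc htf), gI, e2, yI] at e1
      simp only [e1]
      abel
    · simp only [x']; rw [g0, fy 0 m0, LinearIsometryEquiv.apply_symm_apply, y0]
    · simp only [x']; rw [gT, fy tf mf, LinearIsometryEquiv.apply_symm_apply, yf]
end
end

section
/- Let z be a minimiser of Problem (P) for some data (z0, v0, zf, vf, t_f), with maximum curvature a > 0. Then there do NOT exist 0 = s0 < s1 < s2 < s3 = t_f such that: (i) [s1, s2] is a circular arc of signed curvature ω2 with |ω2| = a whose turning angle a·(s2 − s1) is not an integer multiple of 2π; (ii) each of the outer pieces [s0, s1] and [s2, s3] is either a line segment or a circular arc of signed curvature ±a, where any outer circular arc whose turning angle is not an integer multiple of 2π has signed curvature −ω2 (opposite orientation to the middle arc); and (iii) at least one of the two outer pieces is a line segment or a full loop. (A path of type XCY, with X, Y among C, O, S and not both C, is not optimal.) -/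
open Set MeasureTheory Real

noncomputable section

section PartA

open Set MeasureTheory Real

/-- A proper convex cone in a finite-dimensional space is contained in a half-space. -/
lemma cone_sep {E : Type*} [NormedAddCommGroup E] [NormedSpace ℝ E] [FiniteDimensional ℝ E]
    (V : Set E) (hadd : ∀ x ∈ V, ∀ y ∈ V, x + y ∈ V) (hsm : ∀ c : ℝ, 0 < c → ∀ x ∈ V, c • x ∈ V)
    (hne : V.Nonempty) (hV : V ≠ univ) : ∃ f : E →ₗ[ℝ] ℝ, f ≠ 0 ∧ ∀ x ∈ V, 0 ≤ f x := by
  by_cases hspan : Submodule.span ℝ V = ⊤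
  · have hconv : Convex ℝ V := by
      intro x hx y hy a b ha hb hab
      rcases ha.eq_or_lt with rfl | ha
      · simp at hab; subst hab; simpa using hy
      rcases hb.eq_or_lt with rfl | hb
      · simp at hab; subst hab; simpa using hx
      exact hadd _ (hsm a ha x hx) _ (hsm b hb y hy)
    obtain ⟨b, hb⟩ := (Set.ne_univ_iff_exists_notMem V).1 hV
    have hInt : (interior V).Nonempty := by
      rw [hconv.interior_nonempty_iff_affineSpan_eq_top]
      obtain ⟨x, hx⟩ := hne
      have h0 : (0:E) ∈ affineSpan ℝ V := by
        have h2 : (2:ℝ) • x ∈ V := hsm 2 (by norm_num) x hx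
        have := AffineMap.lineMap_mem (k := ℝ) (Q := affineSpan ℝ V) (-1 : ℝ)
          (subset_affineSpan ℝ V hx) (subset_affineSpan ℝ V h2)
        convert this using 1
        rw [AffineMap.lineMap_apply]
        simp only [vsub_eq_sub, vadd_eq_add]
        module
      rw [eq_top_iff]
      intro y _
      have hy : y ∈ Submodule.span ℝ V := by rw [hspan]; trivial
      have hle : Submodule.span ℝ V ≤ (affineSpan ℝ V).direction := by
        rw [Submodule.span_le]
        intro v hv
        have := AffineSubspace.vsub_mem_direction (subset_affineSpan ℝ V hv) h0
        simpa using this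
      have := AffineSubspace.vadd_mem_of_mem_direction (hle hy) h0
      simpa using this
    obtain ⟨f, hf, hfV⟩ := geometric_hahn_banach_of_nonempty_interior_point hconv
      (fun h => hb (interior_subset h)) hInt
    refine ⟨-f.toLinearMap, ?_, ?_⟩
    · intro h
      apply hf
      ext x
      have := congrArg (fun g => g x) h
      simpa using this
    · intro x hx
      by_contra hcon
      simp only [LinearMap.neg_apply, ContinuousLinearMap.coe_coe, not_le, Left.neg_neg_iff] at hcon
      have h1 := hfV _ (hsm ((|f b| + 1) / f x) (by positivity) x hx)
      rw [map_smul, smul_eq_mul, div_mul_cancel₀ _ hcon.ne'] at h1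
      linarith [le_abs_self (f b)]
  · obtain ⟨f, hf, hle⟩ := Submodule.exists_le_ker_of_lt_top _ (lt_top_iff_ne_top.2 hspan)
    exact ⟨f, hf, fun x hx => (LinearMap.mem_ker.1 (hle (Submodule.subset_span hx))).ge⟩

/-- Implicit curves along kernel directions. -/
lemma implicit_curve {E F : Type*} [NormedAddCommGroup E] [NormedSpace ℝ E] [CompleteSpace E]
    [NormedAddCommGroup F] [NormedSpace ℝ F] [FiniteDimensional ℝ F]
    (f : E → F) (f' : E →L[ℝ] F) (x : E) (hf : HasStrictFDerivAt f f' x)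
    (hsurj : Function.Surjective f') (k : E) (hk : f' k = 0) :
    ∃ c : ℝ → E, c 0 = x ∧ HasDerivAt c k 0 ∧ ∀ᶠ s in nhds (0:ℝ), f (c s) = f x := by
  have hr : f'.range = ⊤ := LinearMap.range_eq_top.2 hsurj
  let kk : f'.ker := ⟨k, hk⟩
  refine ⟨fun s => hf.implicitFunction f f' hr (f x) (s • kk), by simp, ?_, ?_⟩
  · have h1 : HasDerivAt (fun s : ℝ => s • kk) kk 0 := by
      simpa using (hasDerivAt_id (0:ℝ)).smul_const kk
    have h2 := (hf.to_implicitFunction hr).hasFDerivAt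
    have h3 : HasFDerivAt (hf.implicitFunction f f' hr (f x)) f'.ker.subtypeL
      ((fun s : ℝ => s • kk) 0) := by simpa using h2
    exact h3.comp_hasDerivAt (0:ℝ) h1
  · have h := hf.map_implicitFunction_eq hr
    have ht : Filter.Tendsto (fun s : ℝ => (f x, s • kk)) (nhds 0) (nhds (f x, 0)) := by
      have : Continuous (fun s : ℝ => (f x, s • kk)) := by fun_prop
      simpa using this.tendsto 0
    exact ht.eventually h

lemma cos_strict (θ x y : ℝ) :
    |cos x - cos y + sin θ * (x - y)| ≤ (|x - θ| + |y - θ|) * |x - y| := by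
  have hd : ∀ s ∈ uIcc y x, HasDerivWithinAt (fun s => cos s + sin θ * s) (-sin s + sin θ) (uIcc y x) s := by
    intro s _
    have h1 : HasDerivAt (fun s => sin θ * s) (sin θ) s := by
      simpa using (hasDerivAt_id s).const_mul (sin θ)
    exact ((Real.hasDerivAt_cos s).add h1).hasDerivWithinAt
  have hb : ∀ s ∈ uIcc y x, ‖-sin s + sin θ‖ ≤ |x - θ| + |y - θ| := by
    intro s hs
    have h1 : |sin θ - sin s| ≤ |θ - s| := by
      have := Real.abs_sin_sub_sin_le θ s
      exact this
    rw [Real.norm_eq_abs, show -sin s + sin θ = sin θ - sin s by ring]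
    refine h1.trans ?_
    rcases mem_uIcc.1 hs with h | h
    · rw [abs_le]; constructor <;>
      linarith [le_abs_self (x - θ), neg_abs_le (x-θ), le_abs_self (y-θ), neg_abs_le (y-θ), abs_nonneg (x-θ), abs_nonneg (y-θ)]
    · rw [abs_le]; constructor <;>
      linarith [le_abs_self (x - θ), neg_abs_le (x-θ), le_abs_self (y-θ), neg_abs_le (y-θ), abs_nonneg (x-θ), abs_nonneg (y-θ)]
  have := Convex.norm_image_sub_le_of_norm_hasDerivWithin_le hd hb (convex_uIcc y x)
    left_mem_uIcc right_mem_uIcc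
  rw [Real.norm_eq_abs, Real.norm_eq_abs] at this
  convert this using 2
  ring

end PartA

section PartB

open Set MeasureTheory Real

/-- Bounded measurable functions. -/
def BM (f : ℝ → ℝ) : Prop := Measurable f ∧ ∃ C : ℝ, 0 < C ∧ ∀ t, |f t| ≤ C

lemma BM.ii {f : ℝ → ℝ} (h : BM f) (p q : ℝ) : IntervalIntegrable f volume p q := by
  obtain ⟨hm, C, hC, hb⟩ := h
  exact (intervalIntegrable_const (c := C)).mono_fun hm.aestronglyMeasurable
    (Filter.Eventually.of_forall fun t => by
      simpa [Real.norm_eq_abs, abs_of_pos hC] using hb t)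

lemma BM.add {f g : ℝ → ℝ} (hf : BM f) (hg : BM g) : BM (fun t => f t + g t) := by
  obtain ⟨hm, C, hC, hb⟩ := hf
  obtain ⟨hm', C', hC', hb'⟩ := hg
  exact ⟨hm.add hm', C + C', by positivity, fun t => (abs_add_le _ _).trans (add_le_add (hb t) (hb' t))⟩

lemma BM.smul {f : ℝ → ℝ} (hf : BM f) (c : ℝ) : BM (fun t => c * f t) := by
  obtain ⟨hm, C, hC, hb⟩ := hf
  refine ⟨hm.const_mul c, (|c| + 1) * C, by positivity, fun t => ?_⟩
  rw [abs_mul]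
  nlinarith [hb t, abs_nonneg c, abs_nonneg (f t)]

/-- Primitive from `0`. -/
def prim (f : ℝ → ℝ) (t : ℝ) : ℝ := ∫ s in (0:ℝ)..t, f s

lemma BM.prim_sub {f : ℝ → ℝ} (h : BM f) (s t : ℝ) : prim f t - prim f s = ∫ x in s..t, f x := by
  unfold prim
  exact intervalIntegral.integral_interval_sub_left (h.ii _ _) (h.ii _ _)

lemma BM.prim_lip {f : ℝ → ℝ} (h : BM f) {C : ℝ} (hb : ∀ t, |f t| ≤ C) (s t : ℝ) :
    |prim f t - prim f s| ≤ C * |t - s| := by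
  rw [h.prim_sub]
  exact intervalIntegral.norm_integral_le_of_norm_le_const (f := f) (C := C) (fun x _ => hb x)

lemma BM.prim_cont {f : ℝ → ℝ} (h : BM f) : Continuous (prim f) :=
  intervalIntegral.continuous_primitive (fun _ _ => h.ii _ _) 0

lemma prim_add {f g : ℝ → ℝ} (hf : BM f) (hg : BM g) (t : ℝ) :
    prim (fun t => f t + g t) t = prim f t + prim g t :=
  intervalIntegral.integral_add (hf.ii _ _) (hg.ii _ _)

lemma prim_smul (f : ℝ → ℝ) (c t : ℝ) :
    prim (fun t => c * f t) t = c * prim f t :=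
  intervalIntegral.integral_const_mul _ _

lemma cont_BM_on {g : ℝ → ℝ} (hg : Continuous g) (p q : ℝ) : IntervalIntegrable g volume p q :=
  hg.intervalIntegrable _ _

lemma prim_hasDeriv {g : ℝ → ℝ} (hg : Continuous g) (t : ℝ) : HasDerivAt (prim g) (g t) t :=
  intervalIntegral.integral_hasDerivAt_right (hg.intervalIntegrable _ _)
    hg.aestronglyMeasurable.stronglyMeasurableAtFilter hg.continuousAt

lemma prim_cont' {g : ℝ → ℝ} (hg : Continuous g) : Continuous (prim g) :=
  continuous_iff_continuousAt.2 fun t => (prim_hasDeriv hg t).continuousAt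

lemma ibp {g δ : ℝ → ℝ} (hg : Continuous g) (hδ : BM δ) (T : ℝ) :
    ∫ t in (0:ℝ)..T, g t * prim δ t = prim δ T * prim g T - ∫ t in (0:ℝ)..T, δ t * prim g t := by
  have h1 : AbsolutelyContinuousOnInterval (prim δ) 0 T :=
    (hδ.ii 0 T).absolutelyContinuousOnInterval_intervalIntegral (c := 0) (by simp)
  have h2 : AbsolutelyContinuousOnInterval (prim g) 0 T :=
    (hg.intervalIntegrable 0 T).absolutelyContinuousOnInterval_intervalIntegral (c := 0) (by simp)
  have h3 := h1.integral_mul_deriv_eq_deriv_mul h2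
  have h4 : ∫ t in (0:ℝ)..T, prim δ t * deriv (prim g) t = ∫ t in (0:ℝ)..T, g t * prim δ t := by
    apply intervalIntegral.integral_congr
    intro t _
    simp only [(prim_hasDeriv hg t).deriv]
    ring
  have h5 : ∫ t in (0:ℝ)..T, deriv (prim δ) t * prim g t = ∫ t in (0:ℝ)..T, δ t * prim g t := by
    apply intervalIntegral.integral_congr_ae
    filter_upwards [(hδ.ii 0 T).ae_hasDerivAt_integral] with t ht ht'
    have := ht (uIoc_subset_uIcc ht') 0 (by simp)
    have h6 : deriv (prim δ) t = δ t := this.deriv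
    rw [h6]
  rw [h4, h5] at h3
  rw [h3]
  simp [prim]

/-- The linearised endpoint map. -/
def Lop (θ : ℝ → ℝ) (T : ℝ) (δ : ℝ → ℝ) : ℝ × ℝ × ℝ :=
  (prim δ T, ∫ t in (0:ℝ)..T, -sin (θ t) * prim δ t, ∫ t in (0:ℝ)..T, cos (θ t) * prim δ t)

lemma Lop_add {θ : ℝ → ℝ} (hθ : Continuous θ) (T : ℝ) {δ δ' : ℝ → ℝ} (h : BM δ) (h' : BM δ') :
    Lop θ T (fun t => δ t + δ' t) = Lop θ T δ + Lop θ T δ' := by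
  have c1 := h.prim_cont
  have c2 := h'.prim_cont
  unfold Lop
  simp only [prim_add h h', Prod.mk_add_mk, mul_add]
  rw [intervalIntegral.integral_add, intervalIntegral.integral_add] <;>
  exact Continuous.intervalIntegrable (by fun_prop) _ _

lemma Lop_smul (θ : ℝ → ℝ) (T : ℝ) (δ : ℝ → ℝ) (c : ℝ) :
    Lop θ T (fun t => c * δ t) = c • Lop θ T δ := by
  unfold Lop
  simp only [prim_smul, Prod.smul_mk, smul_eq_mul, mul_left_comm _ c,
    intervalIntegral.integral_const_mul]

/-- The cone of decreasing directions. -/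
def Dec (u δ : ℝ → ℝ) : Prop := BM δ ∧ ∃ η : ℝ, 0 < η ∧ ∀ t, u t ≠ 0 → δ t * u t ≤ -η

lemma strict_cos {n : ℕ} (θ : ℝ → ℝ) (hθ : Continuous θ) (T : ℝ) (φ : Fin n → ℝ → ℝ)
    (hφ : ∀ j, Continuous (φ j)) (B : ℝ) (hB : 0 < B) (hφB : ∀ j, ∀ t ∈ uIoc 0 T, |φ j t| ≤ B)
    (L : (Fin n → ℝ) →L[ℝ] ℝ) (hL : ∀ c, L c = ∑ j, c j * ∫ t in (0:ℝ)..T, -sin (θ t) * φ j t) :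
    HasStrictFDerivAt (fun c : Fin n → ℝ => ∫ t in (0:ℝ)..T, cos (θ t + ∑ j, c j * φ j t)) L 0 := by
  have hℓ : ∀ c : Fin n → ℝ, ∀ t ∈ uIoc 0 T, |∑ j, c j * φ j t| ≤ n * B * ‖c‖ := by
    intro c t ht
    refine (Finset.abs_sum_le_sum_abs _ _).trans ?_
    have : ∀ j ∈ Finset.univ, |c j * φ j t| ≤ B * ‖c‖ := by
      intro j _
      rw [abs_mul, mul_comm]
      exact mul_le_mul (hφB j t ht) (norm_le_pi_norm c j) (abs_nonneg _) hB.le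
    refine (Finset.sum_le_sum this).trans ?_
    simp [mul_assoc]
  have hcont : ∀ c : Fin n → ℝ, Continuous (fun t => ∑ j, c j * φ j t) := by
    intro c
    exact continuous_finsetSum _ fun j _ => (hφ j).const_mul _
  have key : ∀ c d : Fin n → ℝ, ‖(∫ t in (0:ℝ)..T, cos (θ t + ∑ j, c j * φ j t)) -
      (∫ t in (0:ℝ)..T, cos (θ t + ∑ j, d j * φ j t)) - L (c - d)‖ ≤
      ((n * B * ‖c‖ + n * B * ‖d‖) * (n * B * ‖c - d‖)) * |T - 0| := by
    intro c d
    have hLe : L (c - d) = ∫ t in (0:ℝ)..T, -sin (θ t) * ∑ j, (c - d) j * φ j t := by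
      rw [hL]
      simp only [Finset.mul_sum]
      rw [intervalIntegral.integral_finsetSum]
      · apply Finset.sum_congr rfl
        intro j _
        rw [← intervalIntegral.integral_const_mul]
        congr 1
        ext t
        ring
      · intro j _
        have := hφ j
        exact Continuous.intervalIntegrable (by fun_prop) _ _
    have hc := hcont c
    have hd := hcont d
    have hcd := hcont (c - d)
    rw [hLe, ← intervalIntegral.integral_sub, ← intervalIntegral.integral_sub]
    · apply intervalIntegral.norm_integral_le_of_norm_le_const
      intro t ht
      have h1 := cos_strict (θ t) (θ t + ∑ j, c j * φ j t) (θ t + ∑ j, d j * φ j t)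
      have h2 : (θ t + ∑ j, c j * φ j t) - (θ t + ∑ j, d j * φ j t) = ∑ j, (c - d) j * φ j t := by
        simp only [Pi.sub_apply, sub_mul, Finset.sum_sub_distrib]
        ring
      rw [h2] at h1
      rw [Real.norm_eq_abs, show ∀ x y z w: ℝ, x - y - -z * w = x - y + z * w by intros; ring]
      refine h1.trans ?_
      rw [add_sub_cancel_left, add_sub_cancel_left]
      exact mul_le_mul (add_le_add (hℓ c t ht) (hℓ d t ht)) (hℓ _ t ht) (abs_nonneg _)
        (by positivity)
    all_goals exact Continuous.intervalIntegrable (by fun_prop) _ _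
  rw [hasStrictFDerivAt_iff_isLittleO, Asymptotics.isLittleO_iff]
  intro ε hε
  have hc0 : Continuous (fun p : (Fin n → ℝ) × (Fin n → ℝ) =>
    (n * B * ‖p.1‖ + n * B * ‖p.2‖) * (n * B) * |T - 0|) := by fun_prop
  have := (hc0.tendsto 0).eventually_lt_const (u := ε) (by simpa using hε)
  filter_upwards [this] with p hp
  refine (key p.1 p.2).trans ?_
  calc _ = ((n * B * ‖p.1‖ + n * B * ‖p.2‖) * (n * B) * |T - 0|) * ‖p.1 - p.2‖ := by ring
    _ ≤ _ := by gcongr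

end PartB

section PartC

open Set MeasureTheory Real

lemma improve (T a θ0 : ℝ) (hT : 0 < T) (ha : 0 < a) (u : ℝ → ℝ) (hu : BM u)
    (hval : ∀ t, u t = a ∨ u t = -a ∨ u t = 0)
    (hsurj : ∀ v, ∃ δ, Dec u δ ∧ Lop (fun t => θ0 + prim u t) T δ = v) :
    ∃ (u' : ℝ → ℝ) (a' : ℝ), 0 ≤ a' ∧ a' < a ∧ BM u' ∧ (∀ t, |u' t| ≤ a') ∧
      prim u' T = prim u T ∧
      prim (fun t => cos (θ0 + prim u' t)) T = prim (fun t => cos (θ0 + prim u t)) T ∧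
      prim (fun t => sin (θ0 + prim u' t)) T = prim (fun t => sin (θ0 + prim u t)) T := by
  set θ : ℝ → ℝ := fun t => θ0 + prim u t with hθdef
  have hθ : Continuous θ := continuous_const.add hu.prim_cont
  choose g hgD hgL using hsurj
  let vs : Fin 4 → ℝ × ℝ × ℝ := ![0, (1,0,0), (0,1,0), (0,0,1)]
  let δ : Fin 4 → ℝ → ℝ := fun j => g (vs j)
  have hδ : ∀ j, BM (δ j) := fun j => (hgD _).1
  have hδL : ∀ j, Lop θ T (δ j) = vs j := fun j => hgL _
  obtain ⟨C, hC, hδC⟩ : ∃ C : ℝ, 0 < C ∧ ∀ j t, |δ j t| ≤ C := by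
    choose Cj hCj hj using fun j => (hδ j).2
    refine ⟨∑ j, Cj j, Finset.sum_pos (fun j _ => hCj j) Finset.univ_nonempty, fun j t => ?_⟩
    exact (hj j t).trans (Finset.single_le_sum (f := Cj) (fun i _ => (hCj i).le) (Finset.mem_univ j))
  obtain ⟨η, hη, hdec⟩ := (hgD (vs 0)).2
  let φ : Fin 4 → ℝ → ℝ := fun j => prim (δ j)
  have hφc : ∀ j, Continuous (φ j) := fun j => (hδ j).prim_cont
  have hφB : ∀ j, ∀ t ∈ uIoc 0 T, |φ j t| ≤ C * T := by
    intro j t ht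
    rw [uIoc_of_le hT.le] at ht
    have := (hδ j).prim_lip (hδC j) 0 t
    simp only [prim, intervalIntegral.integral_same, sub_zero] at this
    refine this.trans ?_
    rw [abs_of_pos ht.1]
    exact mul_le_mul_of_nonneg_left ht.2 hC.le
  let Lw : (Fin 4 → ℝ) → (Fin 4 → ℝ) →L[ℝ] ℝ := fun w => ∑ j, w j • ContinuousLinearMap.proj j
  have hLw : ∀ w c, Lw w c = ∑ j, c j * w j := by
    intro w c
    simp only [Lw, sum_apply, smul_apply,
      ContinuousLinearMap.proj_apply, smul_eq_mul]
    exact Finset.sum_congr rfl fun j _ => mul_comm _ _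
  let L0 := Lw (fun j => φ j T)
  let L1 := Lw (fun j => ∫ t in (0:ℝ)..T, -sin (θ t) * φ j t)
  let L2 := Lw (fun j => ∫ t in (0:ℝ)..T, -sin (θ t - π/2) * φ j t)
  have hs0 : HasStrictFDerivAt (fun c : Fin 4 → ℝ => ∑ j, c j * φ j T) L0 0 := by
    have : (fun c : Fin 4 → ℝ => ∑ j, c j * φ j T) = L0 := by
      ext c; rw [hLw]
    rw [this]
    exact L0.hasStrictFDerivAt
  have hs1 := strict_cos θ hθ T φ hφc (C * T) (by positivity) hφB L1 (hLw _)
  have hs2 := strict_cos (fun t => θ t - π/2) (by fun_prop) T φ hφc (C * T) (by positivity) hφB L2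
    (hLw _)
  have hs := hs0.prodMk (hs1.prodMk hs2)
  have hLval : ∀ c, (L0.prod (L1.prod L2)) c = ∑ j, c j • vs j := by
    intro c
    have e : ∀ j, vs j = (φ j T, ∫ t in (0:ℝ)..T, -sin (θ t) * φ j t,
        ∫ t in (0:ℝ)..T, -sin (θ t - π/2) * φ j t) := by
      intro j
      rw [← hδL j]
      simp only [Lop, sin_sub_pi_div_two, neg_neg, φ]
    simp only [ContinuousLinearMap.prod_apply, L0, L1, L2, hLw]
    simp only [e, Prod.smul_mk, smul_eq_mul]
    simp only [Fin.sum_univ_four, Prod.mk_add_mk]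
  have hsj : Function.Surjective (L0.prod (L1.prod L2)) := by
    rintro ⟨x, y, w⟩
    refine ⟨![0, x, y, w], ?_⟩
    rw [hLval]
    simp [Fin.sum_univ_four, vs]
  have hk : (L0.prod (L1.prod L2)) (Pi.single 0 1) = 0 := by
    rw [hLval]
    simp [Fin.sum_univ_four, vs]
  obtain ⟨c, hc0, hcd, hcF⟩ := implicit_curve _ _ 0 hs hsj (Pi.single 0 1) hk
  have hcl := (hasDerivAt_iff_isLittleO.1 hcd)
  rw [Asymptotics.isLittleO_iff] at hcl
  have hε : 0 < η / (8 * a * C) := by positivity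
  have hev := hcl hε
  have hsmall : ∀ᶠ s in nhdsWithin (0:ℝ) (Ioi 0), s < min (a / (2 * C)) (a * a / (2 * η)) := by
    apply Filter.Eventually.filter_mono nhdsWithin_le_nhds
    exact gt_mem_nhds (by positivity)
  obtain ⟨s, hs1', hs2', hs3, hs4⟩ := ((hev.filter_mono nhdsWithin_le_nhds).and
    ((hcF.filter_mono nhdsWithin_le_nhds).and (hsmall.and self_mem_nhdsWithin))).exists
  replace hs4 : 0 < s := hs4
  have hsC : s * C < a / 2 := by
    have := hs3.trans_le (min_le_left _ _)
    rw [lt_div_iff₀ (by positivity)] at this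
    linarith
  have hsη : s * η / a < a / 2 := by
    have := hs3.trans_le (min_le_right _ _)
    rw [lt_div_iff₀ (by positivity)] at this
    rw [div_lt_iff₀ ha]
    linarith
  let w : ℝ → ℝ := fun t => ∑ j, c s j * δ j t
  have hw : BM w := by
    have := ((((hδ 0).smul (c s 0)).add ((hδ 1).smul (c s 1))).add ((hδ 2).smul (c s 2))).add
      ((hδ 3).smul (c s 3))
    convert this using 2
    simp [w, Fin.sum_univ_four]
  have hwp : ∀ t, prim w t = ∑ j, c s j * φ j t := by
    intro t
    have e : w = fun t => ((c s 0 * δ 0 t + c s 1 * δ 1 t) + c s 2 * δ 2 t) + c s 3 * δ 3 t := by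
      ext t; simp [w, Fin.sum_univ_four]
    rw [e, prim_add ((((hδ 0).smul (c s 0)).add ((hδ 1).smul (c s 1))).add ((hδ 2).smul (c s 2)))
      ((hδ 3).smul (c s 3)), prim_add (((hδ 0).smul (c s 0)).add ((hδ 1).smul (c s 1)))
      ((hδ 2).smul (c s 2)), prim_add ((hδ 0).smul (c s 0)) ((hδ 1).smul (c s 1))]
    simp only [prim_smul, Fin.sum_univ_four, φ]
  have hpu : ∀ t, prim (fun t => u t + w t) t = prim u t + ∑ j, c s j * φ j t := by
    intro t
    rw [prim_add hu hw, hwp]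
  simp only [Prod.mk.injEq, Pi.zero_apply, zero_mul, Finset.sum_const_zero, add_zero] at hs2'
  obtain ⟨q0, q1, q2⟩ := hs2'
  refine ⟨fun t => u t + w t, a - s * η / (2 * a), ?_, ?_, hu.add hw, ?_, ?_, ?_, ?_⟩
  · have : s * η / (2 * a) = (s * η / a) / 2 := by field_simp
    rw [this]
    linarith
  · have : 0 < s * η / (2 * a) := by positivity
    linarith
  · intro t
    have hcj : ∀ j, |c s j - s * (Pi.single 0 1 : Fin 4 → ℝ) j| ≤ η / (8 * a * C) * s := by
      intro j
      rw [hc0, sub_zero, sub_zero, Real.norm_of_nonneg hs4.le] at hs1'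
      exact (norm_le_pi_norm _ j).trans hs1'
    have hrem : |w t - s * δ 0 t| ≤ s * η / (2 * a) := by
      have e : w t - s * δ 0 t = ∑ j, (c s j - s * (Pi.single 0 1 : Fin 4 → ℝ) j) * δ j t := by
        simp [w, Fin.sum_univ_four]
        ring
      rw [e]
      refine (Finset.abs_sum_le_sum_abs _ _).trans ?_
      have : ∀ j ∈ Finset.univ, |(c s j - s * (Pi.single 0 1 : Fin 4 → ℝ) j) * δ j t| ≤
          η / (8 * a * C) * s * C := by
        intro j _
        rw [abs_mul]
        exact mul_le_mul (hcj j) (hδC j t) (abs_nonneg _) (by positivity)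
      refine (Finset.sum_le_sum this).trans (le_of_eq ?_)
      simp
      field_simp
      norm_num
    have hmain : |u t + s * δ 0 t| ≤ a - s * η / a := by
      have hd := abs_le.1 (hδC 0 t)
      have hd1 : s * δ 0 t ≤ s * C := mul_le_mul_of_nonneg_left hd.2 hs4.le
      have hd2 : s * (-C) ≤ s * δ 0 t := mul_le_mul_of_nonneg_left hd.1 hs4.le
      rw [abs_le]
      rcases hval t with h | h | h
      · have h1 := hdec t (by rw [h]; exact ha.ne')
        have h2 : δ 0 t ≤ -(η / a) := by
          rw [h] at h1
          rw [← neg_div, le_div_iff₀ ha]; exact h1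
        have h3 := mul_le_mul_of_nonneg_left h2 hs4.le
        have h4 : s * -(η / a) = - (s * η / a) := by ring
        rw [h]
        constructor <;> linarith
      · have h1 := hdec t (by rw [h]; linarith)
        have h2 : η / a ≤ δ 0 t := by
          rw [h] at h1
          rw [div_le_iff₀ ha]
          change δ 0 t * (-a) ≤ -η at h1
          linarith
        have h3 := mul_le_mul_of_nonneg_left h2 hs4.le
        have h4 : s * (η / a) = (s * η / a) := by ring
        rw [h]
        constructor <;> linarith
      · rw [h]
        constructor <;> linarith
    have : u t + w t = (u t + s * δ 0 t) + (w t - s * δ 0 t) := by ring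
    change |u t + w t| ≤ _
    rw [this]
    refine (abs_add_le _ _).trans ((add_le_add hmain hrem).trans (le_of_eq ?_))
    field_simp
    ring
  · rw [hpu, q0, add_zero]
  · simp only [hpu, ← add_assoc]
    exact q1
  · have e : ∀ x : ℝ, sin x = cos (x - π/2) := fun x => (cos_sub_pi_div_two x).symm
    simp only [e, hpu]
    unfold prim
    convert q2 using 5 <;> simp only [hθdef, prim]
    ring

lemma sep_integral (T θ0 : ℝ) (u : ℝ → ℝ) (hu : BM u) (f : ℝ × ℝ × ℝ →ₗ[ℝ] ℝ) (hf : f ≠ 0) :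
    ∃ l0 l1 l2 : ℝ, ¬ (l0 = 0 ∧ l1 = 0 ∧ l2 = 0) ∧ ∀ δ, BM δ →
      f (Lop (fun t => θ0 + prim u t) T δ) = - ∫ t in (0:ℝ)..T, δ t *
        (l0 + l1 * prim (fun t => cos (θ0 + prim u t)) t
            + l2 * prim (fun t => sin (θ0 + prim u t)) t) := by
  have hθ : Continuous (fun t => θ0 + prim u t) := continuous_const.add hu.prim_cont
  set X := prim (fun t => cos (θ0 + prim u t)) with hX
  set Y := prim (fun t => sin (θ0 + prim u t)) with hY
  have hXc : Continuous X := prim_cont' (by fun_prop)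
  have hYc : Continuous Y := prim_cont' (by fun_prop)
  have hfe : ∀ x y z, f (x, y, z) = f (1,0,0) * x + f (0,1,0) * y + f (0,0,1) * z := by
    intro x y z
    have : (x, y, z) = x • ((1:ℝ),(0:ℝ),(0:ℝ)) + y • ((0:ℝ),(1:ℝ),(0:ℝ)) + z • ((0:ℝ),(0:ℝ),(1:ℝ)) := by
      simp
    rw [this, map_add, map_add, map_smul, map_smul, map_smul]
    simp only [smul_eq_mul]
    ring
  set f0 := f (1,0,0)
  set f1 := f (0,1,0)
  set f2 := f (0,0,1)
  refine ⟨-(f0 - f1 * Y T + f2 * X T), f2, -f1, ?_, ?_⟩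
  · rintro ⟨h0, h1, h2⟩
    apply hf
    have h2' : f1 = 0 := by linarith
    rw [h1, h2'] at h0
    have h0' : f0 = 0 := by linarith
    ext <;> simp [f0, f1, f2] at * <;> assumption
  · intro δ hδ
    have i1 := ibp (g := fun t => sin (θ0 + prim u t)) (by fun_prop) hδ T
    have i2 := ibp (g := fun t => cos (θ0 + prim u t)) (by fun_prop) hδ T
    rw [Lop, hfe]
    simp only [neg_mul, intervalIntegral.integral_neg]
    rw [i1, i2, ← hX, ← hY]
    have hiX : IntervalIntegrable (fun t => δ t * X t) volume 0 T :=
      (hδ.ii 0 T).mul_continuousOn hXc.continuousOn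
    have hiY : IntervalIntegrable (fun t => δ t * Y t) volume 0 T :=
      (hδ.ii 0 T).mul_continuousOn hYc.continuousOn
    have e : (fun t => δ t * (-(f0 - f1 * Y T + f2 * X T) + f2 * X t + -(f1 * Y t))) =
      fun t => (-(f0 - f1 * Y T + f2 * X T)) * δ t + f2 * (δ t * X t) + (-f1) * (δ t * Y t) := by
      ext t; ring
    rw [e, intervalIntegral.integral_add, intervalIntegral.integral_add,
      intervalIntegral.integral_const_mul, intervalIntegral.integral_const_mul,
      intervalIntegral.integral_const_mul]
    · change _ = -(-(f0 - f1 * Y T + f2 * X T) * prim δ T + _ + _)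
      ring
    · exact (hδ.ii 0 T).const_mul _
    · exact hiX.const_mul _
    · exact ((hδ.ii 0 T).const_mul _).add (hiX.const_mul _)
    · exact hiY.const_mul _

lemma sign_open (T a : ℝ) (ha : 0 < a) (u : ℝ → ℝ) (hu : BM u)
    (hval : ∀ t, u t = a ∨ u t = -a ∨ u t = 0) (ψ : ℝ → ℝ) (hψ : Continuous ψ)
    (hpos : ∀ δ, Dec u δ → ∫ t in (0:ℝ)..T, δ t * ψ t ≤ 0)
    (p q ω : ℝ) (hp : 0 ≤ p) (hq : q ≤ T) (hω : ∀ t ∈ Ioo p q, u t = ω)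
    (t0 : ℝ) (ht0 : t0 ∈ Ioo p q) (κ : ℝ) (hκ : κ * ω ≤ 0) : κ * ψ t0 ≤ 0 := by
  by_contra hcon
  push Not at hcon
  have hc : Continuous (fun t => κ * ψ t) := by fun_prop
  have hev : ∀ᶠ t in nhds t0, κ * ψ t0 / 2 < κ * ψ t ∧ t ∈ Ioo p q :=
    (hc.continuousAt.eventually_const_lt (by linarith)).and (Ioo_mem_nhds ht0.1 ht0.2)
  obtain ⟨r, hr, hball⟩ := Metric.eventually_nhds_iff_ball.1 hev
  rw [Real.ball_eq_Ioo] at hball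
  set p' := t0 - r
  set q' := t0 + r
  have hpq : p' < q' := by simp only [p', q']; linarith
  have hp' : p ≤ p' := by
    by_contra h
    push Not at h
    have h1 := (hball p ⟨h, by have := ht0.1; simp only [q']; linarith⟩).2.1
    exact lt_irrefl _ h1
  have hq' : q' ≤ q := by
    by_contra h
    push Not at h
    have h1 := (hball q ⟨by have := ht0.2; simp only [p']; linarith, h⟩).2.2
    exact lt_irrefl _ h1
  let χ : ℝ → ℝ := (Ioo p' q').indicator (fun _ => κ)
  have hχ : BM χ := by
    refine ⟨measurable_const.indicator measurableSet_Ioo, |κ| + 1, by positivity, fun t => ?_⟩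
    by_cases h : t ∈ Ioo p' q'
    · simp [χ, h]
    · simp only [χ, indicator_of_notMem h, abs_zero]; positivity
  have hI : 0 < ∫ t in (0:ℝ)..T, χ t * ψ t := by
    have e : (fun t => χ t * ψ t) = (Ioo p' q').indicator (fun t => κ * ψ t) := by
      ext t
      by_cases h : t ∈ Ioo p' q'
      · simp [χ, h]
      · simp [χ, h]
    rw [e, intervalIntegral.integral_of_le (by linarith), setIntegral_indicator measurableSet_Ioo,
      inter_eq_right.2 (show Ioo p' q' ⊆ Ioc 0 T from
        fun t ht => ⟨by linarith [ht.1], by linarith [ht.2]⟩),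
      ← integral_Ioc_eq_integral_Ioo, ← intervalIntegral.integral_of_le hpq.le]
    have h1 : ∫ t in p'..q', κ * ψ t0 / 2 ≤ ∫ t in p'..q', κ * ψ t := by
      apply intervalIntegral.integral_mono_on_of_le_Ioo hpq.le intervalIntegrable_const
        (hc.intervalIntegrable _ _)
      intro t ht
      exact (hball t ht).1.le
    rw [intervalIntegral.integral_const, smul_eq_mul] at h1
    have : 0 < (q' - p') * (κ * ψ t0 / 2) := mul_pos (by linarith) (by linarith)
    linarith
  set I := ∫ t in (0:ℝ)..T, χ t * ψ t
  set I0 := ∫ t in (0:ℝ)..T, (-1 * u t) * ψ t with hI0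
  have hM : 0 < (|I0| + 1) / I := by positivity
  have hD : Dec u (fun t => -1 * u t + (|I0| + 1) / I * χ t) := by
    refine ⟨(hu.smul _).add (hχ.smul _), a * a, by positivity, fun t ht => ?_⟩
    have h1 : χ t * u t ≤ 0 := by
      by_cases h : t ∈ Ioo p' q'
      · simp only [χ, indicator_of_mem h]
        rw [hω t ⟨by linarith [h.1], by linarith [h.2]⟩]
        exact hκ
      · simp [χ, indicator_of_notMem h]
    have h2 : u t * u t = a * a := by
      rcases hval t with h | h | h
      · rw [h]
      · rw [h]; ring
      · exact absurd h ht
    have h3 := mul_nonpos_of_nonneg_of_nonpos hM.le h1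
    nlinarith
  have h := hpos _ hD
  have e : (fun t => (-1 * u t + (|I0| + 1) / I * χ t) * ψ t) =
      fun t => (-1 * u t) * ψ t + (|I0| + 1) / I * (χ t * ψ t) := by
    ext t; ring
  rw [e, intervalIntegral.integral_add, intervalIntegral.integral_const_mul, ← hI0,
    div_mul_cancel₀ _ hI.ne'] at h
  · linarith [neg_abs_le I0]
  · exact ((hu.smul (-1)).ii 0 T).mul_continuousOn hψ.continuousOn
  · exact ((hχ.ii 0 T).mul_continuousOn hψ.continuousOn).const_mul _

lemma pmp (T a θ0 : ℝ) (hT : 0 < T) (ha : 0 < a) (u : ℝ → ℝ) (hu : BM u)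
    (hval : ∀ t, u t = a ∨ u t = -a ∨ u t = 0) :
    (∃ (u' : ℝ → ℝ) (a' : ℝ), 0 ≤ a' ∧ a' < a ∧ BM u' ∧ (∀ t, |u' t| ≤ a') ∧
      prim u' T = prim u T ∧
      prim (fun t => cos (θ0 + prim u' t)) T = prim (fun t => cos (θ0 + prim u t)) T ∧
      prim (fun t => sin (θ0 + prim u' t)) T = prim (fun t => sin (θ0 + prim u t)) T) ∨
    ∃ (l0 l1 l2 : ℝ) (ψ : ℝ → ℝ), ¬ (l0 = 0 ∧ l1 = 0 ∧ l2 = 0) ∧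
      (∀ t, ψ t = l0 + l1 * prim (fun t => cos (θ0 + prim u t)) t
            + l2 * prim (fun t => sin (θ0 + prim u t)) t) ∧
      ∀ p q ω, 0 ≤ p → p < q → q ≤ T → (∀ t ∈ Ioo p q, u t = ω) → ∀ t ∈ Icc p q,
        0 ≤ ω * ψ t ∧ (ω = 0 → ψ t = 0) := by
  by_cases hV : {v | ∃ δ, Dec u δ ∧ Lop (fun t => θ0 + prim u t) T δ = v} = univ
  · left
    apply improve T a θ0 hT ha u hu hval
    intro v
    have : v ∈ {v | ∃ δ, Dec u δ ∧ Lop (fun t => θ0 + prim u t) T δ = v} := by rw [hV]; trivial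
    exact this
  · right
    have hθ : Continuous (fun t => θ0 + prim u t) := continuous_const.add hu.prim_cont
    obtain ⟨f, hf, hfV⟩ := cone_sep _ (by
        rintro _ ⟨δ, ⟨hδ, η, hη, hd⟩, rfl⟩ _ ⟨δ', ⟨hδ', η', hη', hd'⟩, rfl⟩
        refine ⟨fun t => δ t + δ' t, ⟨hδ.add hδ', η + η', by positivity, fun t ht => ?_⟩,
          Lop_add hθ T hδ hδ'⟩
        have := hd t ht
        have := hd' t ht
        rw [add_mul]
        linarith) (by
        rintro c hc _ ⟨δ, ⟨hδ, η, hη, hd⟩, rfl⟩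
        refine ⟨fun t => c * δ t, ⟨hδ.smul c, c * η, by positivity, fun t ht => ?_⟩,
          Lop_smul _ _ _ _⟩
        have := mul_le_mul_of_nonneg_left (hd t ht) hc.le
        linarith) (by
        refine ⟨_, fun t => -1 * u t, ⟨hu.smul _, a * a, by positivity, fun t ht => ?_⟩, rfl⟩
        rcases hval t with h | h | h
        · simp only [h]; linarith
        · simp only [h]; linarith
        · exact absurd h ht) hV
    obtain ⟨l0, l1, l2, hl, hInt⟩ := sep_integral T θ0 u hu f hf
    refine ⟨l0, l1, l2, _, hl, fun t => rfl, ?_⟩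
    set ψ : ℝ → ℝ := fun t => l0 + l1 * prim (fun t => cos (θ0 + prim u t)) t
            + l2 * prim (fun t => sin (θ0 + prim u t)) t with hψd
    have hXc : Continuous (prim (fun t => cos (θ0 + prim u t))) := prim_cont' (by fun_prop)
    have hYc : Continuous (prim (fun t => sin (θ0 + prim u t))) := prim_cont' (by fun_prop)
    have hψ : Continuous ψ := by fun_prop
    have hpos : ∀ δ, Dec u δ → ∫ t in (0:ℝ)..T, δ t * ψ t ≤ 0 := by
      intro δ hδ
      have h1 := hfV _ ⟨δ, hδ, rfl⟩
      rw [hInt δ hδ.1] at h1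
      linarith
    intro p q ω hp hpq hq hω
    have key := sign_open T a ha u hu hval ψ hψ hpos p q ω hp hq hω
    have hcl : closure (Ioo p q) = Icc p q := closure_Ioo hpq.ne
    have main : ∀ κ, κ * ω ≤ 0 → ∀ t ∈ Icc p q, κ * ψ t ≤ 0 := by
      intro κ hκ
      rw [← hcl]
      exact closure_minimal (s := Ioo p q) (t := {t | κ * ψ t ≤ 0}) (fun t ht => key t ht κ hκ)
        (isClosed_le (by fun_prop) continuous_const)
    intro t ht
    refine ⟨?_, ?_⟩
    · have := main (-ω) (by nlinarith [mul_self_nonneg ω]) t ht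
      linarith
    · rintro rfl
      have h1 := main 1 (by simp) t ht
      have h2 := main (-1) (by simp) t ht
      linarith

end PartC

section PartD

open Set MeasureTheory Real

def DC (θ ω l : ℝ) : ℝ := if ω = 0 then l * cos θ else (sin (θ + ω * l) - sin θ) / ω
def DS (θ ω l : ℝ) : ℝ := if ω = 0 then l * sin θ else (cos θ - cos (θ + ω * l)) / ω

lemma DC_zero (θ ω : ℝ) : DC θ ω 0 = 0 := by simp [DC]
lemma DS_zero (θ ω : ℝ) : DS θ ω 0 = 0 := by simp [DS]

lemma DC_add (θ ω l l' : ℝ) : DC θ ω (l + l') = DC θ ω l + DC (θ + ω * l) ω l' := by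
  unfold DC
  split_ifs with h
  · subst h; simp; ring
  · rw [← add_div, mul_add, ← add_assoc]; congr 1; ring

lemma DS_add (θ ω l l' : ℝ) : DS θ ω (l + l') = DS θ ω l + DS (θ + ω * l) ω l' := by
  unfold DS
  split_ifs with h
  · subst h; simp; ring
  · rw [← add_div, mul_add, ← add_assoc]; congr 1; ring

lemma DC_congr {θ θ' : ℝ} (ω l : ℝ) (hc : cos θ = cos θ') (hs : sin θ = sin θ') :
    DC θ ω l = DC θ' ω l := by
  simp only [DC, sin_add, hc, hs]

lemma DS_congr {θ θ' : ℝ} (ω l : ℝ) (hc : cos θ = cos θ') (hs : sin θ = sin θ') :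
    DS θ ω l = DS θ' ω l := by
  simp only [DS, cos_add, hc, hs]

lemma DC_hasDeriv (θ ω l : ℝ) : HasDerivAt (DC θ ω) (cos (θ + ω * l)) l := by
  unfold DC
  by_cases h : ω = 0
  · subst h; simpa using (hasDerivAt_id l).mul_const (cos θ)
  · simp only [if_neg h]
    have := ((((hasDerivAt_id l).const_mul ω).const_add θ).sin.sub_const (sin θ)).div_const ω
    refine this.congr_deriv ?_
    simp only [id, mul_one]
    field_simp

lemma DS_hasDeriv (θ ω l : ℝ) : HasDerivAt (DS θ ω) (sin (θ + ω * l)) l := by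
  unfold DS
  by_cases h : ω = 0
  · subst h; simpa using (hasDerivAt_id l).mul_const (sin θ)
  · simp only [if_neg h]
    have := ((((hasDerivAt_id l).const_mul ω).const_add θ).cos.const_sub (cos θ)).div_const ω
    refine this.congr_deriv ?_
    simp only [id, mul_one]
    field_simp

lemma eq_of_deriv {p q : ℝ} (f g f' : ℝ → ℝ)
    (hf : ∀ t ∈ Icc p q, HasDerivWithinAt f (f' t) (Icc p q) t)
    (hg : ∀ t ∈ Icc p q, HasDerivAt g (f' t) t) (t : ℝ) (ht : t ∈ Icc p q) :
    f t = f p + (g t - g p) := by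
  have h : ∀ t ∈ Icc p q, HasDerivWithinAt (fun t => f t - g t) 0 (Icc p q) t := fun t ht => by
    simpa using (hf t ht).fun_sub (hg t ht).hasDerivWithinAt
  have := constant_of_has_deriv_right_zero (fun x hx => (h x hx).continuousWithinAt)
    (fun x hx => (h x ⟨hx.1, hx.2.le⟩).mono_of_mem_nhdsWithin (Icc_mem_nhdsGE_of_mem hx)) t ht
  linarith

lemma disp_C {p q θ ω : ℝ} (f : ℝ → ℝ)
    (hf : ∀ t ∈ Icc p q, HasDerivWithinAt f (cos (θ + ω * (t - p))) (Icc p q) t)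
    (t : ℝ) (ht : t ∈ Icc p q) : f t = f p + DC θ ω (t - p) := by
  have := eq_of_deriv f (fun t => DC θ ω (t - p)) _ hf (fun t _ => by
    exact (DC_hasDeriv θ ω (t - p)).comp_sub_const t p) t ht
  simpa [DC_zero] using this

lemma disp_S {p q θ ω : ℝ} (f : ℝ → ℝ)
    (hf : ∀ t ∈ Icc p q, HasDerivWithinAt f (sin (θ + ω * (t - p))) (Icc p q) t)
    (t : ℝ) (ht : t ∈ Icc p q) : f t = f p + DS θ ω (t - p) := by
  have := eq_of_deriv f (fun t => DS θ ω (t - p)) _ hf (fun t _ => by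
    exact (DS_hasDeriv θ ω (t - p)).comp_sub_const t p) t ht
  simpa [DS_zero] using this

/-- behaviour of a control on a piece where it is constant -/
lemma piece_angle {u : ℝ → ℝ} (hu : BM u) {p q ω : ℝ}
    (h : ∀ t ∈ Ioo p q, u t = ω) (t : ℝ) (ht : t ∈ Icc p q) :
    prim u t = prim u p + ω * (t - p) := by
  have h1 := hu.prim_sub p t
  have h2 : ∫ x in p..t, u x = ∫ x in p..t, ω := by
    rw [intervalIntegral.integral_of_le ht.1, intervalIntegral.integral_of_le ht.1,
      integral_Ioc_eq_integral_Ioo, integral_Ioc_eq_integral_Ioo]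
    exact setIntegral_congr_fun measurableSet_Ioo fun x hx => h x ⟨hx.1, hx.2.trans_le ht.2⟩
  rw [h2, intervalIntegral.integral_const, smul_eq_mul] at h1
  linarith

lemma piece_C {u : ℝ → ℝ} (hu : BM u) (θ0 : ℝ) {p q ω : ℝ}
    (h : ∀ t ∈ Ioo p q, u t = ω) (t : ℝ) (ht : t ∈ Icc p q) :
    prim (fun t => cos (θ0 + prim u t)) t = prim (fun t => cos (θ0 + prim u t)) p
      + DC (θ0 + prim u p) ω (t - p) := by
  refine disp_C (q := q) (prim (fun t => cos (θ0 + prim u t))) (fun t ht => ?_) t ht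
  have hc : Continuous (fun t => cos (θ0 + prim u t)) := by
    have := hu.prim_cont
    fun_prop
  have := (prim_hasDeriv hc t).hasDerivWithinAt (s := Icc p q)
  rw [piece_angle hu h t ht, ← add_assoc] at this
  exact this

lemma piece_S {u : ℝ → ℝ} (hu : BM u) (θ0 : ℝ) {p q ω : ℝ}
    (h : ∀ t ∈ Ioo p q, u t = ω) (t : ℝ) (ht : t ∈ Icc p q) :
    prim (fun t => sin (θ0 + prim u t)) t = prim (fun t => sin (θ0 + prim u t)) p
      + DS (θ0 + prim u p) ω (t - p) := by
  refine disp_S (q := q) (prim (fun t => sin (θ0 + prim u t))) (fun t ht => ?_) t ht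
  have hc : Continuous (fun t => sin (θ0 + prim u t)) := by
    have := hu.prim_cont
    fun_prop
  have := (prim_hasDeriv hc t).hasDerivWithinAt (s := Icc p q)
  rw [piece_angle hu h t ht, ← add_assoc] at this
  exact this

/-- no admissible control with a smaller bound -/
def NB (a T θ0 X Y Θ : ℝ) : Prop := ∀ (u' : ℝ → ℝ) (a' : ℝ), 0 ≤ a' → a' < a → BM u' →
  (∀ t, |u' t| ≤ a') → cos (θ0 + prim u' T) = cos Θ → sin (θ0 + prim u' T) = sin Θ →
  prim (fun t => cos (θ0 + prim u' t)) T = X → prim (fun t => sin (θ0 + prim u' t)) T = Y → False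

/-- Data of the adjoint function on a piece -/
def Piece (l1 l2 : ℝ) (ψ θ : ℝ → ℝ) (p q ω : ℝ) : Prop :=
  ∀ b ∈ Icc p q, ∀ c ∈ Icc p q, θ c = θ b + ω * (c - b) ∧
    ψ c = ψ b + l1 * DC (θ b) ω (c - b) + l2 * DS (θ b) ω (c - b) ∧
    0 ≤ ω * ψ c ∧ (ω = 0 → ψ c = 0)

lemma mk_piece {u : ℝ → ℝ} (hu : BM u) (θ0 T : ℝ) {l0 l1 l2 : ℝ} {ψ : ℝ → ℝ}
    (hψ : ∀ t, ψ t = l0 + l1 * prim (fun t => cos (θ0 + prim u t)) t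
            + l2 * prim (fun t => sin (θ0 + prim u t)) t)
    (hs : ∀ p q ω, 0 ≤ p → p < q → q ≤ T → (∀ t ∈ Ioo p q, u t = ω) → ∀ t ∈ Icc p q,
        0 ≤ ω * ψ t ∧ (ω = 0 → ψ t = 0)) (p q ω : ℝ) (hp : 0 ≤ p) (hpq : p < q) (hq : q ≤ T)
    (h : ∀ t ∈ Ioo p q, u t = ω) : Piece l1 l2 ψ (fun t => θ0 + prim u t) p q ω := by
  intro b hb c hc
  have a1 := piece_angle hu h b hb
  have a2 := piece_angle hu h c hc
  refine ⟨by simp only; linarith, ?_, hs p q ω hp hpq hq h c hc⟩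
  have c1 := piece_C hu θ0 h b hb
  have c2 := piece_C hu θ0 h c hc
  have d1 := piece_S hu θ0 h b hb
  have d2 := piece_S hu θ0 h c hc
  have e1 := DC_add (θ0 + prim u p) ω (b - p) (c - b)
  have e2 := DS_add (θ0 + prim u p) ω (b - p) (c - b)
  rw [show b - p + (c - b) = c - p by ring, add_assoc, ← a1] at e1 e2
  rw [hψ, hψ, c2, c1, d2, d1, e1, e2]
  ring

def u4 (w1 w2 w3 w4 t1 t2 t3 t : ℝ) : ℝ :=
  if t < t1 then w1 else if t < t2 then w2 else if t < t3 then w3 else w4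

lemma pmp4 {a T θ0 : ℝ} (hT : 0 < T) (ha : 0 < a) {w1 w2 w3 w4 t1 t2 t3 : ℝ}
    (h1 : w1 = a ∨ w1 = -a ∨ w1 = 0) (h2 : w2 = a ∨ w2 = -a ∨ w2 = 0)
    (h3 : w3 = a ∨ w3 = -a ∨ w3 = 0) (h4 : w4 = a ∨ w4 = -a ∨ w4 = 0)
    (o1 : 0 ≤ t1) (o2 : t1 ≤ t2) (o3 : t2 ≤ t3) (o4 : t3 ≤ T)
    (hnb : NB a T θ0
      (DC θ0 w1 t1 + DC (θ0 + w1 * t1) w2 (t2 - t1)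
        + DC (θ0 + w1 * t1 + w2 * (t2 - t1)) w3 (t3 - t2)
        + DC (θ0 + w1 * t1 + w2 * (t2 - t1) + w3 * (t3 - t2)) w4 (T - t3))
      (DS θ0 w1 t1 + DS (θ0 + w1 * t1) w2 (t2 - t1)
        + DS (θ0 + w1 * t1 + w2 * (t2 - t1)) w3 (t3 - t2)
        + DS (θ0 + w1 * t1 + w2 * (t2 - t1) + w3 * (t3 - t2)) w4 (T - t3))
      (θ0 + w1 * t1 + w2 * (t2 - t1) + w3 * (t3 - t2) + w4 * (T - t3))) :
    ∃ (l1 l2 : ℝ) (ψ θ : ℝ → ℝ), (l1 = 0 → l2 = 0 → ∀ t, ψ t ≠ 0) ∧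
      (0 < t1 → Piece l1 l2 ψ θ 0 t1 w1) ∧ (t1 < t2 → Piece l1 l2 ψ θ t1 t2 w2) ∧
      (t2 < t3 → Piece l1 l2 ψ θ t2 t3 w3) ∧ (t3 < T → Piece l1 l2 ψ θ t3 T w4) := by
  set u := u4 w1 w2 w3 w4 t1 t2 t3 with hud
  have hval : ∀ t, u t = a ∨ u t = -a ∨ u t = 0 := by
    intro t
    simp only [hud, u4]
    split_ifs <;> assumption
  have hu : BM u := by
    refine ⟨?_, a, ha, fun t => ?_⟩
    · unfold u u4
      exact Measurable.ite measurableSet_Iio measurable_const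
        (Measurable.ite measurableSet_Iio measurable_const
        (Measurable.ite measurableSet_Iio measurable_const measurable_const))
    · rcases hval t with h | h | h <;> rw [h] <;> simp [abs_of_pos ha, ha.le]
  have p1 : ∀ t ∈ Ioo 0 t1, u t = w1 := fun t ht => by simp [hud, u4, ht.2]
  have p2 : ∀ t ∈ Ioo t1 t2, u t = w2 := fun t ht => by
    simp [hud, u4, ht.2, not_lt.2 ht.1.le]
  have p3 : ∀ t ∈ Ioo t2 t3, u t = w3 := fun t ht => by
    simp [hud, u4, ht.2, not_lt.2 ht.1.le, not_lt.2 (o2.trans ht.1.le)]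
  have p4 : ∀ t ∈ Ioo t3 T, u t = w4 := fun t ht => by
    simp [hud, u4, not_lt.2 ht.1.le, not_lt.2 (o3.trans ht.1.le),
      not_lt.2 (o2.trans (o3.trans ht.1.le))]
  have z0 : ∀ f, prim f 0 = 0 := fun f => by simp [prim]
  have a1 := piece_angle hu p1 t1 ⟨o1, le_rfl⟩
  have a2 := piece_angle hu p2 t2 ⟨o2, le_rfl⟩
  have a3 := piece_angle hu p3 t3 ⟨o3, le_rfl⟩
  have a4 := piece_angle hu p4 T ⟨o4, le_rfl⟩
  have c1 := piece_C hu θ0 p1 t1 ⟨o1, le_rfl⟩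
  have c2 := piece_C hu θ0 p2 t2 ⟨o2, le_rfl⟩
  have c3 := piece_C hu θ0 p3 t3 ⟨o3, le_rfl⟩
  have c4 := piece_C hu θ0 p4 T ⟨o4, le_rfl⟩
  have d1 := piece_S hu θ0 p1 t1 ⟨o1, le_rfl⟩
  have d2 := piece_S hu θ0 p2 t2 ⟨o2, le_rfl⟩
  have d3 := piece_S hu θ0 p3 t3 ⟨o3, le_rfl⟩
  have d4 := piece_S hu θ0 p4 T ⟨o4, le_rfl⟩
  simp only [z0, sub_zero, add_zero, zero_add] at a1 c1 d1
  have b1 : θ0 + prim u t1 = θ0 + w1 * t1 := by rw [a1]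
  have b2 : θ0 + prim u t2 = θ0 + w1 * t1 + w2 * (t2 - t1) := by rw [a2, ← add_assoc, b1]
  have b3 : θ0 + prim u t3 = θ0 + w1 * t1 + w2 * (t2 - t1) + w3 * (t3 - t2) := by
    rw [a3, ← add_assoc, b2]
  have b4 : θ0 + prim u T = θ0 + w1 * t1 + w2 * (t2 - t1) + w3 * (t3 - t2) + w4 * (T - t3) := by
    rw [a4, ← add_assoc, b3]
  rw [b1] at c2 d2
  rw [b2] at c3 d3
  rw [b3] at c4 d4
  rw [c3, c2, c1] at c4
  rw [d3, d2, d1] at d4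
  rcases pmp T a θ0 hT ha u hu hval with ⟨u', a', g1, g2, g3, g4, g5, g6, g7⟩ | ⟨l0, l1, l2, ψ, n, hψ, hs⟩
  · exfalso
    refine hnb u' a' g1 g2 g3 g4 ?_ ?_ ?_ ?_
    · rw [g5, b4]
    · rw [g5, b4]
    · rw [g6, c4]
    · rw [g7, d4]
  · refine ⟨l1, l2, ψ, fun t => θ0 + prim u t, ?_, ?_, ?_, ?_, ?_⟩
    · intro e1 e2 t e3
      apply n
      rw [hψ, e1, e2] at e3
      exact ⟨by simpa using e3, e1, e2⟩
    · exact fun h => mk_piece hu θ0 T hψ hs _ _ _ le_rfl h (by linarith) p1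
    · exact fun h => mk_piece hu θ0 T hψ hs _ _ _ (by linarith) h (by linarith) p2
    · exact fun h => mk_piece hu θ0 T hψ hs _ _ _ (by linarith) h (by linarith) p3
    · exact fun h => mk_piece hu θ0 T hψ hs _ _ _ (by linarith) h (by linarith) p4

lemma lemG {l1 l2 : ℝ} {ψ θ : ℝ → ℝ} {p q ω b c : ℝ} (hω : ω ≠ 0)
    (hn : l1 = 0 → l2 = 0 → ∀ t, ψ t ≠ 0) (hP : Piece l1 l2 ψ θ p q ω)
    (hb : b ∈ Icc p q) (hc : c ∈ Icc p q) (h1 : ψ b = 0) (h2 : ψ c = 0)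
    (hm : l1 * cos (θ b) + l2 * sin (θ b) = 0) (hk : ∀ k : ℤ, ω * (c - b) ≠ 2 * π * k) : False := by
  have h := (hP b hb c hc).2.1
  rw [h1, h2] at h
  unfold DC DS at h
  rw [if_neg hω, if_neg hω] at h
  set x := ω * (c - b)
  have hx : cos x ≠ 1 := by
    intro h
    obtain ⟨k, hk'⟩ := (Real.cos_eq_one_iff x).1 h
    exact hk k (by rw [← hk']; ring)
  rw [sin_add, cos_add] at h
  have h' : (l1 * cos (θ b) + l2 * sin (θ b)) * sin x
      + (-l1 * sin (θ b) + l2 * cos (θ b)) * (1 - cos x) = 0 := by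
    field_simp at h
    linarith
  rw [hm, zero_mul, zero_add, mul_eq_zero] at h'
  have hnn : -l1 * sin (θ b) + l2 * cos (θ b) = 0 := by
    rcases h' with h' | h'
    · exact h'
    · exact absurd (by linarith) hx
  have sc := sin_sq_add_cos_sq (θ b)
  refine hn ?_ ?_ b h1
  · linear_combination (cos (θ b)) * hm - sin (θ b) * hnn - l1 * sc
  · linear_combination (sin (θ b)) * hm + cos (θ b) * hnn - l2 * sc

/-- vanishing of the first coefficient from a two-sided sign condition -/
lemma lem_m {m n ε : ℝ} (hε : 0 < ε) (h : ∀ x, |x| < ε → 0 ≤ m * sin x + n * (1 - cos x)) :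
    m = 0 := by
  have hd : HasDerivAt (fun x => m * sin x + n * (1 - cos x)) m 0 := by
    have := ((hasDerivAt_sin 0).const_mul m).fun_add (((hasDerivAt_cos 0).const_sub 1).const_mul n)
    simpa using this
  have hl : IsLocalMin (fun x => m * sin x + n * (1 - cos x)) 0 := by
    filter_upwards [Metric.ball_mem_nhds (0:ℝ) hε] with x hx
    have := h x (by simpa using hx)
    simpa using this
  exact hl.hasDerivAt_eq_zero hd

end PartD

section PartE

open Set MeasureTheory Real

lemma DCS {ω : ℝ} (hω : ω ≠ 0) (l1 l2 θ l : ℝ) :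
    ω * (l1 * DC θ ω l + l2 * DS θ ω l) =
      (l1 * cos θ + l2 * sin θ) * sin (ω * l) + (-l1 * sin θ + l2 * cos θ) * (1 - cos (ω * l)) := by
  unfold DC DS
  rw [if_neg hω, if_neg hω, sin_add, cos_add]
  field_simp
  ring

lemma two_sided {l1 l2 : ℝ} {ψ θ : ℝ → ℝ} {p1 b1 b2 q2 ω : ℝ} (hω : ω ≠ 0)
    (h1 : p1 < b1) (h2 : b2 < q2) (hl : Piece l1 l2 ψ θ p1 b1 ω) (hr : Piece l1 l2 ψ θ b2 q2 ω)
    (e1 : ψ b1 = 0) (e2 : ψ b2 = 0) (hc : cos (θ b1) = cos (θ b2)) (hs : sin (θ b1) = sin (θ b2)) :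
    l1 * cos (θ b2) + l2 * sin (θ b2) = 0 := by
  have hω' : 0 < |ω| := abs_pos.2 hω
  have hmin : 0 < min (b1 - p1) (q2 - b2) := lt_min (by linarith) (by linarith)
  refine lem_m (n := -l1 * sin (θ b2) + l2 * cos (θ b2)) (ε := |ω| * min (b1 - p1) (q2 - b2))
    (by positivity) fun x hx => ?_
  obtain ⟨τ, rfl⟩ : ∃ τ, x = ω * τ := ⟨x / ω, by field_simp⟩
  rw [abs_mul, mul_lt_mul_iff_right₀ hω', lt_min_iff, abs_lt, abs_lt] at hx
  rcases le_total τ 0 with h | h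
  · obtain ⟨-, k2, k3, -⟩ := hl b1 ⟨h1.le, le_rfl⟩ (b1 + τ) ⟨by linarith, by linarith⟩
    rw [k2, e1, zero_add, DCS hω, hc, hs] at k3
    simpa using k3
  · obtain ⟨-, k2, k3, -⟩ := hr b2 ⟨le_rfl, h2.le⟩ (b2 + τ) ⟨by linarith, by linarith⟩
    rw [k2, e2, zero_add, DCS hω] at k3
    simpa using k3

lemma sgn0 {ω x : ℝ} (hω : ω ≠ 0) (h1 : 0 ≤ ω * x) (h2 : 0 ≤ -ω * x) : x = 0 := by
  have : ω * x = 0 := by linarith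
  simpa [hω] using this

lemma nk {a ω l : ℝ} (hω : ω = a ∨ ω = -a) (h : ∀ k : ℤ, a * l ≠ 2 * π * k) :
    (∀ k : ℤ, ω * l ≠ 2 * π * k) ∧ (∀ k : ℤ, ω * (-l) ≠ 2 * π * k) := by
  rcases hω with rfl | rfl
  · refine ⟨h, fun k hk => h (-k) ?_⟩
    push_cast; linarith
  · refine ⟨fun k hk => h (-k) ?_, fun k hk => h k ?_⟩
    · push_cast; linarith
    · linarith

lemma lk {a ω l : ℝ} (hω : ω = a ∨ ω = -a) (h : ∃ k : ℤ, a * l = 2 * π * k) :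
    ∃ j : ℤ, ω * l = j * (2 * π) := by
  obtain ⟨k, hk⟩ := h
  rcases hω with rfl | rfl
  · exact ⟨k, by linarith⟩
  · exact ⟨-k, by push_cast; linarith⟩

/-- three piece data -/
def NB3 (a θ0 w1 w2 w3 s1 s2 tf : ℝ) : Prop := NB a tf θ0
  (DC θ0 w1 s1 + DC (θ0 + w1 * s1) w2 (s2 - s1)
    + DC (θ0 + w1 * s1 + w2 * (s2 - s1)) w3 (tf - s2))
  (DS θ0 w1 s1 + DS (θ0 + w1 * s1) w2 (s2 - s1)
    + DS (θ0 + w1 * s1 + w2 * (s2 - s1)) w3 (tf - s2))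
  (θ0 + w1 * s1 + w2 * (s2 - s1) + w3 * (tf - s2))

lemma pmp3 {a tf θ0 : ℝ} (ha : 0 < a) {w1 w2 w3 s1 s2 : ℝ}
    (h1 : w1 = a ∨ w1 = -a ∨ w1 = 0) (h2 : w2 = a ∨ w2 = -a ∨ w2 = 0)
    (h3 : w3 = a ∨ w3 = -a ∨ w3 = 0)
    (o1 : 0 < s1) (o2 : s1 < s2) (o3 : s2 < tf) (hnb : NB3 a θ0 w1 w2 w3 s1 s2 tf) :
    ∃ (l1 l2 : ℝ) (ψ θ : ℝ → ℝ), (l1 = 0 → l2 = 0 → ∀ t, ψ t ≠ 0) ∧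
      Piece l1 l2 ψ θ 0 s1 w1 ∧ Piece l1 l2 ψ θ s1 s2 w2 ∧ Piece l1 l2 ψ θ s2 tf w3 := by
  obtain ⟨l1, l2, ψ, θ, h, k1, k2, k3, -⟩ := pmp4 (θ0 := θ0) (T := tf) (by linarith) ha h1 h2 h3 h3
    o1.le o2.le o3.le le_rfl (by
      unfold NB3 at hnb
      simpa [DC_zero, DS_zero] using hnb)
  exact ⟨l1, l2, ψ, θ, h, k1 o1, k2 o2, k3 o3⟩

variable {a tf θ0 w1 w2 w3 s1 s2 : ℝ}

lemma case_Sstart (ha : 0 < a) (h2 : w2 = a ∨ w2 = -a) (h1 : w1 = 0) (h3 : w3 = 0 ∨ w3 = -w2)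
    (o1 : 0 < s1) (o2 : s1 < s2) (o3 : s2 < tf) (hk : ∀ k : ℤ, a * (s2 - s1) ≠ 2 * π * k)
    (hnb : NB3 a θ0 w1 w2 w3 s1 s2 tf) : False := by
  have hw : w2 ≠ 0 := by rcases h2 with rfl | rfl <;> simp [ha.ne']
  obtain ⟨l1, l2, ψ, θ, hn, P1, P2, P3⟩ := pmp3 ha (by tauto) (by tauto) (by
    rcases h3 with rfl | rfl
    · tauto
    · rcases h2 with rfl | rfl <;> simp) o1 o2 o3 hnb
  have m0 : (0:ℝ) ∈ Icc 0 s1 := ⟨le_rfl, o1.le⟩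
  have m1 : s1 ∈ Icc 0 s1 := ⟨o1.le, le_rfl⟩
  have m1' : s1 ∈ Icc s1 s2 := ⟨le_rfl, o2.le⟩
  have m2 : s2 ∈ Icc s1 s2 := ⟨o2.le, le_rfl⟩
  have m2' : s2 ∈ Icc s2 tf := ⟨le_rfl, o3.le⟩
  have z0 := (P1 0 m0 0 m0).2.2.2 h1
  obtain ⟨q1, q2, -, q4⟩ := P1 0 m0 s1 m1
  have z1 := q4 h1
  have z2 : ψ s2 = 0 := by
    have r1 := (P2 s2 m2 s2 m2).2.2.1
    have r2 := (P3 s2 m2' s2 m2').2.2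
    rcases h3 with h3 | h3
    · exact r2.2 h3
    · rw [h3] at r2
      exact sgn0 hw r1 r2.1
  refine lemG hw hn P2 m1' m2 z1 z2 ?_ (nk h2 hk).1
  rw [z0, z1, h1] at q2
  rw [h1] at q1
  simp [DC, DS] at q2 q1
  rw [q1]
  have : s1 * (l1 * cos (θ 0) + l2 * sin (θ 0)) = 0 := by linarith
  simpa [o1.ne'] using this

lemma case_Send (ha : 0 < a) (h2 : w2 = a ∨ w2 = -a) (h1 : w1 = 0 ∨ w1 = -w2) (h3 : w3 = 0)
    (o1 : 0 < s1) (o2 : s1 < s2) (o3 : s2 < tf) (hk : ∀ k : ℤ, a * (s2 - s1) ≠ 2 * π * k)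
    (hnb : NB3 a θ0 w1 w2 w3 s1 s2 tf) : False := by
  have hw : w2 ≠ 0 := by rcases h2 with rfl | rfl <;> simp [ha.ne']
  obtain ⟨l1, l2, ψ, θ, hn, P1, P2, P3⟩ := pmp3 ha (by
    rcases h1 with rfl | rfl
    · tauto
    · rcases h2 with rfl | rfl <;> simp) (by tauto) (by tauto) o1 o2 o3 hnb
  have m1 : s1 ∈ Icc 0 s1 := ⟨o1.le, le_rfl⟩
  have m1' : s1 ∈ Icc s1 s2 := ⟨le_rfl, o2.le⟩
  have m2 : s2 ∈ Icc s1 s2 := ⟨o2.le, le_rfl⟩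
  have m2' : s2 ∈ Icc s2 tf := ⟨le_rfl, o3.le⟩
  have m3 : tf ∈ Icc s2 tf := ⟨o3.le, le_rfl⟩
  have z0 := (P3 s2 m2' s2 m2').2.2.2 h3
  obtain ⟨q1, q2, -, q4⟩ := P3 s2 m2' tf m3
  have z1 := q4 h3
  have z2 : ψ s1 = 0 := by
    have r1 := (P2 s1 m1' s1 m1').2.2.1
    have r2 := (P1 s1 m1 s1 m1).2.2
    rcases h1 with h3 | h3
    · exact r2.2 h3
    · rw [h3] at r2
      exact sgn0 hw r1 r2.1
  refine lemG hw hn P2 m2 m1' z0 z2 ?_ (by simpa using (nk h2 hk).2)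
  rw [z0, z1, h3] at q2
  simp [DC, DS] at q2
  have : (tf - s2) * (l1 * cos (θ s2) + l2 * sin (θ s2)) = 0 := by linarith
  simpa [sub_ne_zero.2 o3.ne'] using this

lemma trig_loop {x : ℝ} (h : ∃ j : ℤ, x = j * (2 * π)) (y : ℝ) :
    cos (y + x) = cos y ∧ sin (y + x) = sin y := by
  obtain ⟨j, rfl⟩ := h
  exact ⟨cos_add_int_mul_two_pi _ _, sin_add_int_mul_two_pi _ _⟩

lemma D_loop {ω l : ℝ} (hω : ω ≠ 0) (h : ∃ j : ℤ, ω * l = j * (2 * π)) (θ : ℝ) :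
    DC θ ω l = 0 ∧ DS θ ω l = 0 := by
  obtain ⟨e1, e2⟩ := trig_loop h θ
  simp [DC, DS, hω, e1, e2]

lemma half (ha : 0 < a) (o2 : s1 < s2) :
    ∃ r, 0 < r ∧ r < s2 - s1 ∧ (∀ k : ℤ, a * r ≠ 2 * π * k) := by
  have hp := pi_pos
  refine ⟨min ((s2 - s1) / 2) (π / a), lt_min (by linarith) (by positivity),
    (min_le_left _ _).trans_lt (by linarith), fun k hk => ?_⟩
  have h0 : 0 < min ((s2 - s1) / 2) (π / a) := lt_min (by linarith) (by positivity)
  have h1 : a * min ((s2 - s1) / 2) (π / a) ≤ π := by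
    calc _ ≤ a * (π / a) := by gcongr; exact min_le_right _ _
      _ = π := by field_simp
  have h2 : 0 < a * min ((s2 - s1) / 2) (π / a) := by positivity
  rw [hk] at h1 h2
  have k1 : (0:ℝ) < k := by
    by_contra! h
    nlinarith
  have k2 : (k:ℝ) < 1 := by nlinarith
  norm_cast at k1 k2
  omega

lemma case_Lstart (ha : 0 < a) (h2 : w2 = a ∨ w2 = -a)
    (o1 : 0 < s1) (o2 : s1 < s2) (o3 : s2 < tf) (hl : ∃ k : ℤ, a * s1 = 2 * π * k)
    (hnb : NB3 a θ0 (-w2) w2 (-w2) s1 s2 tf) : False := by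
  have hw : w2 ≠ 0 := by rcases h2 with rfl | rfl <;> simp [ha.ne']
  have h2' : -w2 = a ∨ -w2 = -a := by rcases h2 with rfl | rfl <;> simp
  obtain ⟨r', hr0, hr1, hrk⟩ := half ha o2
  have hj' := lk h2' hl
  obtain ⟨r, hr⟩ : ∃ r, r = s2 - s1 - r' := ⟨_, rfl⟩
  obtain ⟨l1, l2, ψ, θ, hn, P1, P2, P3, P4⟩ := pmp4 (θ0 := θ0) (T := tf) (a := a) (w1 := w2)
    (w2 := -w2) (w3 := w2) (w4 := -w2) (t1 := r) (t2 := r + s1) (t3 := s2) (by linarith) ha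
    (by tauto) (by tauto) (by tauto) (by tauto) (by linarith) (by linarith) (by linarith)
    (by linarith) (by
      unfold NB3 at hnb
      have E1 : r + s1 - r = s1 := by ring
      have E2 : s2 - (r + s1) = s2 - s1 - r := by ring
      have E3 : θ0 + w2 * r + -w2 * s1 + w2 * (s2 - s1 - r) = θ0 + -w2 * s1 + w2 * (s2 - s1) := by
        ring
      rw [E1, E2, E3, (D_loop (neg_ne_zero.2 hw) hj' _).1, (D_loop (neg_ne_zero.2 hw) hj' _).2]
      rw [(D_loop (neg_ne_zero.2 hw) hj' _).1, (D_loop (neg_ne_zero.2 hw) hj' _).2] at hnb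
      obtain ⟨c1, c2⟩ := trig_loop hj' θ0
      obtain ⟨c3, c4⟩ := trig_loop hj' (θ0 + w2 * r)
      rw [DC_congr _ _ c1 c2, DS_congr _ _ c1 c2] at hnb
      rw [DC_congr _ _ c3 c4, DS_congr _ _ c3 c4]
      have A1 := DC_add θ0 w2 r (s2 - s1 - r)
      have A2 := DS_add θ0 w2 r (s2 - s1 - r)
      rw [show r + (s2 - s1 - r) = s2 - s1 by ring] at A1 A2
      rw [add_zero, add_zero, ← A1, ← A2]
      rw [zero_add, zero_add] at hnb
      exact hnb)
  replace P1 := P1 (by linarith)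
  replace P2 := P2 (by linarith)
  replace P3 := P3 (by linarith)
  replace P4 := P4 (by linarith)
  have i1 : r ∈ Icc 0 r := ⟨by linarith, le_rfl⟩
  have i1' : r ∈ Icc r (r + s1) := ⟨le_rfl, by linarith⟩
  have i2 : r + s1 ∈ Icc r (r + s1) := ⟨by linarith, le_rfl⟩
  have i2' : r + s1 ∈ Icc (r + s1) s2 := ⟨le_rfl, by linarith⟩
  have i3 : s2 ∈ Icc (r + s1) s2 := ⟨by linarith, le_rfl⟩
  have i3' : s2 ∈ Icc s2 tf := ⟨le_rfl, by linarith⟩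
  have z1 := sgn0 hw (P1 _ i1 _ i1).2.2.1 (P2 _ i1' _ i1').2.2.1
  have z2 := sgn0 hw (P3 _ i2' _ i2').2.2.1 (P2 _ i2 _ i2).2.2.1
  have z3 := sgn0 hw (P3 _ i3 _ i3).2.2.1 (P4 _ i3' _ i3').2.2.1
  have ang := (P2 _ i1' _ i2).1
  rw [show r + s1 - r = s1 by ring] at ang
  obtain ⟨c1, c2⟩ := trig_loop hj' (θ r)
  rw [← ang] at c1 c2
  have hm := two_sided hw (by linarith) (by linarith) P1 P3 z1 z2 c1.symm c2.symm
  refine lemG hw hn P3 i2' i3 z2 z3 hm ?_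
  rw [show s2 - (r + s1) = r' by rw [hr]; ring]
  exact (nk h2 hrk).1

lemma case_Lend (ha : 0 < a) (h2 : w2 = a ∨ w2 = -a)
    (o1 : 0 < s1) (o2 : s1 < s2) (o3 : s2 < tf) (hl : ∃ k : ℤ, a * (tf - s2) = 2 * π * k)
    (hnb : NB3 a θ0 (-w2) w2 (-w2) s1 s2 tf) : False := by
  have hw : w2 ≠ 0 := by rcases h2 with rfl | rfl <;> simp [ha.ne']
  have h2' : -w2 = a ∨ -w2 = -a := by rcases h2 with rfl | rfl <;> simp
  obtain ⟨r, hr0, hr1, hrk⟩ := half ha o2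
  have hj' := lk h2' hl
  obtain ⟨L, hL⟩ : ∃ L, L = tf - s2 := ⟨_, rfl⟩
  rw [← hL] at hj'
  obtain ⟨l1, l2, ψ, θ, hn, P1, P2, P3, P4⟩ := pmp4 (θ0 := θ0) (T := tf) (a := a) (w1 := -w2)
    (w2 := w2) (w3 := -w2) (w4 := w2) (t1 := s1) (t2 := s1 + r) (t3 := s1 + r + L) (by linarith) ha
    (by tauto) (by tauto) (by tauto) (by tauto) (by linarith) (by linarith) (by linarith)
    (by linarith) (by
      unfold NB3 at hnb
      have E1 : s1 + r - s1 = r := by ring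
      have E2 : s1 + r + L - (s1 + r) = L := by ring
      have E3 : tf - (s1 + r + L) = s2 - s1 - r := by rw [hL]; ring
      rw [E1, E2, E3, (D_loop (neg_ne_zero.2 hw) hj' _).1, (D_loop (neg_ne_zero.2 hw) hj' _).2]
      rw [← hL, (D_loop (neg_ne_zero.2 hw) hj' _).1, (D_loop (neg_ne_zero.2 hw) hj' _).2] at hnb
      obtain ⟨c3, c4⟩ := trig_loop hj' (θ0 + -w2 * s1 + w2 * r)
      rw [DC_congr _ _ c3 c4, DS_congr _ _ c3 c4]
      have A1 := DC_add (θ0 + -w2 * s1) w2 r (s2 - s1 - r)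
      have A2 := DS_add (θ0 + -w2 * s1) w2 r (s2 - s1 - r)
      rw [show r + (s2 - s1 - r) = s2 - s1 by ring] at A1 A2
      rw [add_zero, add_zero, add_assoc, add_assoc (DS _ _ _), ← A1, ← A2]
      rw [add_zero, add_zero] at hnb
      rw [show θ0 + -w2 * s1 + w2 * r + -w2 * L + w2 * (s2 - s1 - r) =
        θ0 + -w2 * s1 + w2 * (s2 - s1) + -w2 * L by ring]
      exact hnb)
  replace P1 := P1 (by linarith)
  replace P2 := P2 (by linarith)
  replace P3 := P3 (by linarith)
  replace P4 := P4 (by linarith)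
  have i1 : s1 ∈ Icc 0 s1 := ⟨by linarith, le_rfl⟩
  have i1' : s1 ∈ Icc s1 (s1 + r) := ⟨le_rfl, by linarith⟩
  have i2 : s1 + r ∈ Icc s1 (s1 + r) := ⟨by linarith, le_rfl⟩
  have i2' : s1 + r ∈ Icc (s1 + r) (s1 + r + L) := ⟨le_rfl, by linarith⟩
  have i3 : s1 + r + L ∈ Icc (s1 + r) (s1 + r + L) := ⟨by linarith, le_rfl⟩
  have i3' : s1 + r + L ∈ Icc (s1 + r + L) tf := ⟨le_rfl, by linarith⟩
  have z1 := sgn0 hw (P2 _ i1' _ i1').2.2.1 (P1 _ i1 _ i1).2.2.1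
  have z2 := sgn0 hw (P2 _ i2 _ i2).2.2.1 (P3 _ i2' _ i2').2.2.1
  have z3 := sgn0 hw (P4 _ i3' _ i3').2.2.1 (P3 _ i3 _ i3).2.2.1
  have ang := (P3 _ i2' _ i3).1
  rw [show s1 + r + L - (s1 + r) = L by ring] at ang
  obtain ⟨c1, c2⟩ := trig_loop hj' (θ (s1 + r))
  rw [← ang] at c1 c2
  have hm := two_sided hw (by linarith) (by linarith) P2 P4 z2 z3 c1.symm c2.symm
  rw [c1, c2] at hm
  refine lemG hw hn P2 i2 i1' z2 z1 hm ?_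
  rw [show s1 - (s1 + r) = -r by ring]
  exact (nk h2 hrk).2

/-- Core: all cases together -/
lemma core (ha : 0 < a) (h2 : w2 = a ∨ w2 = -a) (h1 : w1 = 0 ∨ w1 = -w2) (h3 : w3 = 0 ∨ w3 = -w2)
    (o1 : 0 < s1) (o2 : s1 < s2) (o3 : s2 < tf) (hk : ∀ k : ℤ, a * (s2 - s1) ≠ 2 * π * k)
    (hx : w1 = 0 ∨ w3 = 0 ∨ (∃ k : ℤ, a * s1 = 2 * π * k) ∨ ∃ k : ℤ, a * (tf - s2) = 2 * π * k)
    (hnb : NB3 a θ0 w1 w2 w3 s1 s2 tf) : False := by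
  by_cases e1 : w1 = 0
  · exact case_Sstart ha h2 e1 h3 o1 o2 o3 hk hnb
  by_cases e3 : w3 = 0
  · exact case_Send ha h2 h1 e3 o1 o2 o3 hk hnb
  obtain rfl : w1 = -w2 := by tauto
  obtain rfl : w3 = -w2 := by tauto
  rcases hx with h | h | h | h
  · tauto
  · tauto
  · exact case_Lstart ha h2 o1 o2 o3 h hnb
  · exact case_Lend ha h2 o1 o2 o3 h hnb

end PartE

lemma pt0 (x y : ℝ) : pt x y 0 = x := rfl
lemma pt1 (x y : ℝ) : pt x y 1 = y := rfl

lemma pt_eq (v : Pt) : v = pt (v 0) (v 1) := by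
  ext i; fin_cases i <;> rfl

lemma pt_norm (v : Pt) : ‖v‖ ^ 2 = v 0 ^ 2 + v 1 ^ 2 := by
  rw [EuclideanSpace.norm_sq_eq]; simp

lemma pt_lin (x y : ℝ) : pt x y = x • pt 1 0 + y • pt 0 1 := by
  ext i; fin_cases i <;> simp [pt]

lemma exists_angle (v : Pt) (h : ‖v‖ = 1) : ∃ θ, v 0 = cos θ ∧ v 1 = sin θ := by
  have h1 := pt_norm v
  rw [h] at h1
  have h2 : ‖(⟨v 0, v 1⟩ : ℂ)‖ = 1 := by
    have : ‖(⟨v 0, v 1⟩ : ℂ)‖ ^ 2 = 1 := by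
      rw [← Complex.normSq_eq_norm_sq, Complex.normSq_mk]; linarith
    nlinarith [norm_nonneg (⟨v 0, v 1⟩ : ℂ)]
  refine ⟨Complex.arg ⟨v 0, v 1⟩, ?_, ?_⟩
  · rw [Complex.cos_arg (by intro h; rw [h] at h2; simp at h2), h2]; simp
  · rw [Complex.sin_arg, h2]; simp

lemma comp_hasDeriv {f : ℝ → Pt} {f' : Pt} {t : ℝ} (h : HasDerivAt f f' t) (i : Fin 2) :
    HasDerivAt (fun t => f t i) (f' i) t :=
  (EuclideanSpace.proj (𝕜 := ℝ) i).hasFDerivAt.comp_hasDerivAt t h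

lemma comp_hasDerivW {f : ℝ → Pt} {f' : Pt} {t : ℝ} {s : Set ℝ} (h : HasDerivWithinAt f f' s t)
    (i : Fin 2) : HasDerivWithinAt (fun t => f t i) (f' i) s t :=
  (EuclideanSpace.proj (𝕜 := ℝ) i).hasFDerivAt.comp_hasDerivWithinAt t h

lemma comp_lip {f : ℝ → Pt} {K : NNReal} {s : Set ℝ} (h : LipschitzOnWith K f s) (i : Fin 2) :
    LipschitzOnWith K (fun t => f t i) s := by
  apply LipschitzOnWith.of_dist_le_mul
  intro x hx y hy
  refine le_trans ?_ (h.dist_le_mul x hx y hy)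
  rw [dist_eq_norm, dist_eq_norm]
  exact PiLp.norm_apply_le (f x - f y) i

lemma arc_lemma {z' : ℝ → Pt} {ω p q θ : ℝ} {K : NNReal} (hpq : p < q)
    (hL : LipschitzOnWith K z' (Icc p q)) (harc : IsArcOn z' ω p q)
    (h0 : z' p 0 = cos θ) (h1 : z' p 1 = sin θ) :
    ∀ t ∈ Icc p q, z' t 0 = cos (θ + ω * (t - p)) ∧ z' t 1 = sin (θ + ω * (t - p)) := by
  have hu : uIcc p q = Icc p q := uIcc_of_le hpq.le
  have ax : AbsolutelyContinuousOnInterval (fun t => z' t 0) p q :=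
    LipschitzOnWith.absolutelyContinuousOnInterval (hu ▸ comp_lip hL 0)
  have ay : AbsolutelyContinuousOnInterval (fun t => z' t 1) p q :=
    LipschitzOnWith.absolutelyContinuousOnInterval (hu ▸ comp_lip hL 1)
  have ac : AbsolutelyContinuousOnInterval (fun t => cos (ω * (t - p))) p q :=
    ContDiffOn.absolutelyContinuousOnInterval (by fun_prop)
  have as : AbsolutelyContinuousOnInterval (fun t => sin (ω * (t - p))) p q :=
    ContDiffOn.absolutelyContinuousOnInterval (by fun_prop)
  have as' : AbsolutelyContinuousOnInterval (fun t => -sin (ω * (t - p))) p q :=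
    ContDiffOn.absolutelyContinuousOnInterval (by fun_prop)
  have hae : ∀ᵐ t ∂volume, t ∈ uIcc p q → HasDerivAt z' (ω • J (z' t)) t := by
    have np : ∀ᵐ t ∂(volume : Measure ℝ), t ≠ p := by simp [ae_iff]
    have nq : ∀ᵐ t ∂(volume : Measure ℝ), t ≠ q := by simp [ae_iff]
    filter_upwards [harc, np, nq] with t h1 h2 h3 h4
    rw [hu] at h4
    exact h1 ⟨lt_of_le_of_ne h4.1 (Ne.symm h2), lt_of_le_of_ne h4.2 h3⟩
  have hl : ∀ t, HasDerivAt (fun t => ω * (t - p)) ω t := fun t => by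
    simpa using ((hasDerivAt_id t).sub_const p).const_mul ω
  obtain ⟨C1, hC1⟩ := ((ax.fun_mul ac).fun_add (ay.fun_mul as)).const_of_ae_hasDerivAt_zero (by
    filter_upwards [hae] with t ht h
    have hx := comp_hasDeriv (ht h) 0
    have hy := comp_hasDeriv (ht h) 1
    refine ((hx.fun_mul (hl t).cos).fun_add (hy.fun_mul (hl t).sin)).congr_deriv ?_
    simp only [PiLp.smul_apply, J, pt0, pt1, smul_eq_mul]
    ring)
  obtain ⟨C2, hC2⟩ := ((ax.fun_mul as').fun_add (ay.fun_mul ac)).const_of_ae_hasDerivAt_zero (by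
    filter_upwards [hae] with t ht h
    have hx := comp_hasDeriv (ht h) 0
    have hy := comp_hasDeriv (ht h) 1
    refine ((hx.fun_mul (hl t).sin.fun_neg).fun_add (hy.fun_mul (hl t).cos)).congr_deriv ?_
    simp only [PiLp.smul_apply, J, pt0, pt1, smul_eq_mul]
    ring)
  rw [hu] at hC1 hC2
  have e1 := hC1 p ⟨le_rfl, hpq.le⟩
  have e2 := hC2 p ⟨le_rfl, hpq.le⟩
  simp only [sub_self, mul_zero, cos_zero, sin_zero, mul_one, neg_zero, add_zero, zero_add, h0, h1]
    at e1 e2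
  intro t ht
  have f1 := hC1 t ht
  have f2 := hC2 t ht
  simp only at f1 f2
  rw [← e1] at f1
  rw [← e2] at f2
  have sc := sin_sq_add_cos_sq (ω * (t - p))
  rw [cos_add, sin_add]
  constructor
  · linear_combination cos (ω * (t - p)) * f1 - sin (ω * (t - p)) * f2 - z' t 0 * sc
  · linear_combination sin (ω * (t - p)) * f1 + cos (ω * (t - p)) * f2 - z' t 1 * sc

/-- description of the curve over a piece -/
def Seg (z z' : ℝ → Pt) (θ ω p q : ℝ) : Prop :=
  z' q 0 = cos (θ + ω * (q - p)) ∧ z' q 1 = sin (θ + ω * (q - p)) ∧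
  z q 0 = z p 0 + DC θ ω (q - p) ∧ z q 1 = z p 1 + DS θ ω (q - p)

lemma seg_of {z z' : ℝ → Pt} {z0 v0 zf vf : Pt} {tf p q θ ω : ℝ}
    (hadm : AdmissibleOn 0 tf z0 v0 zf vf z z') (hp : 0 ≤ p) (hpq : p < q) (hq : q ≤ tf)
    (h : ∀ t ∈ Icc p q, z' t 0 = cos (θ + ω * (t - p)) ∧ z' t 1 = sin (θ + ω * (t - p))) :
    Seg z z' θ ω p q := by
  have hq' : q ∈ Icc p q := ⟨hpq.le, le_rfl⟩
  have hsub : Icc p q ⊆ Icc 0 tf := Icc_subset_Icc hp hq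
  refine ⟨(h q hq').1, (h q hq').2, ?_, ?_⟩
  · refine disp_C (fun t => z t 0) (fun t ht => ?_) q hq'
    rw [← (h t ht).1]
    exact comp_hasDerivW ((hadm.1 t (hsub ht)).mono hsub) 0
  · refine disp_S (fun t => z t 1) (fun t ht => ?_) q hq'
    rw [← (h t ht).2]
    exact comp_hasDerivW ((hadm.1 t (hsub ht)).mono hsub) 1

lemma seg_arc {z z' : ℝ → Pt} {z0 v0 zf vf : Pt} {tf p q θ ω : ℝ}
    (hadm : AdmissibleOn 0 tf z0 v0 zf vf z z') (hp : 0 ≤ p) (hpq : p < q) (hq : q ≤ tf)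
    (harc : IsArcOn z' ω p q) (h0 : z' p 0 = cos θ) (h1 : z' p 1 = sin θ) :
    Seg z z' θ ω p q := by
  obtain ⟨K, hK⟩ := hadm.2.1
  exact seg_of hadm hp hpq hq
    (arc_lemma hpq (hK.mono (Icc_subset_Icc hp hq)) harc h0 h1)

lemma seg_norm {z z' : ℝ → Pt} {z0 v0 zf vf : Pt} {tf p q θ w2 a : ℝ} (ha : 0 < a)
    (h2 : w2 = a ∨ w2 = -a)
    (hadm : AdmissibleOn 0 tf z0 v0 zf vf z z') (hp : 0 ≤ p) (hpq : p < q) (hq : q ≤ tf)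
    (H : IsLineOn z' p q ∨ ∃ ω : ℝ, (ω = a ∨ ω = -a) ∧ IsArcOn z' ω p q ∧
          ((∀ k : ℤ, a * (q - p) ≠ 2 * π * k) → ω = -w2))
    (h0 : z' p 0 = cos θ) (h1 : z' p 1 = sin θ) :
    ∃ w, (w = 0 ∨ w = -w2) ∧ (IsLineOn z' p q → w = 0) ∧ Seg z z' θ w p q := by
  by_cases hL : IsLineOn z' p q
  · refine ⟨0, Or.inl rfl, fun _ => rfl, seg_of hadm hp hpq hq fun t ht => ?_⟩
    rw [← hL p ⟨le_rfl, hpq.le⟩ t ht, h0, h1]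
    simp
  · obtain ⟨ω, hω, harc, hi⟩ := H.resolve_left hL
    have S := seg_arc hadm hp hpq hq harc h0 h1
    refine ⟨-w2, Or.inr rfl, fun h => absurd h hL, ?_⟩
    by_cases e : ω = -w2
    · rwa [e] at S
    · have hl : ∃ k : ℤ, a * (q - p) = 2 * π * k := by
        by_contra! h
        exact e (hi h)
      have h2' : -w2 = a ∨ -w2 = -a := by rcases h2 with rfl | rfl <;> simp
      have n1 : ω ≠ 0 := by rcases hω with rfl | rfl <;> simp [ha.ne']
      have n2 : -w2 ≠ 0 := by rcases h2' with h | h <;> rw [h] <;> simp [ha.ne']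
      unfold Seg at S ⊢
      rw [(trig_loop (lk hω hl) θ).1, (trig_loop (lk hω hl) θ).2, (D_loop n1 (lk hω hl) θ).1,
        (D_loop n1 (lk hω hl) θ).2] at S
      rw [(trig_loop (lk h2' hl) θ).1, (trig_loop (lk h2' hl) θ).2, (D_loop n2 (lk h2' hl) θ).1,
        (D_loop n2 (lk h2' hl) θ).2]
      exact S

lemma dir_lip (x y : ℝ) : ‖pt (cos x) (sin x) - pt (cos y) (sin y)‖ ≤ |x - y| := by
  have h : ‖pt (cos x) (sin x) - pt (cos y) (sin y)‖ ^ 2 ≤ |x - y| ^ 2 := by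
    rw [pt_norm, sq_abs]
    simp only [PiLp.sub_apply, pt0, pt1]
    have h1 := one_sub_sq_div_two_le_cos (x := x - y)
    rw [cos_sub] at h1
    nlinarith [sin_sq_add_cos_sq x, sin_sq_add_cos_sq y]
  exact (pow_le_pow_iff_left₀ (norm_nonneg _) (abs_nonneg _) two_ne_zero).1 h

lemma no_better {z0 v0 zf vf : Pt} {tf a θ0 X Y Θ : ℝ}
    {z' : ℝ → Pt} (hcurv : maxCurvOn (Icc 0 tf) z' = a)
    (hmin : ∀ w w' : ℝ → Pt, AdmissibleOn 0 tf z0 v0 zf vf w w' →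
      maxCurvOn (Icc 0 tf) z' ≤ maxCurvOn (Icc 0 tf) w')
    (h0 : v0 0 = cos θ0) (h1 : v0 1 = sin θ0) (k0 : vf 0 = cos Θ) (k1 : vf 1 = sin Θ)
    (hX : zf 0 = z0 0 + X) (hY : zf 1 = z0 1 + Y) : NB a tf θ0 X Y Θ := by
  intro u a' g1 g2 g3 g4 e1 e2 e3 e4
  set θ : ℝ → ℝ := fun t => θ0 + prim u t with hθ
  have hc := g3.prim_cont
  have hθc : Continuous θ := by fun_prop
  have z00 : ∀ f, prim f 0 = 0 := fun f => by simp [prim]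
  set w' : ℝ → Pt := fun t => pt (cos (θ t)) (sin (θ t)) with hw'
  set w : ℝ → Pt := fun t => z0 + pt (prim (fun t => cos (θ t)) t) (prim (fun t => sin (θ t)) t)
    with hw
  have hlip : LipschitzOnWith (Real.toNNReal a') w' (Icc 0 tf) := by
    apply LipschitzOnWith.of_dist_le_mul
    intro x _ y _
    rw [dist_eq_norm, Real.coe_toNNReal _ g1, Real.dist_eq]
    refine (dir_lip _ _).trans ?_
    have := g3.prim_lip g4 y x
    simpa [hθ] using this
  have hle : maxCurvOn (Icc 0 tf) w' ≤ a' :=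
    csInf_le ⟨0, fun x hx => hx.1⟩ ⟨g1, hlip⟩
  have := hmin w w' ⟨?_, ⟨_, hlip⟩, ?_, ?_, ?_, ?_, ?_⟩
  · linarith
  · intro t _
    apply HasDerivAt.hasDerivWithinAt
    have d1 := prim_hasDeriv (g := fun t => cos (θ t)) (by fun_prop) t
    have d2 := prim_hasDeriv (g := fun t => sin (θ t)) (by fun_prop) t
    simp only [hw, hw']
    rw [pt_lin (cos (θ t))]
    simp only [pt_lin (prim _ _)]
    exact ((d1.smul_const _).fun_add (d2.smul_const _)).const_add z0
  · intro t _
    have := pt_norm (w' t)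
    simp only [hw', pt0, pt1, cos_sq_add_sin_sq] at this
    nlinarith [norm_nonneg (w' t)]
  · simp only [hw, z00]
    rw [pt_eq z0]; ext i; fin_cases i <;> simp [pt]
  · rw [pt_eq zf, hX, hY, ← e3, ← e4, hw]
    ext i; fin_cases i <;> simp [pt, hθ]
  · rw [pt_eq v0, h0, h1]
    simp [hw', hθ, z00]
  · rw [pt_eq vf, k0, k1, ← e1, ← e2]

/-- Lemma 5 of the paper: paths of type `XCY` are not optimal.
Let `z` be a minimiser of Problem (P) with maximum curvature `a > 0`. Then there is no
partition `0 < s1 < s2 < tf` such that: the middle piece `[s1, s2]` is a circular arc of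
signed curvature `ω2` with `|ω2| = a` whose turning angle `a(s2 − s1)` is not an integer
multiple of `2π`; each outer piece is a line segment or a circular arc of signed
curvature `±a` (with any outer arc whose turning angle is not an integer multiple of
`2π` having signed curvature `−ω2`); and at least one of the outer pieces is a line
segment or a full loop. -/
theorem stmt8 (z0 v0 zf vf : Pt) (tf a : ℝ) (htf : 0 < tf) (ha : 0 < a)
    (z z' : ℝ → Pt)
    (hadm : AdmissibleOn 0 tf z0 v0 zf vf z z')
    (hcurv : maxCurvOn (Icc 0 tf) z' = a)
    (hmin : ∀ w w' : ℝ → Pt, AdmissibleOn 0 tf z0 v0 zf vf w w' →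
      maxCurvOn (Icc 0 tf) z' ≤ maxCurvOn (Icc 0 tf) w') :
    ¬ ∃ s1 s2 ω2 : ℝ, 0 < s1 ∧ s1 < s2 ∧ s2 < tf ∧
      |ω2| = a ∧ IsArcOn z' ω2 s1 s2 ∧
      (∀ k : ℤ, a * (s2 - s1) ≠ 2 * π * k) ∧
      (IsLineOn z' 0 s1 ∨
        ∃ ω : ℝ, (ω = a ∨ ω = -a) ∧ IsArcOn z' ω 0 s1 ∧
          ((∀ k : ℤ, a * (s1 - 0) ≠ 2 * π * k) → ω = -ω2)) ∧
      (IsLineOn z' s2 tf ∨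
        ∃ ω : ℝ, (ω = a ∨ ω = -a) ∧ IsArcOn z' ω s2 tf ∧
          ((∀ k : ℤ, a * (tf - s2) ≠ 2 * π * k) → ω = -ω2)) ∧
      (IsLineOn z' 0 s1 ∨ IsFullLoopOn z' a 0 s1 ∨
        IsLineOn z' s2 tf ∨ IsFullLoopOn z' a s2 tf) := by
  rintro ⟨s1, s2, w2, o1, o2, o3, hw2, harc, hk, H1, H3, hx⟩
  have h2 : w2 = a ∨ w2 = -a := eq_or_eq_neg_of_abs_eq hw2
  have hunit := hadm.2.2.1
  obtain ⟨-, -, -, q0, qf, r0, rf⟩ := id hadm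
  obtain ⟨θ0, e0, e1⟩ := exists_angle (z' 0) (hunit 0 ⟨le_rfl, htf.le⟩)
  obtain ⟨w1, c1, d1, S1⟩ := seg_norm ha h2 hadm le_rfl o1 (o2.trans o3).le H1 e0 e1
  have S2 := seg_arc hadm o1.le o2 o3.le harc S1.1 S1.2.1
  obtain ⟨w3, c3, d3, S3⟩ := seg_norm ha h2 hadm (o1.trans o2).le o3 le_rfl H3 S2.1 S2.2.1
  obtain ⟨-, -, x1, y1⟩ := S1
  obtain ⟨-, -, x2, y2⟩ := S2
  obtain ⟨v3, v3', x3, y3⟩ := S3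
  rw [q0, sub_zero] at x1 y1
  rw [sub_zero] at x2 y2 x3 y3 v3 v3'
  rw [qf, x2, x1] at x3
  rw [qf, y2, y1] at y3
  rw [rf] at v3 v3'
  rw [r0] at e0 e1
  refine core (θ0 := θ0) (w1 := w1) (w2 := w2) (w3 := w3) ha h2 c1 c3 o1 o2 o3 hk ?_
    (no_better hcurv hmin e0 e1 v3 v3' (by rw [x3]; ring) (by rw [y3]; ring))
  rcases hx with h | ⟨ω, -, -, k, -, h⟩ | h | ⟨ω, -, -, k, -, h⟩
  · exact Or.inl (d1 h)
  · exact Or.inr (Or.inr (Or.inl ⟨k, by rw [sub_zero] at h; exact_mod_cast h⟩))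
  · exact Or.inr (Or.inl (d3 h))
  · exact Or.inr (Or.inr (Or.inr ⟨k, by exact_mod_cast h⟩))
end
end

section
/- Let z be an admissible curve for the data (z0, v0, zf, vf, t_f) with maximum curvature a > 0, and suppose there is a partition 0 = s0 < s1 < s2 < s3 < s4 = t_f into four circular arcs of alternating orientation: for each i = 1, 2, 3, 4, the piece [s_{i−1}, s_i] is a circular arc of signed curvature ω_i with |ω_i| = a, and ω_{i+1} = −ω_i for i = 1, 2, 3. Then z is not a minimiser of Problem (P) for its data. (A CCCC trajectory is not a solution.) -/
open Set MeasureTheory Real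

noncomputable section

/-- `J` as a continuous linear map. -/
def Jl : Pt →L[ℝ] Pt :=
  LinearMap.toContinuousLinearMap
    { toFun := J
      map_add' := by
        intro x y; ext i; fin_cases i <;> simp [J, pt]; ring
      map_smul' := by
        intro c x; ext i; fin_cases i <;> simp [J, pt] }

theorem Jl_apply (v : Pt) : Jl v = J v := rfl

theorem J_J (v : Pt) : J (J v) = -v := by
  ext i; fin_cases i <;> simp [J, pt]

/-- Explicit form of a circular arc. -/
theorem arc_formula (v : ℝ → Pt) (ω s t : ℝ) (hst : s ≤ t) (K : NNReal)
    (hL : LipschitzOnWith K v (Icc s t)) (harc : IsArcOn v ω s t)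
    (x y : ℝ) (hx : x ∈ Icc s t) (hy : y ∈ Icc s t) :
    v y = Real.cos (ω * (y - x)) • v x + Real.sin (ω * (y - x)) • J (v x) := by
  have hv : AbsolutelyContinuousOnInterval v s t :=
    LipschitzOnWith.absolutelyContinuousOnInterval (by rwa [uIcc_of_le hst])
  have hJv : AbsolutelyContinuousOnInterval (fun r => Jl (v r)) s t := by
    have := Jl.lipschitz.comp_lipschitzOnWith hL
    exact LipschitzOnWith.absolutelyContinuousOnInterval (by rw [uIcc_of_le hst]; exact this)
  have hc : AbsolutelyContinuousOnInterval (fun r => Real.cos (ω * (r - x))) s t := by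
    apply ContDiffOn.absolutelyContinuousOnInterval
    apply ContDiff.contDiffOn
    fun_prop
  have hs : AbsolutelyContinuousOnInterval (fun r => Real.sin (ω * (r - x))) s t := by
    apply ContDiffOn.absolutelyContinuousOnInterval
    apply ContDiff.contDiffOn
    fun_prop
  have hg := (hc.smul hv).sub (hs.smul hJv)
  obtain ⟨C, hC⟩ := hg.const_of_ae_hasDerivAt_zero (by
    have h1 : ∀ᵐ r : ℝ, r ≠ s := by simp [ae_iff, measure_singleton]
    have h2 : ∀ᵐ r : ℝ, r ≠ t := by simp [ae_iff, measure_singleton]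
    filter_upwards [harc, h1, h2] with r hr h1 h2 hmem
    rw [uIcc_of_le hst] at hmem
    have hd := hr ⟨lt_of_le_of_ne hmem.1 (Ne.symm h1), lt_of_le_of_ne hmem.2 h2⟩
    have hdJ : HasDerivAt (fun r => Jl (v r)) (Jl (ω • J (v r))) r :=
      Jl.hasFDerivAt.comp_hasDerivAt r hd
    have hl : HasDerivAt (fun r : ℝ => ω * (r - x)) ω r := by
      simpa using ((hasDerivAt_id r).sub_const x).const_mul ω
    have := (hl.cos.smul hd).sub (hl.sin.smul hdJ)
    convert this using 1
    rw [map_smul, Jl_apply, Jl_apply, J_J]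
    module)
  rw [uIcc_of_le hst] at hC
  have e1 := hC x hx
  have e2 := hC y hy
  have e3 := e2.trans e1.symm
  simp only [Pi.sub_apply, Pi.smul_apply', sub_self, mul_zero, Real.cos_zero, Real.sin_zero,
    one_smul, zero_smul, sub_zero, Jl_apply] at e3
  have e4 : J (v x) = Real.cos (ω * (y - x)) • J (v y) + Real.sin (ω * (y - x)) • v y := by
    rw [← e3, ← Jl_apply, map_sub, map_smul, map_smul, Jl_apply, Jl_apply, J_J]
    module
  rw [e4, ← e3]
  have h1 := Real.sin_sq_add_cos_sq (ω * (y - x))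
  have : v y = (Real.sin (ω * (y - x)) ^ 2 + Real.cos (ω * (y - x)) ^ 2) • v y := by
    rw [h1, one_smul]
  nth_rewrite 1 [this]
  module

/-- Reflection symmetry of the velocity at a switching time. -/
theorem switch_symm (v : ℝ → Pt) (ω s t u : ℝ) (hst : s ≤ t) (htu : t ≤ u) (K : NNReal)
    (hL : LipschitzOnWith K v (Icc s u)) (h1 : IsArcOn v ω s t) (h2 : IsArcOn v (-ω) t u)
    (x : ℝ) (hx : 0 ≤ x) (hx1 : x ≤ t - s) (hx2 : x ≤ u - t) : v (t - x) = v (t + x) := by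
  rw [arc_formula v ω s t hst K (hL.mono (Icc_subset_Icc le_rfl htu)) h1 t (t - x)
      ⟨hst, le_rfl⟩ ⟨by linarith, by linarith⟩,
    arc_formula v (-ω) t u htu K (hL.mono (Icc_subset_Icc hst le_rfl)) h2 t (t + x)
      ⟨le_rfl, htu⟩ ⟨by linarith, by linarith⟩]
  have e : ω * (t - x - t) = -ω * (t + x - t) := by ring
  rw [e]

/-- Linear independence of `1, v` along an arc. -/
theorem arc_indep (v : ℝ → Pt) (ω p q : ℝ) (hω : ω ≠ 0) (hpq : p < q) (K : NNReal)
    (hL : LipschitzOnWith K v (Icc p q)) (harc : IsArcOn v ω p q) (hn : ‖v p‖ = 1)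
    (c0 : ℝ) (c : Pt) (h : ∀ t ∈ Icc p q, c0 + inner ℝ c (v t) = 0) : c0 = 0 ∧ c = 0 := by
  set A := inner ℝ c (v p) with hA
  set B := inner ℝ c (J (v p)) with hB
  have hf : ∀ t ∈ Ioo p q,
      c0 + (Real.cos (ω * (t - p)) * A + Real.sin (ω * (t - p)) * B) = 0 := by
    intro t ht
    have := h t (Ioo_subset_Icc_self ht)
    rw [arc_formula v ω p q hpq.le K hL harc p t ⟨le_rfl, hpq.le⟩ (Ioo_subset_Icc_self ht),
      inner_add_right, inner_smul_right, inner_smul_right] at this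
    exact this
  have hl : ∀ r : ℝ, HasDerivAt (fun r : ℝ => ω * (r - p)) ω r := by
    intro r
    simpa using ((hasDerivAt_id r).sub_const p).const_mul ω
  have hf1 : ∀ t ∈ Ioo p q,
      -Real.sin (ω * (t - p)) * A + Real.cos (ω * (t - p)) * B = 0 := by
    intro t ht
    have hd := ((((hl t).cos.mul_const A).add ((hl t).sin.mul_const B)).const_add c0)
    have hz : HasDerivAt (fun t => c0 + (Real.cos (ω * (t - p)) * A + Real.sin (ω * (t - p)) * B))
        0 t := by
      apply (hasDerivAt_const t (0:ℝ)).congr_of_eventuallyEq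
      filter_upwards [Ioo_mem_nhds ht.1 ht.2] with r hr using hf r hr
    have := hd.unique hz
    have h2 : ω * (-Real.sin (ω * (t - p)) * A + Real.cos (ω * (t - p)) * B) = 0 := by
      rw [← this]; ring
    exact (mul_eq_zero.mp h2).resolve_left hω
  have hf2 : ∀ t ∈ Ioo p q,
      Real.cos (ω * (t - p)) * A + Real.sin (ω * (t - p)) * B = 0 := by
    intro t ht
    have hd := (((hl t).sin.neg.mul_const A).add ((hl t).cos.mul_const B))
    have hz : HasDerivAt (fun t => -Real.sin (ω * (t - p)) * A + Real.cos (ω * (t - p)) * B)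
        0 t := by
      apply (hasDerivAt_const t (0:ℝ)).congr_of_eventuallyEq
      filter_upwards [Ioo_mem_nhds ht.1 ht.2] with r hr using hf1 r hr
    have := hd.unique hz
    have h2 : ω * (Real.cos (ω * (t - p)) * A + Real.sin (ω * (t - p)) * B) = 0 := by
      linear_combination -this
    exact (mul_eq_zero.mp h2).resolve_left hω
  have hm : (p + q) / 2 ∈ Ioo p q := ⟨by linarith, by linarith⟩
  have g0 := hf _ hm
  have g1 := hf1 _ hm
  have g2 := hf2 _ hm
  have g3 := Real.sin_sq_add_cos_sq (ω * ((p + q) / 2 - p))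
  set S := Real.sin (ω * ((p + q) / 2 - p))
  set Cc := Real.cos (ω * ((p + q) / 2 - p))
  have A0 : A = 0 := by linear_combination Cc * g2 - S * g1 - A * g3
  have B0 : B = 0 := by linear_combination S * g2 + Cc * g1 - B * g3
  refine ⟨by linarith, ?_⟩
  have hn2 : (v p 0) ^ 2 + (v p 1) ^ 2 = 1 := by
    have := EuclideanSpace.norm_sq_eq (v p)
    rw [hn, Fin.sum_univ_two] at this
    simp only [Real.norm_eq_abs, sq_abs] at this
    linarith
  have hA2 : v p 0 * c 0 + v p 1 * c 1 = 0 := by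
    rw [← A0, hA]; simp [PiLp.inner_apply, Fin.sum_univ_two]
  have hB2 : -(v p 1) * c 0 + v p 0 * c 1 = 0 := by
    rw [← B0, hB]; simp [PiLp.inner_apply, Fin.sum_univ_two, J, pt]
  ext i
  fin_cases i
  · show c 0 = 0
    linear_combination v p 0 * hA2 - v p 1 * hB2 - c 0 * hn2
  · show c 1 = 0
    linear_combination v p 1 * hA2 + v p 0 * hB2 - c 1 * hn2

/-- Reparametrisation of a velocity field by a nonnegative time density. -/
theorem reparam (T b : ℝ) (hT : 0 ≤ T) (hb : 0 ≤ b) (v : ℝ → Pt) (ρ : ℝ → ℝ) (z0 zf : Pt)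
    (hρ0 : ∀ t, 0 ≤ ρ t)
    (hρ : IntervalIntegrable ρ volume 0 T)
    (hρv : IntervalIntegrable (fun t => ρ t • v t) volume 0 T)
    (hLip : ∀ s ∈ Icc 0 T, ∀ s' ∈ Icc 0 T, s ≤ s' → ‖v s' - v s‖ ≤ b * ∫ t in s..s', ρ t)
    (hunit : ∀ t ∈ Icc 0 T, ‖v t‖ = 1)
    (hR : ∫ t in (0:ℝ)..T, ρ t = T) (hW : ∫ t in (0:ℝ)..T, ρ t • v t = zf - z0) :
    ∃ w w' : ℝ → Pt, AdmissibleOn 0 T z0 (v 0) zf (v T) w w' ∧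
      LipschitzOnWith (Real.toNNReal b) w' (Icc 0 T) := by
  have sub : ∀ s ∈ Icc 0 T, ∀ s' ∈ Icc 0 T, uIcc s s' ⊆ uIcc 0 T := by
    intro s hs s' hs'
    rw [uIcc_of_le hT]
    exact OrdConnected.uIcc_subset ordConnected_Icc hs hs'
  have iρ : ∀ s ∈ Icc 0 T, ∀ s' ∈ Icc 0 T, IntervalIntegrable ρ volume s s' :=
    fun s hs s' hs' => hρ.mono_set (sub s hs s' hs')
  have iρv : ∀ s ∈ Icc 0 T, ∀ s' ∈ Icc 0 T,
      IntervalIntegrable (fun t => ρ t • v t) volume s s' :=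
    fun s hs s' hs' => hρv.mono_set (sub s hs s' hs')
  have m0 : (0:ℝ) ∈ Icc 0 T := ⟨le_rfl, hT⟩
  have mT : T ∈ Icc 0 T := ⟨hT, le_rfl⟩
  set R : ℝ → ℝ := fun s => ∫ t in (0:ℝ)..s, ρ t with hRdef
  set W : ℝ → Pt := fun s => ∫ t in (0:ℝ)..s, ρ t • v t with hWdef
  have Rsub : ∀ s ∈ Icc 0 T, ∀ s' ∈ Icc 0 T, R s' - R s = ∫ t in s..s', ρ t := by
    intro s hs s' hs'
    exact intervalIntegral.integral_interval_sub_left (iρ 0 m0 s' hs') (iρ 0 m0 s hs)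
  have Wsub : ∀ s ∈ Icc 0 T, ∀ s' ∈ Icc 0 T, W s' - W s = ∫ t in s..s', ρ t • v t := by
    intro s hs s' hs'
    exact intervalIntegral.integral_interval_sub_left (iρv 0 m0 s' hs') (iρv 0 m0 s hs)
  have Rmono : ∀ s ∈ Icc 0 T, ∀ s' ∈ Icc 0 T, s ≤ s' → R s ≤ R s' := by
    intro s hs s' hs' h
    have := Rsub s hs s' hs'
    have h2 : 0 ≤ ∫ t in s..s', ρ t :=
      intervalIntegral.integral_nonneg h (fun t _ => hρ0 t)
    linarith
  have R0 : R 0 = 0 := by simp [hRdef]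
  have W0 : W 0 = 0 := by simp [hWdef]
  have RT : R T = T := hR
  have L1 : ∀ s ∈ Icc 0 T, ∀ s' ∈ Icc 0 T, ‖v s' - v s‖ ≤ b * |R s' - R s| := by
    intro s hs s' hs'
    rcases le_total s s' with h | h
    · have := hLip s hs s' hs' h
      rw [← Rsub s hs s' hs'] at this
      exact this.trans (mul_le_mul_of_nonneg_left (le_abs_self _) hb)
    · have := hLip s' hs' s hs h
      rw [← Rsub s' hs' s hs] at this
      rw [norm_sub_rev, abs_sub_comm]
      exact this.trans (mul_le_mul_of_nonneg_left (le_abs_self _) hb)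
  have key : ∀ s ∈ Icc 0 T, ∀ s' ∈ Icc 0 T,
      ‖W s' - W s - (R s' - R s) • v s‖ ≤ b * |R s' - R s| ^ 2 := by
    intro s hs s' hs'
    have e : W s' - W s - (R s' - R s) • v s = ∫ t in s..s', (ρ t • v t - ρ t • v s) := by
      rw [intervalIntegral.integral_sub (iρv s hs s' hs') ⟨(iρ s hs s' hs').1.smul_const _, (iρ s hs s' hs').2.smul_const _⟩,
        intervalIntegral.integral_smul_const, Wsub s hs s' hs', Rsub s hs s' hs']
    rw [e]
    have := intervalIntegral.norm_integral_le_abs_of_norm_le (μ := volume) (a := s) (b := s')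
      (f := fun t => ρ t • v t - ρ t • v s) (g := fun t => ρ t * (b * |R s' - R s|)) (by
        refine (ae_restrict_iff' measurableSet_uIoc).mpr (Filter.Eventually.of_forall ?_)
        intro t ht
        have ht' : t ∈ uIcc s s' := uIoc_subset_uIcc ht
        have htT : t ∈ Icc 0 T := by
          have := sub s hs s' hs' ht'
          rwa [uIcc_of_le hT] at this
        rw [← smul_sub, norm_smul, Real.norm_eq_abs, abs_of_nonneg (hρ0 t)]
        refine mul_le_mul_of_nonneg_left ?_ (hρ0 t)
        refine (L1 s hs t htT).trans (mul_le_mul_of_nonneg_left ?_ hb)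
        rcases le_total s s' with h | h
        · rw [uIcc_of_le h] at ht'
          have h1 := Rmono s hs t htT ht'.1
          have h2 := Rmono t htT s' hs' ht'.2
          rw [abs_of_nonneg (by linarith), abs_of_nonneg (by linarith)]
          linarith
        · rw [uIcc_of_ge h] at ht'
          have h1 := Rmono s' hs' t htT ht'.1
          have h2 := Rmono t htT s hs ht'.2
          rw [abs_of_nonpos (by linarith), abs_of_nonpos (by linarith)]
          linarith) ((iρ s hs s' hs').mul_const _)
    refine this.trans (le_of_eq ?_)
    rw [intervalIntegral.integral_mul_const, ← Rsub s hs s' hs', abs_mul, abs_mul, abs_abs,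
      abs_of_nonneg hb]
    ring
  have Rcont : ContinuousOn R (Icc 0 T) := by
    have := intervalIntegral.continuousOn_primitive_interval' hρ (a := 0) left_mem_uIcc
    rwa [uIcc_of_le hT] at this
  have surj : ∀ t ∈ Icc 0 T, ∃ s ∈ Icc 0 T, R s = t := by
    intro t ht
    have := intermediate_value_Icc hT Rcont
    rw [R0, RT] at this
    exact this ht
  choose! σ hσ1 hσ2 using surj
  have vwd : ∀ s ∈ Icc 0 T, ∀ s' ∈ Icc 0 T, R s = R s' → v s = v s' := by
    intro s hs s' hs' h
    have := L1 s' hs' s hs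
    rw [h, sub_self, abs_zero, mul_zero] at this
    exact sub_eq_zero.mp (norm_le_zero_iff.mp this)
  have Wwd : ∀ s ∈ Icc 0 T, ∀ s' ∈ Icc 0 T, R s = R s' → W s = W s' := by
    intro s hs s' hs' h
    have := key s' hs' s hs
    rw [h, sub_self, abs_zero, zero_smul, sub_zero] at this
    norm_num at this
    exact sub_eq_zero.mp this
  have lip : LipschitzOnWith (Real.toNNReal b) (fun t => v (σ t)) (Icc 0 T) := by
    apply LipschitzOnWith.of_dist_le_mul
    intro x hx y hy
    rw [dist_eq_norm, Real.coe_toNNReal _ hb, Real.dist_eq]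
    have := L1 (σ y) (hσ1 y hy) (σ x) (hσ1 x hx)
    rwa [hσ2 x hx, hσ2 y hy] at this
  refine ⟨fun t => z0 + W (σ t), fun t => v (σ t), ⟨?_, ⟨_, lip⟩, ?_, ?_, ?_, ?_, ?_⟩, lip⟩
  · intro t ht
    rw [hasDerivWithinAt_iff_isLittleO, Asymptotics.isLittleO_iff]
    intro c hc
    have hev : ∀ᶠ t' in nhdsWithin t (Icc 0 T), b * |t' - t| < c := by
      have : ContinuousWithinAt (fun t' => b * |t' - t|) (Icc 0 T) t := by fun_prop
      have h := this.tendsto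
      simp only [sub_self, abs_zero, mul_zero] at h
      exact h.eventually (gt_mem_nhds hc)
    filter_upwards [hev, self_mem_nhdsWithin] with t' h1 h2
    have := key (σ t) (hσ1 t ht) (σ t') (hσ1 t' h2)
    rw [hσ2 t ht, hσ2 t' h2] at this
    rw [Real.norm_eq_abs]
    calc _ = ‖W (σ t') - W (σ t) - (t' - t) • v (σ t)‖ := by congr 1; abel
      _ ≤ b * |t' - t| ^ 2 := this
      _ = (b * |t' - t|) * |t' - t| := by ring
      _ ≤ c * |t' - t| := mul_le_mul_of_nonneg_right h1.le (abs_nonneg _)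
  · intro t ht
    exact hunit _ (hσ1 t ht)
  · show z0 + W (σ 0) = z0
    rw [Wwd (σ 0) (hσ1 0 m0) 0 m0 (by rw [hσ2 0 m0, R0]), W0, add_zero]
  · show z0 + W (σ T) = zf
    rw [Wwd (σ T) (hσ1 T mT) T mT (by rw [hσ2 T mT, RT])]
    show z0 + ∫ t in (0:ℝ)..T, ρ t • v t = zf
    rw [hW]; abel
  · exact vwd (σ 0) (hσ1 0 m0) 0 m0 (by rw [hσ2 0 m0, R0])
  · exact vwd (σ T) (hσ1 T mT) T mT (by rw [hσ2 T mT, RT])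

/-- Solvability of the moment problem on an arc. -/
theorem moment (v : ℝ → Pt) (p q : ℝ) (hpq : p < q) (hv : ContinuousOn v (Icc p q))
    (hind : ∀ (c0 : ℝ) (c : Pt), (∀ t ∈ Icc p q, c0 + inner ℝ c (v t) = 0) → c0 = 0 ∧ c = 0)
    (V0 : ℝ) (V : Pt) :
    ∃ n : ℝ → ℝ, ContinuousOn n (Icc p q) ∧ ∫ t in p..q, n t = V0 ∧
      ∫ t in p..q, n t • v t = V := by
  have hn : ∀ c : ℝ × Pt, ContinuousOn (fun t => c.1 + inner ℝ c.2 (v t)) (Icc p q) := by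
    intro c
    fun_prop
  have i1 : ∀ c : ℝ × Pt, IntervalIntegrable (fun t => c.1 + inner ℝ c.2 (v t)) volume p q := by
    intro c
    apply ContinuousOn.intervalIntegrable
    rw [uIcc_of_le hpq.le]
    exact hn c
  have i2 : ∀ c : ℝ × Pt,
      IntervalIntegrable (fun t => (c.1 + inner ℝ c.2 (v t)) • v t) volume p q := by
    intro c
    apply ContinuousOn.intervalIntegrable
    rw [uIcc_of_le hpq.le]
    exact (hn c).smul hv
  let Φ : (ℝ × Pt) →ₗ[ℝ] (ℝ × Pt) :=
    { toFun := fun c => (∫ t in p..q, (c.1 + inner ℝ c.2 (v t)),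
        ∫ t in p..q, (c.1 + inner ℝ c.2 (v t)) • v t)
      map_add' := by
        intro c d
        refine Prod.ext ?_ ?_
        · show _ = (∫ t in p..q, (c.1 + inner ℝ c.2 (v t))) + ∫ t in p..q, (d.1 + inner ℝ d.2 (v t))
          rw [← intervalIntegral.integral_add (i1 c) (i1 d)]
          refine intervalIntegral.integral_congr (fun t _ => ?_)
          simp only [Prod.fst_add, Prod.snd_add, inner_add_left]; ring
        · show _ = (∫ t in p..q, (c.1 + inner ℝ c.2 (v t)) • v t) +
            ∫ t in p..q, (d.1 + inner ℝ d.2 (v t)) • v t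
          rw [← intervalIntegral.integral_add (i2 c) (i2 d)]
          refine intervalIntegral.integral_congr (fun t _ => ?_)
          simp only [Prod.fst_add, Prod.snd_add, inner_add_left]; module
      map_smul' := by
        intro r c
        refine Prod.ext ?_ ?_
        · show _ = r • (∫ t in p..q, (c.1 + inner ℝ c.2 (v t)))
          rw [← intervalIntegral.integral_smul]
          refine intervalIntegral.integral_congr (fun t _ => ?_)
          simp only [Prod.smul_fst, Prod.smul_snd, real_inner_smul_left, smul_eq_mul]; ring
        · show _ = r • (∫ t in p..q, (c.1 + inner ℝ c.2 (v t)) • v t)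
          rw [← intervalIntegral.integral_smul]
          refine intervalIntegral.integral_congr (fun t _ => ?_)
          simp only [Prod.smul_fst, Prod.smul_snd, real_inner_smul_left, smul_eq_mul]; module }
  have inj : Function.Injective Φ := by
    rw [injective_iff_map_eq_zero]
    intro c hc
    have e1 : ∫ t in p..q, (c.1 + inner ℝ c.2 (v t)) = 0 := congrArg Prod.fst hc
    have e2 : ∫ t in p..q, (c.1 + inner ℝ c.2 (v t)) • v t = 0 := congrArg Prod.snd hc
    have e3 : ∫ t in p..q, (c.1 + inner ℝ c.2 (v t)) ^ 2 = 0 := by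
      have h3 : ∫ t in p..q, inner ℝ c.2 ((c.1 + inner ℝ c.2 (v t)) • v t) = 0 := by
        have := (innerSL ℝ c.2).intervalIntegral_comp_comm (i2 c)
        simp only [innerSL_apply_apply] at this
        rw [this, e2, inner_zero_right]
      have i3 : IntervalIntegrable (fun t => inner ℝ c.2 ((c.1 + inner ℝ c.2 (v t)) • v t))
          volume p q := by
        apply ContinuousOn.intervalIntegrable
        rw [uIcc_of_le hpq.le]
        fun_prop
      have h4 : ∫ t in p..q, (c.1 * (c.1 + inner ℝ c.2 (v t)) +
          inner ℝ c.2 ((c.1 + inner ℝ c.2 (v t)) • v t)) = 0 := by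
        rw [intervalIntegral.integral_add ((i1 c).const_mul _) i3,
          intervalIntegral.integral_const_mul, e1, h3]
        simp
      rw [← h4]
      refine intervalIntegral.integral_congr (fun t _ => ?_)
      rw [inner_smul_right]; ring
    have hz : ∀ t ∈ Icc p q, c.1 + inner ℝ c.2 (v t) = 0 := by
      by_contra hne
      push Not at hne
      obtain ⟨t, ht, hne⟩ := hne
      have : 0 < ∫ t in p..q, (c.1 + inner ℝ c.2 (v t)) ^ 2 := by
        apply intervalIntegral.integral_pos hpq ((hn c).pow 2)
        · intro x _; exact sq_nonneg _
        · exact ⟨t, ht, (sq_nonneg _).lt_of_ne' (pow_ne_zero 2 hne)⟩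
      linarith
    obtain ⟨h1, h2⟩ := hind c.1 c.2 hz
    exact Prod.ext h1 h2
  obtain ⟨c, hc⟩ := LinearMap.injective_iff_surjective.mp inj (V0, V)
  exact ⟨_, hn c, congrArg Prod.fst hc, congrArg Prod.snd hc⟩

theorem indicator_int {F : Type*} [NormedAddCommGroup F] [NormedSpace ℝ F] (T p q : ℝ)
    (hp : 0 ≤ p) (hpq : p ≤ q) (hq : q ≤ T) (g : ℝ → F) (hg : ContinuousOn g (Icc p q)) :
    IntervalIntegrable ((Ioc p q).indicator g) volume 0 T ∧
      ∫ t in (0:ℝ)..T, (Ioc p q).indicator g t = ∫ t in p..q, g t := by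
  have hT : 0 ≤ T := by linarith
  have hs : Ioc 0 T ∩ Ioc p q = Ioc p q :=
    inter_eq_self_of_subset_right (Ioc_subset_Ioc hp hq)
  constructor
  · have hi : IntervalIntegrable g volume p q := by
      apply ContinuousOn.intervalIntegrable
      rwa [uIcc_of_le hpq]
    rw [intervalIntegrable_iff_integrableOn_Ioc_of_le hpq] at hi
    rw [intervalIntegrable_iff_integrableOn_Ioc_of_le hT]
    exact (hi.integrable_indicator measurableSet_Ioc).integrableOn
  · rw [intervalIntegral.integral_of_le hT, setIntegral_indicator measurableSet_Ioc, hs,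
      intervalIntegral.integral_of_le hpq]

/-- The core construction: delete `(e1, e2]`, redistribute its time over `(p, q]`, and slow
down everywhere. -/
theorem core_s9 (T a : ℝ) (ha : 0 < a) (v : ℝ → Pt) (z0 zf : Pt) (p q e1 e2 : ℝ)
    (hp : 0 ≤ p) (hpq : p < q) (hq : q ≤ T) (he1 : 0 ≤ e1) (he : e1 < e2) (he2 : e2 ≤ T)
    (hdisj : q ≤ e1 ∨ e2 ≤ p) (hlen : e2 - e1 = 2 * (q - p))
    (hint : ∫ t in e1..e2, v t = (2 : ℝ) • ∫ t in p..q, v t) (hve : v e1 = v e2)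
    (hind : ∀ (c0 : ℝ) (c : Pt), (∀ t ∈ Icc p q, c0 + inner ℝ c (v t) = 0) → c0 = 0 ∧ c = 0)
    (hL : ∀ s ∈ Icc 0 T, ∀ s' ∈ Icc 0 T, s ≤ s' → ‖v s' - v s‖ ≤ a * (s' - s))
    (hv : ContinuousOn v (Icc 0 T))
    (hunit : ∀ t ∈ Icc 0 T, ‖v t‖ = 1) (hz : ∫ t in (0:ℝ)..T, v t = zf - z0) :
    ∃ (b : ℝ) (w w' : ℝ → Pt), 0 ≤ b ∧ b < a ∧ AdmissibleOn 0 T z0 (v 0) zf (v T) w w' ∧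
      LipschitzOnWith (Real.toNNReal b) w' (Icc 0 T) := by
  have hT : 0 ≤ T := by linarith
  have subI : Icc p q ⊆ Icc 0 T := Icc_subset_Icc hp hq
  have subE : Icc e1 e2 ⊆ Icc 0 T := Icc_subset_Icc he1 he2
  obtain ⟨n, hn, hn1, hn2⟩ := moment v p q hpq (hv.mono subI) hind
    (T - (e2 - e1)) ((∫ t in (0:ℝ)..T, v t) - ∫ t in e1..e2, v t)
  obtain ⟨N, hN⟩ := isCompact_Icc.exists_bound_of_continuousOn hn
  have hN0 : 0 ≤ N := (norm_nonneg _).trans (hN p ⟨le_rfl, hpq.le⟩)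
  set δ : ℝ := 1 / (N + 1) with hδ
  have hδ0 : 0 < δ := by positivity
  have hδn : ∀ t ∈ Icc p q, 0 ≤ 2 - δ * n t := by
    intro t ht
    have h1 := (le_abs_self (n t)).trans (hN t ht)
    have h2 : δ * n t ≤ δ * (N + 1) := mul_le_mul_of_nonneg_left (by linarith) hδ0.le
    have h3 : δ * (N + 1) = 1 := by rw [hδ]; field_simp
    linarith
  set ρ : ℝ → ℝ := fun t => (1 + δ) - (Ioc e1 e2).indicator (fun _ => 1 + δ) t +
    (Ioc p q).indicator (fun t => 2 - δ * n t) t with hρdef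
  have hdj : ∀ t, t ∈ Ioc e1 e2 → t ∉ Ioc p q := by
    intro t h1 h2
    rcases hdisj with h | h
    · linarith [h1.1, h2.2]
    · linarith [h1.2, h2.1]
  have ρE : ∀ t ∈ Ioc e1 e2, ρ t = 0 := by
    intro t ht
    simp only [hρdef, indicator_of_mem ht, indicator_of_notMem (hdj t ht)]
    ring
  have ρnE : ∀ t, t ∉ Ioc e1 e2 → 1 + δ ≤ ρ t := by
    intro t ht
    simp only [hρdef, indicator_of_notMem ht, sub_zero]
    have : 0 ≤ (Ioc p q).indicator (fun t => 2 - δ * n t) t :=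
      indicator_nonneg (fun t ht => hδn t (Ioc_subset_Icc_self ht)) t
    linarith
  have ρ0 : ∀ t, 0 ≤ ρ t := by
    intro t
    by_cases ht : t ∈ Ioc e1 e2
    · exact (ρE t ht).ge
    · have := ρnE t ht; linarith
  have iv : IntervalIntegrable v volume 0 T := by
    apply ContinuousOn.intervalIntegrable
    rwa [uIcc_of_le hT]
  -- scalar integral
  obtain ⟨a1, a2⟩ := indicator_int T e1 e2 he1 he.le he2 (fun _ => 1 + δ) continuousOn_const
  obtain ⟨b1, b2⟩ := indicator_int T p q hp hpq.le hq (fun t => 2 - δ * n t)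
    (continuousOn_const.sub (continuousOn_const.mul hn))
  have inq : IntervalIntegrable n volume p q := by
    apply ContinuousOn.intervalIntegrable
    rwa [uIcc_of_le hpq.le]
  have hc : IntervalIntegrable (fun _ : ℝ => 1 + δ) volume 0 T := intervalIntegrable_const
  have iρ : IntervalIntegrable ρ volume 0 T := (hc.sub a1).add b1
  have hR : ∫ t in (0:ℝ)..T, ρ t = T := by
    rw [intervalIntegral.integral_add (hc.sub a1) b1, intervalIntegral.integral_sub hc a1, a2, b2,
      intervalIntegral.integral_sub intervalIntegrable_const (inq.const_mul δ),
      intervalIntegral.integral_const_mul, hn1]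
    simp only [intervalIntegral.integral_const, smul_eq_mul]
    linear_combination hlen * (-1)
  -- vector integral
  have hcv : IntervalIntegrable (fun t => (1 + δ) • v t) volume 0 T := iv.smul (1 + δ)
  obtain ⟨c1, c2⟩ := indicator_int T e1 e2 he1 he.le he2 (fun t => (1 + δ) • v t)
    ((hv.mono subE).const_smul (1 + δ))
  have hnv : ContinuousOn (fun t => (2 - δ * n t) • v t) (Icc p q) :=
    (continuousOn_const.sub (continuousOn_const.mul hn)).smul (hv.mono subI)
  obtain ⟨d1, d2⟩ := indicator_int T p q hp hpq.le hq (fun t => (2 - δ * n t) • v t) hnv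
  have hρv : (fun t => ρ t • v t) = fun t => ((1 + δ) • v t -
      (Ioc e1 e2).indicator (fun t => (1 + δ) • v t) t) +
      (Ioc p q).indicator (fun t => (2 - δ * n t) • v t) t := by
    funext t
    by_cases h1 : t ∈ Ioc e1 e2 <;> by_cases h2 : t ∈ Ioc p q <;>
      simp only [hρdef, h1, h2, indicator_of_mem, indicator_of_notMem, not_false_eq_true] <;> module
  have iρv : IntervalIntegrable (fun t => ρ t • v t) volume 0 T := by
    rw [hρv]; exact (hcv.sub c1).add d1
  have hW : ∫ t in (0:ℝ)..T, ρ t • v t = zf - z0 := by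
    rw [← hz]
    have e3 : ∫ t in p..q, (2 - δ * n t) • v t =
        (2:ℝ) • (∫ t in p..q, v t) - δ • ∫ t in p..q, n t • v t := by
      have j1 : IntervalIntegrable v volume p q := by
        apply ContinuousOn.intervalIntegrable
        rw [uIcc_of_le hpq.le]; exact hv.mono subI
      have j2 : IntervalIntegrable (fun t => n t • v t) volume p q := by
        apply ContinuousOn.intervalIntegrable
        rw [uIcc_of_le hpq.le]; exact hn.smul (hv.mono subI)
      have j3 : IntervalIntegrable (fun t => (2:ℝ) • v t) volume p q := j1.smul (2:ℝ)
      have j4 : IntervalIntegrable (fun t => δ • n t • v t) volume p q := j2.smul δ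
      rw [← intervalIntegral.integral_smul, ← intervalIntegral.integral_smul,
        ← intervalIntegral.integral_sub j3 j4]
      refine intervalIntegral.integral_congr (fun t _ => ?_)
      module
    have e4 : ∫ t in (0:ℝ)..T, ρ t • v t = (1 + δ) • (∫ t in (0:ℝ)..T, v t) -
        (1 + δ) • (∫ t in e1..e2, v t) + ∫ t in p..q, (2 - δ * n t) • v t := by
      rw [hρv, intervalIntegral.integral_add (hcv.sub c1) d1, intervalIntegral.integral_sub hcv c1,
        c2, d2, intervalIntegral.integral_smul, intervalIntegral.integral_smul]
    rw [e4, e3, hn2, ← hint]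
    module
  -- modified velocity
  set u : ℝ → Pt := fun t => if t ∈ Ioc e1 e2 then v e1 else v t with hu
  have uE : ∀ t ∈ Icc e1 e2, u t = v e1 := by
    intro t ht
    by_cases h : t ∈ Ioc e1 e2
    · simp only [hu, if_pos h]
    · have : t = e1 := by
        by_contra hne
        exact h ⟨lt_of_le_of_ne ht.1 (Ne.symm hne), ht.2⟩
      simp only [hu, if_neg h]
      rw [this]
  have uL : ∀ t, t ≤ e1 → u t = v t := by
    intro t ht
    simp only [hu]
    rw [if_neg (fun h => by linarith [h.1])]
  have uR : ∀ t, e2 ≤ t → u t = v t := by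
    intro t ht
    rcases eq_or_lt_of_le ht with h | h
    · rw [← h, uE e2 ⟨he.le, le_rfl⟩, hve]
    · simp only [hu]
      rw [if_neg (fun h' => by linarith [h'.2])]
  have hρu : (fun t => ρ t • u t) = fun t => ρ t • v t := by
    funext t
    by_cases h : t ∈ Ioc e1 e2
    · rw [ρE t h, zero_smul, zero_smul]
    · simp only [hu, if_neg h]
  set b := a / (1 + δ) with hb
  have hb0 : 0 ≤ b := by positivity
  have iρ' : ∀ s ∈ Icc 0 T, ∀ s' ∈ Icc 0 T, IntervalIntegrable ρ volume s s' := by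
    intro s hs s' hs'
    apply iρ.mono_set
    rw [uIcc_of_le hT]
    exact OrdConnected.uIcc_subset ordConnected_Icc hs hs'
  have low : ∀ s ∈ Icc 0 T, ∀ s' ∈ Icc 0 T, s ≤ s' → (∀ t ∈ Ioo s s', t ∉ Ioc e1 e2) →
      a * (s' - s) ≤ b * ∫ t in s..s', ρ t := by
    intro s hs s' hs' h hE
    have h1 : ∫ t in s..s', (1 + δ) ≤ ∫ t in s..s', ρ t := by
      apply intervalIntegral.integral_mono_on_of_le_Ioo h intervalIntegrable_const
        (iρ' s hs s' hs')
      intro t ht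
      exact ρnE t (hE t ht)
    rw [intervalIntegral.integral_const, smul_eq_mul] at h1
    have h2 : a * (s' - s) = b * ((s' - s) * (1 + δ)) := by rw [hb]; field_simp
    rw [h2]
    exact mul_le_mul_of_nonneg_left h1 hb0
  have glue : ∀ x ∈ Icc 0 T, ∀ y ∈ Icc 0 T, ∀ w ∈ Icc 0 T,
      ‖u y - u x‖ ≤ b * ∫ t in x..y, ρ t → ‖u w - u y‖ ≤ b * ∫ t in y..w, ρ t →
      ‖u w - u x‖ ≤ b * ∫ t in x..w, ρ t := by
    intro x hx y hy w hw h1 h2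
    rw [← intervalIntegral.integral_add_adjacent_intervals (iρ' x hx y hy) (iρ' y hy w hw), mul_add]
    have : u w - u x = (u w - u y) + (u y - u x) := by abel
    rw [this]
    exact (norm_add_le _ _).trans (by linarith)
  have m1 : e1 ∈ Icc 0 T := ⟨he1, by linarith⟩
  have m2 : e2 ∈ Icc 0 T := ⟨by linarith, he2⟩
  have PL : ∀ s ∈ Icc 0 T, ∀ s' ∈ Icc 0 T, s ≤ s' → s' ≤ e1 →
      ‖u s' - u s‖ ≤ b * ∫ t in s..s', ρ t := by
    intro s hs s' hs' h h'
    rw [uL s' h', uL s (h.trans h')]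
    refine (hL s hs s' hs' h).trans (low s hs s' hs' h ?_)
    intro t ht ht'
    linarith [ht.2, ht'.1]
  have PR : ∀ s ∈ Icc 0 T, ∀ s' ∈ Icc 0 T, s ≤ s' → e2 ≤ s →
      ‖u s' - u s‖ ≤ b * ∫ t in s..s', ρ t := by
    intro s hs s' hs' h h'
    rw [uR s' (h'.trans h), uR s h']
    refine (hL s hs s' hs' h).trans (low s hs s' hs' h ?_)
    intro t ht ht'
    linarith [ht.1, ht'.2]
  have PE : ∀ s ∈ Icc e1 e2, ∀ s' ∈ Icc e1 e2, s ≤ s' →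
      ‖u s' - u s‖ ≤ b * ∫ t in s..s', ρ t := by
    intro s hs s' hs' h
    rw [uE s hs, uE s' hs', sub_self, norm_zero]
    exact mul_nonneg hb0 (intervalIntegral.integral_nonneg h (fun t _ => ρ0 t))
  -- from the left part and the middle
  have PLE : ∀ s ∈ Icc 0 T, ∀ s' ∈ Icc 0 T, s ≤ s' → s' ≤ e2 →
      ‖u s' - u s‖ ≤ b * ∫ t in s..s', ρ t := by
    intro s hs s' hs' h h'
    rcases le_total s' e1 with g | g
    · exact PL s hs s' hs' h g
    · rcases le_total s e1 with g' | g'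
      · exact glue s hs e1 m1 s' hs' (PL s hs e1 m1 g' le_rfl)
          (PE e1 ⟨le_rfl, he.le⟩ s' ⟨g, h'⟩ g)
      · exact PE s ⟨g', h.trans h'⟩ s' ⟨g, h'⟩ h
  have hLip : ∀ s ∈ Icc 0 T, ∀ s' ∈ Icc 0 T, s ≤ s' →
      ‖u s' - u s‖ ≤ b * ∫ t in s..s', ρ t := by
    intro s hs s' hs' h
    rcases le_total s' e2 with g | g
    · exact PLE s hs s' hs' h g
    · rcases le_total s e2 with g' | g'
      · exact glue s hs e2 m2 s' hs' (PLE s hs e2 m2 g' le_rfl) (PR e2 m2 s' hs' g le_rfl)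
      · exact PR s hs s' hs' h g'
  have hunit' : ∀ t ∈ Icc 0 T, ‖u t‖ = 1 := by
    intro t ht
    by_cases h : t ∈ Ioc e1 e2
    · rw [uE t (Ioc_subset_Icc_self h)]; exact hunit _ m1
    · simp only [hu, if_neg h]; exact hunit _ ht
  obtain ⟨w, w', h1, h2⟩ := reparam T b hT hb0 u ρ z0 zf ρ0 iρ (by rw [hρu]; exact iρv) hLip hunit'
    hR (by rw [show (∫ t in (0:ℝ)..T, ρ t • u t) = ∫ t in (0:ℝ)..T, ρ t • v t from
      congrArg (fun f => ∫ t in (0:ℝ)..T, f t) hρu]; exact hW)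
  rw [uL 0 he1, uR T he2] at h1
  refine ⟨b, w, w', hb0, ?_, h1, h2⟩
  rw [hb, div_lt_iff₀ (by positivity)]
  nlinarith

theorem fold_int (v : ℝ → Pt) (T m η : ℝ) (hη : 0 ≤ η) (h0 : 0 ≤ m - η) (hT : m + η ≤ T)
    (hv : ContinuousOn v (Icc 0 T)) (hs : ∀ x ∈ Icc 0 η, v (m - x) = v (m + x)) :
    ∫ t in (m - η)..(m + η), v t = (2 : ℝ) • ∫ x in (0:ℝ)..η, v (m + x) := by
  have i1 : IntervalIntegrable v volume (m - η) m := by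
    apply ContinuousOn.intervalIntegrable
    rw [uIcc_of_le (by linarith)]
    exact hv.mono (Icc_subset_Icc h0 (by linarith))
  have i2 : IntervalIntegrable v volume m (m + η) := by
    apply ContinuousOn.intervalIntegrable
    rw [uIcc_of_le (by linarith)]
    exact hv.mono (Icc_subset_Icc (by linarith) hT)
  rw [← intervalIntegral.integral_add_adjacent_intervals i1 i2]
  have e1 : ∫ t in (m - η)..m, v t = ∫ x in (0:ℝ)..η, v (m - x) := by
    rw [intervalIntegral.integral_comp_sub_left (fun t => v t), sub_zero]
  have e2 : ∫ t in m..(m + η), v t = ∫ x in (0:ℝ)..η, v (m + x) := by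
    rw [intervalIntegral.integral_comp_add_left (fun t => v t), add_zero]
  have e3 : ∫ x in (0:ℝ)..η, v (m - x) = ∫ x in (0:ℝ)..η, v (m + x) := by
    refine intervalIntegral.integral_congr (fun x hx => ?_)
    rw [uIcc_of_le hη] at hx
    exact hs x hx
  rw [e1, e2, e3, two_smul]

/-- Lemma 6 of the paper: a `CCCC` trajectory is not a solution.
If the admissible curve `z`, of maximum curvature `a > 0`, is a concatenation of four
circular arcs of curvature `a` with alternating orientations along the partition
`0 < s1 < s2 < s3 < tf`, then `z` is not a minimiser of Problem (P) for its data. -/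
theorem stmt9 (z0 v0 zf vf : Pt) (tf a : ℝ) (htf : 0 < tf) (ha : 0 < a)
    (z z' : ℝ → Pt)
    (hadm : AdmissibleOn 0 tf z0 v0 zf vf z z')
    (hcurv : maxCurvOn (Icc 0 tf) z' = a)
    (s1 s2 s3 : ℝ) (h01 : 0 < s1) (h12 : s1 < s2) (h23 : s2 < s3) (h3f : s3 < tf)
    (ω1 ω2 ω3 ω4 : ℝ)
    (hω1 : |ω1| = a) (hω2 : ω2 = -ω1) (hω3 : ω3 = -ω2) (hω4 : ω4 = -ω3)
    (harc1 : IsArcOn z' ω1 0 s1) (harc2 : IsArcOn z' ω2 s1 s2)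
    (harc3 : IsArcOn z' ω3 s2 s3) (harc4 : IsArcOn z' ω4 s3 tf) :
    ¬ ∀ w w' : ℝ → Pt, AdmissibleOn 0 tf z0 v0 zf vf w w' →
        maxCurvOn (Icc 0 tf) z' ≤ maxCurvOn (Icc 0 tf) w' := by

  obtain ⟨hder, ⟨K, hK⟩, hunit, hz0, hzf, hv0, hvf⟩ := hadm
  have hcont : ContinuousOn z' (Icc 0 tf) := hK.continuousOn
  have hω0 : ω1 ≠ 0 := by
    intro h
    rw [h, abs_zero] at hω1
    linarith
  -- the curvature bound is attained
  have hL : ∀ s ∈ Icc 0 tf, ∀ s' ∈ Icc 0 tf, s ≤ s' → ‖z' s' - z' s‖ ≤ a * (s' - s) := by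
    intro s hs s' hs' h
    have hne : {a : ℝ | 0 ≤ a ∧ LipschitzOnWith (Real.toNNReal a) z' (Icc 0 tf)}.Nonempty :=
      ⟨K, K.coe_nonneg, by rwa [Real.toNNReal_coe]⟩
    have hb : ∀ b, a < b → ‖z' s' - z' s‖ ≤ b * (s' - s) := by
      intro b hab
      rw [← hcurv] at hab
      obtain ⟨c, ⟨hc0, hc⟩, hcb⟩ := exists_lt_of_csInf_lt hne hab
      have := hc.dist_le_mul s' hs' s hs
      rw [dist_eq_norm, Real.dist_eq, Real.coe_toNNReal _ hc0, abs_of_nonneg (by linarith)] at this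
      exact this.trans (mul_le_mul_of_nonneg_right hcb.le (by linarith))
    refine le_of_forall_pos_le_add (fun ε hε => ?_)
    rcases eq_or_lt_of_le h with h' | h'
    · subst h'
      simp only [sub_self, norm_zero, mul_zero, zero_add]
      exact hε.le
    · have hpos : 0 < s' - s := by linarith
      have := hb (a + ε / (s' - s)) (by have : 0 < ε / (s' - s) := by positivity
                                        linarith)
      refine this.trans (le_of_eq ?_)
      field_simp
  have hzint : ∫ t in (0:ℝ)..tf, z' t = zf - z0 := by
    rw [← hz0, ← hzf]
    apply intervalIntegral.integral_eq_sub_of_hasDerivAt_of_le htf.le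
    · exact fun t ht => (hder t ht).continuousWithinAt
    · intro t ht
      exact (hder t (Ioo_subset_Icc_self ht)).hasDerivAt (Icc_mem_nhds ht.1 ht.2)
    · apply ContinuousOn.intervalIntegrable
      rwa [uIcc_of_le htf.le]
  have sub : ∀ x y : ℝ, 0 ≤ x → y ≤ tf → LipschitzOnWith K z' (Icc x y) :=
    fun x y hx hy => hK.mono (Icc_subset_Icc hx hy)
  -- reflection symmetry at the switching times
  have sy1 := switch_symm z' ω1 0 s1 s2 h01.le h12.le K (sub _ _ le_rfl (by linarith)) harc1
    (by rwa [← hω2])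
  have sy2 := switch_symm z' ω2 s1 s2 s3 h12.le h23.le K (sub _ _ (by linarith) (by linarith))
    harc2 (by rwa [← hω3])
  have sy3 := switch_symm z' ω3 s2 s3 tf h23.le h3f.le K (sub _ _ (by linarith) (by linarith))
    harc3 (by rwa [← hω4])
  have arcmono : ∀ ω x y x' y' : ℝ, x ≤ x' → y' ≤ y → IsArcOn z' ω x y → IsArcOn z' ω x' y' := by
    intro ω x y x' y' hx hy h
    filter_upwards [h] with t ht hmem
    exact ht ⟨by linarith [hmem.1], by linarith [hmem.2]⟩
  have main : ∃ (b : ℝ) (w w' : ℝ → Pt), 0 ≤ b ∧ b < a ∧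
      AdmissibleOn 0 tf z0 (z' 0) zf (z' tf) w w' ∧
      LipschitzOnWith (Real.toNNReal b) w' (Icc 0 tf) := by
    rcases le_total (s3 - s2) (s2 - s1) with hc | hc
    · -- delete the neighbourhood of `s3`
      set η := min ((s3 - s2) / 2) (tf - s3) with hη
      have hη0 : 0 < η := lt_min (by linarith) (by linarith)
      have hη1 : η ≤ (s3 - s2) / 2 := min_le_left _ _
      have hη2 : η ≤ tf - s3 := min_le_right _ _
      have hfold : ∀ x ∈ Icc 0 η, z' (s3 - x) = z' (s3 + x) := fun x hx =>
        sy3 x hx.1 (by linarith [hx.2]) (by linarith [hx.2])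
      refine core_s9 tf a ha z' z0 zf (2 * s2 - s3) (2 * s2 - s3 + η) (s3 - η) (s3 + η)
        (by linarith) (by linarith) (by linarith) (by linarith) (by linarith) (by linarith)
        (Or.inl (by linarith)) (by ring) ?_ (hfold η ⟨hη0.le, le_rfl⟩) ?_ hL hcont hunit hzint
      · rw [fold_int z' tf s3 η hη0.le (by linarith) (by linarith) hcont hfold]
        congr 1
        have e2 : ∫ t in (2 * s2 - s3)..(2 * s2 - s3 + η), z' t =
            ∫ x in (0:ℝ)..η, z' (2 * s2 - s3 + x) := by
          rw [intervalIntegral.integral_comp_add_left (fun t => z' t), add_zero]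
        rw [e2]
        refine intervalIntegral.integral_congr (fun x hx => ?_)
        rw [uIcc_of_le hη0.le] at hx
        have := sy2 (s3 - s2 - x) (by linarith [hx.2]) (by linarith [hx.1]) (by linarith [hx.1])
        rw [show s2 - (s3 - s2 - x) = 2 * s2 - s3 + x by ring,
          show s2 + (s3 - s2 - x) = s3 - x by ring, hfold x hx] at this
        exact this.symm
      · refine arc_indep z' ω2 _ _ (by rw [hω2]; exact neg_ne_zero.mpr hω0) (by linarith) K
          (sub _ _ (by linarith) (by linarith))
          (arcmono ω2 s1 s2 _ _ (by linarith) (by linarith) harc2)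
          (hunit _ ⟨by linarith, by linarith⟩)
    · -- delete the neighbourhood of `s1`
      set η := min ((s2 - s1) / 2) s1 with hη
      have hη0 : 0 < η := lt_min (by linarith) (by linarith)
      have hη1 : η ≤ (s2 - s1) / 2 := min_le_left _ _
      have hη2 : η ≤ s1 := min_le_right _ _
      have hfold : ∀ x ∈ Icc 0 η, z' (s1 - x) = z' (s1 + x) := fun x hx =>
        sy1 x hx.1 (by linarith [hx.2]) (by linarith [hx.2])
      refine core_s9 tf a ha z' z0 zf (2 * s2 - s1 - η) (2 * s2 - s1) (s1 - η) (s1 + η)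
        (by linarith) (by linarith) (by linarith) (by linarith) (by linarith) (by linarith)
        (Or.inr (by linarith)) (by ring) ?_ (hfold η ⟨hη0.le, le_rfl⟩) ?_ hL hcont hunit hzint
      · rw [fold_int z' tf s1 η hη0.le (by linarith) (by linarith) hcont hfold]
        congr 1
        have e2 : ∫ t in (2 * s2 - s1 - η)..(2 * s2 - s1), z' t =
            ∫ x in (0:ℝ)..η, z' (2 * s2 - s1 - x) := by
          rw [intervalIntegral.integral_comp_sub_left (fun t => z' t), sub_zero]
        rw [e2]
        refine intervalIntegral.integral_congr (fun x hx => ?_)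
        rw [uIcc_of_le hη0.le] at hx
        have := sy2 (s2 - s1 - x) (by linarith [hx.2]) (by linarith [hx.1]) (by linarith [hx.1])
        rw [show s2 - (s2 - s1 - x) = s1 + x by ring,
          show s2 + (s2 - s1 - x) = 2 * s2 - s1 - x by ring] at this
        exact this
      · refine arc_indep z' ω3 _ _ (by rw [hω3, hω2, neg_neg]; exact hω0) (by linarith) K
          (sub _ _ (by linarith) (by linarith))
          (arcmono ω3 s2 s3 _ _ (by linarith) (by linarith) harc3)
          (hunit _ ⟨by linarith, by linarith⟩)
  obtain ⟨b, w, w', hb0, hba, hw, hlip⟩ := main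
  rw [hv0, hvf] at hw
  intro hmin
  have h1 := hmin w w' hw
  have h2 : maxCurvOn (Icc 0 tf) w' ≤ b :=
    csInf_le ⟨0, fun x hx => hx.1⟩ ⟨hb0, hlip⟩
  rw [hcurv] at h1
  linarith
end
end
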